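/- (Intermediate structure theorem.) Let K ≥ 1 be a real number and let P be a set of n points in the real projective plane ℝP² spanning at most Kn ordinary lines. Then at least one of the following holds: (i) there is an irreducible cubic γ and a set S of at most 2^75·K^5 points such that P ⊆ γ ∪ S; (ii) there is an irreducible conic σ and a collection of at most 2^64·K^4 lines whose union together with σ contains P, and moreover n/2 − 2^76·K^5 ≤ |P ∩ σ| ≤ n/2 + 2^76·K^5 and the set P ∖ σ spans at most 2^62·K^4·n ordinary lines; (iii) there is a collection of at most 2^16·K lines and a set S of at most 2^87·K^6 points such that P is contained in the union of these lines and S. -/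

import Mathlib

/-- The real projective plane: one-dimensional subspaces of `ℝ³`. -/
abbrev RP2 := Projectivization ℝ (Fin 3 → ℝ)

/-- A line in `ℝP²`: the set of points contained in a fixed
two-dimensional linear subspace of `ℝ³`. -/
def IsProjLine (L : Set RP2) : Prop :=
  ∃ W : Submodule ℝ (Fin 3 → ℝ), Module.finrank ℝ W = 2 ∧
    L = {x : RP2 | x.submodule ≤ W}

/-- The number of ordinary lines of `P`: lines containing exactly two points of `P`. -/
noncomputable def numOrdinaryLines (P : Set RP2) : ℕ :=
  {L : Set RP2 | IsProjLine L ∧ (P ∩ L).ncard = 2}.ncard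

/-- An irreducible cubic in `ℝP²`: the zero set of an irreducible homogeneous
polynomial of degree `3` in three real variables. -/
def IsIrreducibleCubic (Z : Set RP2) : Prop :=
  ∃ p : MvPolynomial (Fin 3) ℝ, Irreducible p ∧ p.IsHomogeneous 3 ∧
    Z = {x : RP2 | MvPolynomial.eval x.rep p = 0}

/-- An irreducible conic in `ℝP²`: the zero set of an irreducible homogeneous
polynomial of degree `2` in three real variables. -/
def IsIrreducibleConic (Z : Set RP2) : Prop :=
  ∃ p : MvPolynomial (Fin 3) ℝ, Irreducible p ∧ p.IsHomogeneous 2 ∧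
    Z = {x : RP2 | MvPolynomial.eval x.rep p = 0}



namespace OL

/-- Vectors in `ℝ³`. -/
abbrev V3 := Fin 3 → ℝ

/-- dot product -/
def dt (a x : V3) : ℝ := a 0 * x 0 + a 1 * x 1 + a 2 * x 2

/-- cross product -/
def cr (a b : V3) : V3 :=
  ![a 1 * b 2 - a 2 * b 1, a 2 * b 0 - a 0 * b 2, a 0 * b 1 - a 1 * b 0]

@[simp] lemma cr_0 (a b : V3) : cr a b 0 = a 1 * b 2 - a 2 * b 1 := rfl
@[simp] lemma cr_1 (a b : V3) : cr a b 1 = a 2 * b 0 - a 0 * b 2 := rfl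
@[simp] lemma cr_2 (a b : V3) : cr a b 2 = a 0 * b 1 - a 1 * b 0 := rfl

lemma v3_ext {a b : V3} (h0 : a 0 = b 0) (h1 : a 1 = b 1) (h2 : a 2 = b 2) : a = b := by
  funext i; fin_cases i <;> assumption

@[simp] lemma dt_add (a x y : V3) : dt a (x + y) = dt a x + dt a y := by
  simp [dt]; ring
@[simp] lemma dt_sub (a x y : V3) : dt a (x - y) = dt a x - dt a y := by
  simp [dt]; ring
@[simp] lemma dt_smul (a x : V3) (c : ℝ) : dt a (c • x) = c * dt a x := by
  simp [dt]; ring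
@[simp] lemma dt_neg (a x : V3) : dt a (-x) = - dt a x := by
  simp [dt]; ring
@[simp] lemma dt_zero (a : V3) : dt a 0 = 0 := by simp [dt]
@[simp] lemma smul_dt (a x : V3) (c : ℝ) : dt (c • a) x = c * dt a x := by
  simp [dt]; ring
lemma dt_comm (a x : V3) : dt a x = dt x a := by simp [dt]; ring

lemma dt_self_pos {a : V3} (h : a ≠ 0) : 0 < dt a a := by
  by_contra hc
  apply h
  have h0 : dt a a = a 0 ^ 2 + a 1 ^ 2 + a 2 ^ 2 := by simp [dt]; ring
  apply v3_ext <;> simp <;> nlinarith [sq_nonneg (a 0), sq_nonneg (a 1), sq_nonneg (a 2)]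

lemma dt_cr_left (a b : V3) : dt (cr a b) a = 0 := by simp [dt]; ring
lemma dt_cr_right (a b : V3) : dt (cr a b) b = 0 := by simp [dt]; ring
lemma dt_left_cr (a b : V3) : dt a (cr a b) = 0 := by simp [dt]; ring
lemma dt_right_cr (a b : V3) : dt b (cr a b) = 0 := by simp [dt]; ring
lemma cr_swap (a b : V3) : cr a b = - cr b a := by
  apply v3_ext <;> simp <;> ring
lemma cr_smul (c : ℝ) (a b : V3) : cr a (c • b) = c • cr a b := by
  apply v3_ext <;> simp <;> ring
lemma cr_add (a b c : V3) : cr a (b + c) = cr a b + cr a c := by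
  apply v3_ext <;> simp <;> ring
lemma cr_sub (a b c : V3) : cr a (b - c) = cr a b - cr a c := by
  apply v3_ext <;> simp <;> ring
lemma cr_self (a : V3) : cr a a = 0 := by
  apply v3_ext <;> simp <;> ring
lemma cr_neg (a b : V3) : cr a (-b) = - cr a b := by
  apply v3_ext <;> simp <;> ring
lemma neg_cr (a b : V3) : cr (-a) b = - cr a b := by
  apply v3_ext <;> simp <;> ring

/-- triple product -/
def d3 (u v w : V3) : ℝ := dt (cr u v) w

lemma d3_cyc (u v w : V3) : d3 v w u = d3 u v w := by simp [d3, dt]; ring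
lemma d3_swap (u v w : V3) : d3 u w v = - d3 u v w := by simp [d3, dt]; ring
lemma d3_self (u v : V3) : d3 u v v = 0 := dt_cr_right u v
lemma d3_self' (u v : V3) : d3 u v u = 0 := dt_cr_left u v

/-- Cramer -/
lemma cramer (u v w y : V3) :
    d3 u v w • y = d3 y v w • u + d3 u y w • v + d3 u v y • w := by
  apply v3_ext <;> simp [d3, dt] <;> ring

lemma cr_ne_left {a b : V3} (h : cr a b ≠ 0) : a ≠ 0 := by
  rintro rfl; apply h; apply v3_ext <;> simp
lemma cr_ne_right {a b : V3} (h : cr a b ≠ 0) : b ≠ 0 := by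
  rintro rfl; apply h; apply v3_ext <;> simp
lemma cr_ne_swap {a b : V3} (h : cr a b ≠ 0) : cr b a ≠ 0 := by
  intro h'; apply h; rw [cr_swap, h', neg_zero]

lemma par_of_cr {a b : V3} (ha : a ≠ 0) (h : cr a b = 0) : ∃ c : ℝ, b = c • a := by
  have hp := dt_self_pos ha
  refine ⟨dt a b / dt a a, ?_⟩
  have e0 : a 1 * b 2 - a 2 * b 1 = 0 := congrFun h 0
  have e1 : a 2 * b 0 - a 0 * b 2 = 0 := congrFun h 1
  have e2 : a 0 * b 1 - a 1 * b 0 = 0 := congrFun h 2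
  apply v3_ext <;> simp only [Pi.smul_apply, smul_eq_mul] <;> field_simp <;> simp only [dt]
  · linear_combination a 2 * e1 - a 1 * e2
  · linear_combination a 0 * e2 - a 2 * e0
  · linear_combination a 1 * e0 - a 0 * e1

lemma par_cr_of_perp {a b x : V3} (h : cr a b ≠ 0) (ha : dt a x = 0) (hb : dt b x = 0) :
    ∃ c : ℝ, x = c • cr a b := by
  apply par_of_cr h
  simp only [dt] at ha hb
  apply v3_ext <;> simp
  · linear_combination b 0 * ha - a 0 * hb
  · linear_combination b 1 * ha - a 1 * hb
  · linear_combination b 2 * ha - a 2 * hb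

lemma perp_par {a v w : V3} (h : cr v w ≠ 0) (hv : dt a v = 0) (hw : dt a w = 0) :
    ∃ c : ℝ, a = c • cr v w :=
  par_cr_of_perp h (by rw [dt_comm]; exact hv) (by rw [dt_comm]; exact hw)

/-- coplanar decomposition -/
lemma coplanar_decomp {v w y : V3} (h : cr v w ≠ 0) (hy : d3 v w y = 0) :
    ∃ α β : ℝ, y = α • v + β • w := by
  have hp := dt_self_pos h
  have hc := cramer v w (cr v w) y
  rw [hy, zero_smul, add_zero] at hc
  have : d3 v w (cr v w) = dt (cr v w) (cr v w) := rfl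
  rw [this] at hc
  refine ⟨(dt (cr v w) (cr v w))⁻¹ * d3 y w (cr v w), (dt (cr v w) (cr v w))⁻¹ * d3 v y (cr v w), ?_⟩
  rw [mul_smul, mul_smul, ← smul_add, ← hc, smul_smul, inv_mul_cancel₀ hp.ne', one_smul]

/-- An arrangement of lines in the projective plane (vectors give the dual planes). -/
structure Arr (ι : Type) where
  a : ι → V3
  ne : ∀ i j, i ≠ j → cr (a i) (a j) ≠ 0
  span : ∀ x, (∀ i, dt (a i) x = 0) → x = 0

variable {ι : Type}

/-- vertex on the sphere -/
def Vert (A : Arr ι) (v : V3) : Prop :=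
  ‖v‖ = 1 ∧ ∃ i j, i ≠ j ∧ dt (A.a i) v = 0 ∧ dt (A.a j) v = 0

/-- weakly on the same side of all lines -/
def Compat (A : Arr ι) (v w : V3) : Prop := ∀ j, 0 ≤ dt (A.a j) v * dt (A.a j) w

/-- adjacency of vertices -/
structure Adj (A : Arr ι) (v w : V3) : Prop where
  vl : Vert A v
  vr : Vert A w
  ind : cr v w ≠ 0
  line : ∃ i, dt (A.a i) v = 0 ∧ dt (A.a i) w = 0
  compat : Compat A v w

/-- positively oriented triangular face -/
structure T (A : Arr ι) (v w x : V3) : Prop where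
  pos : 0 < d3 v w x
  a1 : Adj A v w
  a2 : Adj A w x
  a3 : Adj A x v

variable {A : Arr ι}

lemma Compat.symm {v w : V3} (h : Compat A v w) : Compat A w v := fun j => by
  rw [mul_comm]; exact h j

lemma Adj.symm {v w : V3} (h : Adj A v w) : Adj A w v :=
  ⟨h.vr, h.vl, cr_ne_swap h.ind, by obtain ⟨i, h1, h2⟩ := h.line; exact ⟨i, h2, h1⟩, h.compat.symm⟩

lemma T.cyc {v w x : V3} (h : T A v w x) : T A w x v :=
  ⟨by rw [d3_cyc]; exact h.pos, h.a2, h.a3, h.a1⟩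

lemma Vert.ne_zero {v : V3} (h : Vert A v) : v ≠ 0 := by
  rintro rfl; simpa using h.1

lemma A_ne (A : Arr ι) {i j : ι} (h : i ≠ j) : A.a i ≠ 0 := cr_ne_left (A.ne i j h)

lemma Vert.a_ne {v : V3} (h : Vert A v) (i : ι) : A.a i ≠ 0 := by
  obtain ⟨-, j, k, hjk, -⟩ := h
  by_cases hij : i = j
  · subst hij; exact A_ne A hjk
  · exact A_ne A hij

/-- two lines through two independent vectors coincide -/
lemma line_unique {v w : V3} (h : cr v w ≠ 0) {i j : ι} (h1 : dt (A.a i) v = 0)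
    (h2 : dt (A.a i) w = 0) (h3 : dt (A.a j) v = 0) (h4 : dt (A.a j) w = 0) : i = j := by
  by_contra hij
  apply A.ne i j hij
  obtain ⟨c, hc⟩ := perp_par h h1 h2
  obtain ⟨d, hd⟩ := perp_par h h3 h4
  rw [hc, hd]
  apply v3_ext <;> simp <;> ring

/-- line functional of an edge -/
lemma Adj.fun_eq {v w : V3} (h : Adj A v w) {i : ι} (h1 : dt (A.a i) v = 0)
    (h2 : dt (A.a i) w = 0) : ∃ c : ℝ, c ≠ 0 ∧ ∀ x, dt (A.a i) x = c * d3 v w x := by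
  obtain ⟨c, hc⟩ := perp_par h.ind h1 h2
  refine ⟨c, ?_, fun x => by rw [hc, smul_dt]; rfl⟩
  rintro rfl
  exact h.vl.a_ne i (by rw [hc, zero_smul])

lemma Adj.side {v x y z : V3} (h : Adj A v x) (hc : Compat A y z) :
    0 ≤ d3 v x y * d3 v x z := by
  obtain ⟨i, h1, h2⟩ := h.line
  obtain ⟨c, hc0, hf⟩ := h.fun_eq h1 h2
  have := hc i
  rw [hf, hf] at this
  have h2 : 0 < c ^ 2 := by positivity
  by_contra hn
  nlinarith

lemma norm_eq_of_smul {v w : V3} (hv : ‖v‖ = 1) (hw : ‖w‖ = 1) {c : ℝ} (hc : 0 < c)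
    (h : w = c • v) : w = v := by
  have : ‖w‖ = |c| * ‖v‖ := by rw [h, norm_smul, Real.norm_eq_abs]
  rw [hv, hw, abs_of_pos hc, mul_one] at this
  rw [h, ← this, one_smul]

/-- uniqueness of triangle -/
lemma T.unique {v w x x' : V3} (h : T A v w x) (h' : T A v w x') : x = x' := by
  have e1 : d3 v x w = - d3 v w x := d3_swap v w x
  have e2 : d3 v x' w = - d3 v w x' := d3_swap v w x'
  have s1 := h.a3.symm.side h'.a2.compat
  have s2 := h'.a3.symm.side h.a2.compat
  have e3 : d3 v x' x = - d3 v x x' := d3_swap v x x'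
  have p := h.pos
  have p' := h'.pos
  have z1 : d3 v x x' = 0 := by
    rw [e1] at s1; rw [e2, e3] at s2
    apply le_antisymm <;> by_contra hn <;> push Not at hn <;> nlinarith
  have f1 : d3 w x v = d3 v w x := d3_cyc v w x
  have f2 : d3 w x' v = d3 v w x' := d3_cyc v w x'
  have t1 := h.a2.side h'.a3.compat.symm
  have t2 := h'.a2.side h.a3.compat.symm
  have f3 : d3 w x' x = - d3 w x x' := d3_swap w x x'
  have z2 : d3 w x x' = 0 := by
    rw [f1] at t1; rw [f2, f3] at t2
    apply le_antisymm <;> by_contra hn <;> push Not at hn <;> nlinarith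
  have hcr := cramer v w x x'
  have g1 : d3 x' w x = 0 := by rw [← d3_cyc, z2]
  have g2 : d3 v x' x = 0 := by rw [e3, z1, neg_zero]
  rw [g1, g2, zero_smul, zero_smul, zero_add, zero_add] at hcr
  symm
  apply norm_eq_of_smul h.a2.vr.1 h'.a2.vr.1 (c := (d3 v w x)⁻¹ * d3 v w x') (by positivity)
  rw [mul_smul, ← hcr, smul_smul, inv_mul_cancel₀ p.ne', one_smul]

/-- no vertex strictly between adjacent vertices -/
lemma no_between {v w w' : V3} (hc : Compat A v w) (hi : cr v w ≠ 0) (hv : Vert A w') {α β : ℝ}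
    (hα : 0 < α) (hβ : 0 < β) (h : w' = α • v + β • w) : False := by
  have key : ∀ k, dt (A.a k) w' = 0 → dt (A.a k) v = 0 ∧ dt (A.a k) w = 0 := by
    intro k hk
    rw [h] at hk
    simp only [dt_add, dt_smul] at hk
    have hck := hc k
    have h1 : dt (A.a k) v = 0 := by
      have : α * dt (A.a k) v ^ 2 + β * (dt (A.a k) v * dt (A.a k) w) = 0 := by
        linear_combination dt (A.a k) v * hk
      have h2 : 0 ≤ β * (dt (A.a k) v * dt (A.a k) w) := by positivity
      have h3 : 0 ≤ α * dt (A.a k) v ^ 2 := by positivity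
      have h4 : α * dt (A.a k) v ^ 2 = 0 := by linarith
      simpa [hα.ne'] using h4
    refine ⟨h1, ?_⟩
    rw [h1] at hk
    simpa [hβ.ne'] using hk
  obtain ⟨-, i, j, hij, h1, h2⟩ := hv
  obtain ⟨p1, p2⟩ := key i h1
  obtain ⟨p3, p4⟩ := key j h2
  exact hij (line_unique hi p1 p2 p3 p4)

/-- uniqueness of the neighbour in a given direction -/
lemma Adj.unique {v w w' : V3} (h : Adj A v w) (h' : Adj A v w') {β : ℝ} (hβ : 0 < β)
    (he : cr v w' = β • cr v w) : w' = w := by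
  have h0 : cr v (w' - β • w) = 0 := by rw [cr_sub, cr_smul, he, sub_self]
  obtain ⟨α, hα⟩ := par_of_cr h.vl.ne_zero h0
  have h1 : w' = α • v + β • w := by rw [← hα]; simp
  rcases lt_trichotomy α 0 with ha | ha | ha
  · exfalso
    apply no_between h'.compat h'.ind h.vr (α := β⁻¹ * (-α)) (β := β⁻¹)
      (mul_pos (inv_pos.2 hβ) (by linarith)) (inv_pos.2 hβ)
    rw [h1, smul_add, smul_smul, smul_smul, inv_mul_cancel₀ hβ.ne', one_smul, ← add_assoc, ← add_smul]
    simp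
  · rw [ha, zero_smul, zero_add] at h1
    exact norm_eq_of_smul h.vr.1 h'.vr.1 hβ h1
  · exact (no_between h.compat h.ind h'.vr ha hβ h1).elim

variable [Fintype ι] [DecidableEq ι]

open Classical in
/-- the lines through `v` -/
noncomputable def lines (A : Arr ι) (v : V3) : Finset ι :=
  Finset.univ.filter (fun i => dt (A.a i) v = 0)

@[simp] lemma mem_lines {v : V3} {i : ι} : i ∈ lines A v ↔ dt (A.a i) v = 0 := by
  simp [lines]

lemma T.not_col {v w0 w1 w2 : V3} (hd : (lines A v).card = 3) (h0 : T A v w0 w1)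
    (h1 : T A v w1 w2) : d3 v w0 w2 ≠ 0 := by
  intro hz
  obtain ⟨α, β, hw⟩ := coplanar_decomp h0.a1.ind hz
  obtain ⟨i0, p0, q0⟩ := h0.a1.line
  obtain ⟨i1, p1, q1⟩ := h1.a1.line
  have hβ : β < 0 := by
    have := h1.pos
    rw [hw] at this
    simp only [d3, dt_add, dt_smul, dt_cr_left] at this
    have e : d3 v w1 w0 = - d3 v w0 w1 := d3_swap _ _ _
    simp only [d3] at e
    rw [e] at this
    have := h0.pos
    simp only [d3] at this
    by_contra hn
    push Not at hn
    nlinarith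
  obtain ⟨L, hL, hL'⟩ : ∃ L ∈ lines A v, L ∉ ({i0, i1} : Finset ι) := by
    apply Finset.exists_mem_notMem_of_card_lt_card
    rw [hd]
    exact lt_of_le_of_lt (Finset.card_le_two) (by norm_num)
  simp only [Finset.mem_insert, Finset.mem_singleton, not_or] at hL'
  rw [mem_lines] at hL
  have c1 := h0.a2.compat L
  have c2 := h1.a2.compat L
  rw [hw] at c2
  simp only [dt_add, dt_smul, hL, mul_zero, zero_add] at c2
  have : dt (A.a L) w0 * dt (A.a L) w1 = 0 := by
    apply le_antisymm _ c1
    by_contra hn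
    push Not at hn
    nlinarith
  rcases mul_eq_zero.1 this with h | h
  · exact hL'.1 (line_unique h0.a1.ind hL h p0 q0)
  · exact hL'.2 (line_unique h1.a1.ind hL h p1 q1)

/-- going straight at a vertex of degree three -/
lemma T.straight {v w0 w1 w2 w3 : V3} (hd : (lines A v).card = 3) (h0 : T A v w0 w1)
    (h1 : T A v w1 w2) (h2 : T A v w2 w3) : ∃ β : ℝ, β < 0 ∧ cr v w3 = β • cr v w0 := by
  obtain ⟨i0, p0, q0⟩ := h0.a1.line
  obtain ⟨i1, p1, q1⟩ := h1.a1.line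
  obtain ⟨i2, p2, q2⟩ := h2.a1.line
  obtain ⟨i3, p3, q3⟩ := h2.a3.line
  have hne : ∀ {w w' : V3} {i j : ι}, Adj A v w → d3 v w w' ≠ 0 → dt (A.a i) v = 0 →
      dt (A.a i) w = 0 → dt (A.a j) w' = 0 → i ≠ j := by
    intro w w' i j hw hd' e1 e2 e3 hij
    subst hij
    obtain ⟨c, hc, hf⟩ := hw.fun_eq e1 e2
    rw [hf] at e3
    exact hd' ((mul_eq_zero.1 e3).resolve_left hc)
  have n01 : i0 ≠ i1 := hne h0.a1 h0.pos.ne' p0 q0 q1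
  have n12 : i1 ≠ i2 := hne h1.a1 h1.pos.ne' p1 q1 q2
  have n02 : i0 ≠ i2 := hne h0.a1 (T.not_col hd h0 h1) p0 q0 q2
  have n13 : i1 ≠ i3 := hne h1.a1 (T.not_col hd h1 h2) p1 q1 p3
  have n23 : i2 ≠ i3 := hne h2.a1 h2.pos.ne' p2 q2 p3
  have h03 : i0 = i3 := by
    by_contra hne3
    have hsub : ({i0, i1, i2, i3} : Finset ι) ⊆ lines A v := by
      intro x hx
      simp only [Finset.mem_insert, Finset.mem_singleton] at hx
      rw [mem_lines]
      rcases hx with rfl | rfl | rfl | rfl <;> assumption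
    have := Finset.card_le_card hsub
    rw [hd] at this
    rw [Finset.card_eq_of_equiv_fin (n := 4)] at this
    · omega
    · apply Finset.equivFinOfCardEq
      rw [Finset.card_insert_of_notMem, Finset.card_insert_of_notMem, Finset.card_insert_of_notMem] <;>
      simp [*]
  subst h03
  have hz : d3 v w0 w3 = 0 := by
    obtain ⟨c, hc, hf⟩ := h0.a1.fun_eq p0 q0
    rw [hf] at p3
    exact (mul_eq_zero.1 p3).resolve_left hc
  obtain ⟨α, β, hw⟩ := coplanar_decomp h0.a1.ind hz
  have hcr : cr v w3 = β • cr v w0 := by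
    rw [hw, cr_add, cr_smul, cr_smul, cr_self, smul_zero, zero_add]
  refine ⟨β, ?_, hcr⟩
  have hβ0 : β ≠ 0 := by
    rintro rfl
    rw [zero_smul] at hcr
    exact h2.a3.symm.ind hcr
  have s := h1.a1.side h2.a2.compat
  have e1 := h1.pos
  have e0 := h0.pos
  have e3 : d3 v w1 w3 = - β * d3 v w0 w1 := by
    rw [← neg_neg (d3 v w1 w3), ← d3_swap]
    simp only [d3, hcr, smul_dt]; ring
  rw [e3] at s
  by_contra hn
  push Not at hn
  have : 0 < β := lt_of_le_of_ne hn hβ0.symm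
  have : 0 < d3 v w1 w2 * (β * d3 v w0 w1) := by positivity
  linarith

/-- good vertex -/
structure Good (A : Arr ι) (v : V3) : Prop where
  deg : (lines A v).card = 3
  ex : ∀ w, Adj A v w → ∃ x, T A v w x

lemma fan {v a b c d : V3} (hg : Good A v) (h1 : T A v a b) (h2 : Adj A v c) {β : ℝ} (hβ : β < 0)
    (hc : cr v c = β • cr v a) (h3 : T A v d c) : T A v b d := by
  obtain ⟨y, hy⟩ := hg.ex b h1.a3.symm
  obtain ⟨z, hz⟩ := hg.ex y hy.a3.symm
  obtain ⟨β', hβ', e⟩ := T.straight hg.deg h1 hy hz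
  have : z = c := by
    apply Adj.unique h2 hz.a3.symm (β := β' / β) (div_pos_of_neg_of_neg hβ' hβ)
    rw [hc, e, smul_smul, div_mul_cancel₀ _ hβ.ne]
  subst this
  have : y = d := T.unique hz.cyc.cyc h3.cyc.cyc
  subst this
  exact hy

end OL


set_option linter.unusedSectionVars false

namespace OL

variable {ι : Type} [Fintype ι] [DecidableEq ι] {A : Arr ι}

/-- ray shooting, numerical form -/
lemma shoot_num (p q : ι → ℝ) (hp : ∀ k, 0 ≤ p k) (h0 : ∀ k, p k = 0 → 0 ≤ q k)
    (hq : ∃ k, q k < 0) :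
    ∃ t : ℝ, 0 < t ∧ (∀ k, 0 ≤ p k + t * q k) ∧ ∃ k, p k ≠ 0 ∧ q k < 0 ∧ p k + t * q k = 0 := by
  classical
  obtain ⟨k0, hk0⟩ := hq
  obtain ⟨k, hk, hmin⟩ := Finset.exists_min_image (Finset.univ.filter (fun k => q k < 0))
    (fun k => p k / (- q k)) ⟨k0, by simpa using hk0⟩
  simp only [Finset.mem_filter, Finset.mem_univ, true_and] at hk hmin
  have hpk : p k ≠ 0 := fun h => absurd (h0 k h) (not_le.2 hk)
  have hpos : 0 < p k := lt_of_le_of_ne (hp k) hpk.symm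
  refine ⟨p k / (- q k), div_pos hpos (by linarith), ?_, k, hpk, hk, ?_⟩
  · intro j
    by_cases hj : q j < 0
    · have := hmin j hj
      rw [le_div_iff₀ (by linarith)] at this
      linarith
    · push Not at hj
      have : 0 ≤ p k / (- q k) := (div_pos hpos (by linarith)).le
      have := mul_nonneg this hj
      linarith [hp j]
  · have : q k ≠ 0 := hk.ne
    field_simp
    ring

lemma shoot {x0 x d : V3} (hx : Compat A x0 x)
    (h0 : ∀ k, dt (A.a k) x = 0 → 0 ≤ dt (A.a k) x0 * dt (A.a k) d)
    (hq : ∃ k, dt (A.a k) x0 * dt (A.a k) d < 0) (hx0 : ∀ k, dt (A.a k) x0 ≠ 0) :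
    ∃ t : ℝ, 0 < t ∧ Compat A x0 (x + t • d) ∧ ∃ k, dt (A.a k) x ≠ 0 ∧
      dt (A.a k) d ≠ 0 ∧ dt (A.a k) (x + t • d) = 0 := by
  obtain ⟨t, ht, h1, k, h2, h3, h4⟩ := shoot_num (fun k => dt (A.a k) x0 * dt (A.a k) x)
    (fun k => dt (A.a k) x0 * dt (A.a k) d) hx
    (fun k hk => h0 k ((mul_eq_zero.1 hk).resolve_left (hx0 k))) hq
  refine ⟨t, ht, fun j => ?_, k, ?_, ?_, ?_⟩
  · have := h1 j
    simp only [dt_add, dt_smul]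
    linarith
  · exact fun h => h2 (by simp [h])
  · intro h; rw [h] at h3; simp at h3
  · simp only [dt_add, dt_smul]
    have : dt (A.a k) x0 * (dt (A.a k) x + t * dt (A.a k) d) = 0 := by linarith
    exact (mul_eq_zero.1 this).resolve_left (hx0 k)

lemma compat_trans {x0 x y : V3} (hx0 : ∀ k, dt (A.a k) x0 ≠ 0) (hx : Compat A x0 x)
    (hy : Compat A x0 y) : Compat A x y := by
  intro k
  have h1 := mul_nonneg (hx k) (hy k)
  have h2 : 0 < dt (A.a k) x0 ^ 2 := by have := hx0 k; positivity
  by_contra hn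
  push Not at hn
  nlinarith

lemma vert_normalize {z : V3} (hz : z ≠ 0) {i j : ι} (hij : i ≠ j) (h1 : dt (A.a i) z = 0)
    (h2 : dt (A.a j) z = 0) : Vert A (‖z‖⁻¹ • z) := by
  refine ⟨?_, i, j, hij, by simp [h1], by simp [h2]⟩
  rw [norm_smul, norm_inv, norm_norm, inv_mul_cancel₀ (norm_ne_zero_iff.2 hz)]

lemma compat_smul {x0 z : V3} (h : Compat A x0 z) {c : ℝ} (hc : 0 ≤ c) : Compat A x0 (c • z) := by
  intro k
  have := mul_nonneg hc (h k)
  simp only [dt_smul]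
  linarith

lemma exists_big (p q : ι → ℝ) : ∃ M : ℝ, ∀ k, 0 < q k → 0 < p k + M * q k := by
  classical
  by_cases h : ∃ k, 0 < q k
  · obtain ⟨k0, hk0⟩ := h
    obtain ⟨k, hk, hmin⟩ := Finset.exists_max_image (Finset.univ.filter (fun k => 0 < q k))
      (fun k => - p k / q k) ⟨k0, by simpa using hk0⟩
    simp only [Finset.mem_filter, Finset.mem_univ, true_and] at hk hmin
    refine ⟨- p k / q k + 1, fun j hj => ?_⟩
    have := hmin j hj
    rw [div_le_iff₀ hj] at this
    linarith
  · exact ⟨0, fun k hk => absurd ⟨k, hk⟩ h⟩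

lemma lemE {x0 v d : V3} (hx0 : ∀ k, dt (A.a k) x0 ≠ 0) (hv : Vert A v) (hc : Compat A x0 v)
    {i : ι} (hi : dt (A.a i) v = 0) (hd : dt (A.a i) d = 0)
    (hj : ∃ j, dt (A.a j) v = 0 ∧ dt (A.a j) x0 * dt (A.a j) d < 0) :
    ∃ x, Adj A v x ∧ Compat A x0 x ∧ dt (A.a i) x ≠ 0 := by
  classical
  obtain ⟨j0, hj0, hj1⟩ := hj
  -- first step
  obtain ⟨t, ht, h1, j, h2, h3, h4⟩ := shoot_num
    (fun k => dt (A.a k) x0 * dt (A.a k) x0)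
    (fun k => if dt (A.a k) v = 0 then dt (A.a k) x0 * dt (A.a k) d else 0)
    (fun k => mul_self_nonneg _)
    (fun k hk => absurd (mul_self_eq_zero.1 hk) (hx0 k))
    ⟨j0, by simpa [hj0] using hj1⟩
  have hjv : dt (A.a j) v = 0 := by
    by_contra hn; simp [hn] at h3
  set y := x0 + t • d with hy
  have hyk : ∀ k, dt (A.a k) v = 0 → 0 ≤ dt (A.a k) x0 * dt (A.a k) y := by
    intro k hk
    have := h1 k
    simp only [hk, if_true] at this
    simp only [hy, dt_add, dt_smul]
    linarith
  have hyj : dt (A.a j) y = 0 := by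
    simp only [hjv, if_true] at h4
    have : dt (A.a j) x0 * dt (A.a j) y = 0 := by simp only [hy, dt_add, dt_smul]; linarith
    exact (mul_eq_zero.1 this).resolve_left (hx0 j)
  have hyi : dt (A.a i) y ≠ 0 := by simp [hy, hd, hx0 i]
  obtain ⟨M, hM⟩ := exists_big (fun k => dt (A.a k) x0 * dt (A.a k) y)
    (fun k => dt (A.a k) x0 * dt (A.a k) v)
  set y' := y + M • v with hy'
  have hpos : ∀ k, dt (A.a k) v ≠ 0 → 0 < dt (A.a k) x0 * dt (A.a k) v := fun k hk =>
    lt_of_le_of_ne (hc k) (mul_ne_zero (hx0 k) hk).symm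
  have hpos' : ∀ k, dt (A.a k) v ≠ 0 → 0 < dt (A.a k) x0 * dt (A.a k) y' := fun k hk => by
    have := hM k (hpos k hk)
    simp only [hy', dt_add, dt_smul]
    linarith
  have hcy' : Compat A x0 y' := by
    intro k
    by_cases hk : dt (A.a k) v = 0
    · have := hyk k hk
      simpa [hy', hk] using this
    · exact (hpos' k hk).le
  obtain ⟨k0, hk0⟩ : ∃ k, dt (A.a k) v ≠ 0 := by
    by_contra hn
    push Not at hn
    exact hv.ne_zero (A.span v hn)
  obtain ⟨t', ht', c1, k, c2, c3, c4⟩ := shoot (d := -v) hcy' (fun k hk => by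
      have : dt (A.a k) v = 0 := by
        by_contra hn
        have := hpos' k hn
        rw [hk] at this; simp at this
      simp [this]) ⟨k0, by have := hpos k0 hk0; simp only [dt_neg]; linarith⟩ hx0
  set z := y' + t' • -v with hz
  have hkv : dt (A.a k) v ≠ 0 := by simpa using c3
  have hzi : dt (A.a i) z ≠ 0 := by simp [hz, hy', hi, hyi]
  have hzj : dt (A.a j) z = 0 := by simp [hz, hy', hjv, hyj]
  have hz0 : z ≠ 0 := by intro h; rw [h] at hzi; simp at hzi
  have hn : 0 < ‖z‖⁻¹ := inv_pos.2 (norm_pos_iff.2 hz0)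
  have hjk : j ≠ k := by rintro rfl; exact hkv hjv
  have hxi : dt (A.a i) (‖z‖⁻¹ • z) ≠ 0 := by
    rw [dt_smul]; exact mul_ne_zero hn.ne' hzi
  have hcx : Compat A x0 (‖z‖⁻¹ • z) := compat_smul c1 hn.le
  refine ⟨‖z‖⁻¹ • z, ⟨hv, vert_normalize hz0 hjk hzj c4, ?_, ⟨j, hjv, by simp [hzj]⟩, ?_⟩, hcx, hxi⟩
  · intro hcr
    obtain ⟨c, hc⟩ := par_of_cr hv.ne_zero hcr
    rw [hc] at hxi
    simp [hi] at hxi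
  · exact compat_trans hx0 hc hcx

lemma add_perp_ne {x d : V3} (hx : x ≠ 0) (h : dt x d = 0) (t : ℝ) : x + t • d ≠ 0 := by
  intro he
  have := dt_self_pos hx
  have h2 : dt x (x + t • d) = 0 := by rw [he]; simp
  rw [dt_add, dt_smul, h] at h2
  linarith

lemma cr_ne_of_perp {x d : V3} (hx : x ≠ 0) (hd : d ≠ 0) (h : dt x d = 0) : cr x d ≠ 0 := by
  intro hc
  obtain ⟨c, rfl⟩ := par_of_cr hx hc
  have := dt_self_pos hx
  rw [dt_smul] at h
  rcases mul_eq_zero.1 h with h | h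
  · exact hd (by simp [h])
  · linarith

lemma exists_neg {x0 d : V3} (hx0 : ∀ k, dt (A.a k) x0 ≠ 0) (hd : d ≠ 0) :
    ∃ d' : V3, (d' = d ∨ d' = -d) ∧ ∃ k, dt (A.a k) x0 * dt (A.a k) d' < 0 := by
  obtain ⟨k, hk⟩ : ∃ k, dt (A.a k) d ≠ 0 := by
    by_contra hn
    push Not at hn
    exact hd (A.span d hn)
  rcases lt_or_gt_of_ne (mul_ne_zero (hx0 k) hk) with h | h
  · exact ⟨d, Or.inl rfl, k, h⟩
  · exact ⟨-d, Or.inr rfl, k, by simp only [dt_neg]; linarith⟩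

/-- a nondegenerate arrangement has two lines -/
lemma exists_vertex {x0 : V3} (hne : x0 ≠ 0) (hx0 : ∀ k, dt (A.a k) x0 ≠ 0)
    (h2 : ∃ i j : ι, i ≠ j) : ∃ v, Vert A v ∧ Compat A x0 v := by
  obtain ⟨i, j, hij⟩ := h2
  obtain ⟨l, hl⟩ : ∃ l, cr x0 (A.a l) ≠ 0 := by
    by_contra hn
    push Not at hn
    obtain ⟨c, hc⟩ := par_of_cr hne (hn i)
    obtain ⟨c', hc'⟩ := par_of_cr hne (hn j)
    apply A.ne i j hij
    rw [hc, hc']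
    apply v3_ext <;> simp <;> ring
  obtain ⟨d, hd, hk⟩ := exists_neg hx0 hl
  have hperp : dt x0 d = 0 := by
    rcases hd with rfl | rfl <;> simp [dt_left_cr]
  have hcc : Compat A x0 x0 := fun k => mul_self_nonneg _
  obtain ⟨t, ht, c1, k1, c2, c3, c4⟩ := shoot hcc (fun k hk => absurd hk (hx0 k)) hk hx0
  set y := x0 + t • d
  have hy0 : y ≠ 0 := add_perp_ne hne hperp t
  by_cases hex : ∃ k2, k1 ≠ k2 ∧ dt (A.a k2) y = 0
  · obtain ⟨k2, h12, e2⟩ := hex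
    exact ⟨_, vert_normalize hy0 h12 c4 e2, compat_smul c1 (by positivity)⟩
  push Not at hex
  have hk1 : A.a k1 ≠ 0 := by
    by_cases h : k1 = i
    · subst h; exact A_ne A hij
    · exact A_ne A h
  have hcr : cr (A.a k1) y ≠ 0 := cr_ne_of_perp hk1 hy0 c4
  obtain ⟨d', hd', hk'⟩ := exists_neg hx0 hcr
  have p1 : dt (A.a k1) d' = 0 := by
    rcases hd' with rfl | rfl <;> simp [dt_left_cr]
  have p2 : dt y d' = 0 := by
    rcases hd' with rfl | rfl <;> simp [dt_right_cr]
  obtain ⟨t', ht', b1, k2, b2, b3, b4⟩ := shoot c1 (fun k hk => by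
    have : k1 = k := by by_contra h; exact hex k h hk
    subst this; simp [p1]) hk' hx0
  refine ⟨_, vert_normalize (add_perp_ne hy0 p2 t') (i := k1) (j := k2) ?_ ?_ b4,
    compat_smul b1 (by positivity)⟩
  · rintro rfl; exact b2 c4
  · simp [c4, p1]

lemma third {x0 v w : V3} (hx0 : ∀ k, dt (A.a k) x0 ≠ 0) (h : Adj A v w) (hv : Compat A x0 v)
    (hw : Compat A x0 w) {i : ι} (h1 : dt (A.a i) v = 0) (h2 : dt (A.a i) w = 0) :
    ∃ x, Adj A v x ∧ Compat A x0 x ∧ dt (A.a i) x ≠ 0 := by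
  apply lemE hx0 h.vl hv (d := -w) h1 (by simp [h2])
  obtain ⟨-, j, k, hjk, e1, e2⟩ := h.vl
  have key : ∀ l, dt (A.a l) v = 0 → l ≠ i → dt (A.a l) x0 * dt (A.a l) (-w) < 0 := by
    intro l hl hli
    have : dt (A.a l) w ≠ 0 := fun hn => hli (line_unique h.ind hl hn h1 h2)
    have := lt_of_le_of_ne (hw l) (mul_ne_zero (hx0 l) this).symm
    simp only [dt_neg]; linarith
  by_cases hji : j = i
  · exact ⟨k, e2, key k e2 (by rintro rfl; exact hjk hji)⟩
  · exact ⟨j, e1, key j e1 hji⟩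

lemma first_edge {x0 v : V3} (hx0 : ∀ k, dt (A.a k) x0 ≠ 0) (hv : Vert A v) (hc : Compat A x0 v) :
    ∃ w, Adj A v w ∧ Compat A x0 w := by
  obtain ⟨-, i, j, hij, e1, e2⟩ := id hv
  have hz : cr (A.a i) v ≠ 0 := cr_ne_of_perp (hv.a_ne i) hv.ne_zero e1
  have hj : dt (A.a j) (cr (A.a i) v) ≠ 0 := by
    intro h
    have h3 := dt_left_cr (A.a i) v
    have : cr v (cr (A.a i) v) ≠ 0 := cr_ne_of_perp hv.ne_zero hz (dt_right_cr _ _)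
    exact hij (line_unique this e1 h3 e2 h)
  have : ∃ d, dt (A.a i) d = 0 ∧ dt (A.a j) x0 * dt (A.a j) d < 0 := by
    rcases lt_or_gt_of_ne (mul_ne_zero (hx0 j) hj) with h | h
    · exact ⟨_, dt_left_cr _ _, h⟩
    · exact ⟨-cr (A.a i) v, by simp [dt_left_cr], by simp only [dt_neg]; linarith⟩
  obtain ⟨d, hd1, hd2⟩ := this
  obtain ⟨x, a, b, -⟩ := lemE hx0 hv hc e1 hd1 ⟨j, e2, hd2⟩
  exact ⟨x, a, b⟩

lemma exists_small (p q : ι → ℝ) : ∃ ε : ℝ, 0 < ε ∧ ∀ k, p k ≠ 0 → 0 < p k * (p k + ε * q k) := by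
  obtain ⟨M, hM⟩ := exists_big (fun k => p k * q k) (fun k => p k ^ 2)
  have hM' : ∀ k, p k ≠ 0 → 0 < p k * q k + (max M 1) * p k ^ 2 := fun k hk => by
    have h2 : 0 < p k ^ 2 := by positivity
    have := hM k h2
    have h3 : M * p k ^ 2 ≤ max M 1 * p k ^ 2 := by
      gcongr; exact le_max_left _ _
    linarith
  have hm : 0 < max M 1 := lt_of_lt_of_le one_pos (le_max_right _ _)
  refine ⟨(max M 1)⁻¹, by positivity, fun k hk => ?_⟩
  have := mul_pos (inv_pos.2 hm) (hM' k hk)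
  have e : (max M 1)⁻¹ * (p k * q k + (max M 1) * p k ^ 2) = p k * (p k + (max M 1)⁻¹ * q k) := by
    field_simp; ring
  rw [← e]; exact this

/-- the tope to the left of an edge -/
lemma edge_tope {v w : V3} (h : Adj A v w) : ∃ x0, (∀ k, dt (A.a k) x0 ≠ 0) ∧ Compat A x0 v ∧
    Compat A x0 w ∧ 0 < d3 v w x0 := by
  obtain ⟨i, h1, h2⟩ := h.line
  obtain ⟨ε, hε, hs⟩ := exists_small (fun k => dt (A.a k) (v + w)) (fun k => dt (A.a k) (cr v w))
  have hk0 : ∀ k, k ≠ i → dt (A.a k) (v + w) ≠ 0 := by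
    intro k hk hz
    rw [dt_add] at hz
    have hc := h.compat k
    have : dt (A.a k) v = 0 := by
      have e : dt (A.a k) w = - dt (A.a k) v := by linarith
      rw [e] at hc
      have : dt (A.a k) v ^ 2 = 0 := by nlinarith [sq_nonneg (dt (A.a k) v)]
      simpa using this
    have h' : dt (A.a k) w = 0 := by linarith
    exact hk (line_unique h.ind this h' h1 h2)
  obtain ⟨c, hc0, hc⟩ := h.fun_eq h1 h2
  have hsq := dt_self_pos h.ind
  have e0 : ∀ k, dt (A.a k) (v + w + ε • cr v w) = dt (A.a k) (v + w) + ε * dt (A.a k) (cr v w) := by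
    intro k; simp
  have hcomp : ∀ u : V3, dt (A.a i) u = 0 → (∀ k, 0 ≤ dt (A.a k) u * dt (A.a k) (v + w)) →
      Compat A (v + w + ε • cr v w) u := by
    intro u hu hk k
    by_cases hki : k = i
    · subst hki; simp [hu]
    · have h3 := hs k (hk0 k hki)
      rw [e0]
      have h4 := mul_nonneg (hk k) h3.le
      have h5 : 0 < dt (A.a k) (v + w) ^ 2 := by have := hk0 k hki; positivity
      by_contra hn
      push Not at hn
      nlinarith
  refine ⟨v + w + ε • cr v w, fun k => ?_, hcomp v h1 ?_, hcomp w h2 ?_, ?_⟩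
  · by_cases hki : k = i
    · subst hki
      simp only [dt_add, h1, h2, dt_smul, zero_add]
      rw [hc]
      exact mul_ne_zero hε.ne' (mul_ne_zero hc0 hsq.ne')
    · have h3 := hs k (hk0 k hki)
      rw [e0]
      intro hz
      rw [hz] at h3; simp at h3
  · intro k; rw [dt_add]; nlinarith [h.compat k, sq_nonneg (dt (A.a k) v)]
  · intro k; rw [dt_add]; nlinarith [h.compat k, sq_nonneg (dt (A.a k) w)]
  · simp only [d3, dt_add, dt_cr_left, dt_cr_right, dt_smul]
    have := mul_pos hε hsq
    linarith

end OL


set_option linter.unusedSectionVars false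

namespace OL

variable {ι : Type} [Fintype ι] [DecidableEq ι]

open Classical in
/-- positive part -/
noncomputable def sg (A : Arr ι) (s : Finset ι) (x : V3) : Finset ι :=
  s.filter (fun i => 0 < dt (A.a i) x)

/-- sign vector realised by a point off all lines -/
def IsTope (A : Arr ι) (s τ : Finset ι) : Prop :=
  ∃ x, (∀ i ∈ s, dt (A.a i) x ≠ 0) ∧ τ = sg A s x

open Classical in
/-- all topes of the subarrangement `s` -/
noncomputable def topes (A : Arr ι) (s : Finset ι) : Finset (Finset ι) :=
  s.powerset.filter (fun τ => IsTope A s τ)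

open Classical in
/-- topes of the restriction to the line `i0` -/
noncomputable def rtopes (A : Arr ι) (s : Finset ι) (i0 : ι) : Finset (Finset ι) :=
  s.powerset.filter (fun τ => ∃ x, dt (A.a i0) x = 0 ∧ (∀ i ∈ s, dt (A.a i) x ≠ 0) ∧ τ = sg A s x)

variable {A : Arr ι}

lemma mem_sg {s : Finset ι} {x : V3} {i : ι} : i ∈ sg A s x ↔ i ∈ s ∧ 0 < dt (A.a i) x := by
  simp [sg]

lemma sg_subset {s : Finset ι} {x : V3} : sg A s x ⊆ s := fun _ hi => (mem_sg.1 hi).1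

lemma charX {s τ : Finset ι} {i0 : ι} (hi0 : i0 ∉ s) (hτ : τ ⊆ s) : IsTope A (insert i0 s) τ ↔
    ∃ x, (∀ i ∈ s, dt (A.a i) x ≠ 0) ∧ dt (A.a i0) x < 0 ∧ τ = sg A s x := by
  constructor
  · rintro ⟨x, h1, h2⟩
    have hn : i0 ∉ τ := fun h => hi0 (hτ h)
    refine ⟨x, fun i hi => h1 i (Finset.mem_insert_of_mem hi), ?_, ?_⟩
    · have := h1 i0 (Finset.mem_insert_self _ _)
      rw [h2, mem_sg] at hn
      simp only [Finset.mem_insert_self, true_and] at hn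
      exact lt_of_le_of_ne (not_lt.1 hn) this
    · ext i
      rw [h2, mem_sg, mem_sg]
      constructor
      · rintro ⟨h3, h4⟩
        refine ⟨?_, h4⟩
        rcases Finset.mem_insert.1 h3 with rfl | h
        · exact absurd (by rw [h2, mem_sg]; exact ⟨h3, h4⟩) hn
        · exact h
      · rintro ⟨h3, h4⟩; exact ⟨Finset.mem_insert_of_mem h3, h4⟩
  · rintro ⟨x, h1, h2, h3⟩
    refine ⟨x, ?_, ?_⟩
    · intro i hi
      rcases Finset.mem_insert.1 hi with rfl | h
      · exact h2.ne
      · exact h1 i h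
    · ext i
      rw [h3, mem_sg, mem_sg, Finset.mem_insert]
      constructor
      · rintro ⟨a, b⟩; exact ⟨Or.inr a, b⟩
      · rintro ⟨rfl | a, b⟩
        · linarith
        · exact ⟨a, b⟩

lemma charY {s τ : Finset ι} {i0 : ι} (hi0 : i0 ∉ s) (hτ : τ ⊆ s) :
    IsTope A (insert i0 s) (insert i0 τ) ↔
    ∃ x, (∀ i ∈ s, dt (A.a i) x ≠ 0) ∧ 0 < dt (A.a i0) x ∧ τ = sg A s x := by
  have hn : i0 ∉ τ := fun h => hi0 (hτ h)
  constructor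
  · rintro ⟨x, h1, h2⟩
    refine ⟨x, fun i hi => h1 i (Finset.mem_insert_of_mem hi), ?_, ?_⟩
    · have : i0 ∈ sg A (insert i0 s) x := by rw [← h2]; exact Finset.mem_insert_self _ _
      exact (mem_sg.1 this).2
    · ext i
      have h3 : i ∈ insert i0 τ ↔ i ∈ sg A (insert i0 s) x := by rw [h2]
      rw [mem_sg, Finset.mem_insert, Finset.mem_insert] at h3
      rw [mem_sg]
      constructor
      · intro hi; exact ⟨hτ hi, (h3.1 (Or.inr hi)).2⟩
      · rintro ⟨a, b⟩
        rcases h3.2 ⟨Or.inr a, b⟩ with rfl | h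
        · exact absurd a hi0
        · exact h
  · rintro ⟨x, h1, h2, h3⟩
    refine ⟨x, ?_, ?_⟩
    · intro i hi
      rcases Finset.mem_insert.1 hi with rfl | h
      · exact h2.ne'
      · exact h1 i h
    · ext i
      rw [h3, Finset.mem_insert, mem_sg, mem_sg, Finset.mem_insert]
      constructor
      · rintro (rfl | ⟨a, b⟩)
        · exact ⟨Or.inl rfl, h2⟩
        · exact ⟨Or.inr a, b⟩
      · rintro ⟨rfl | a, b⟩
        · exact Or.inl rfl
        · exact Or.inr ⟨a, b⟩

lemma perturb (h0 : ∀ i, A.a i ≠ 0) (i0 : ι) {s : Finset ι} {x : V3} (hx : ∀ i ∈ s, dt (A.a i) x ≠ 0)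
    (hz : dt (A.a i0) x = 0) : (∃ y, (∀ i ∈ s, dt (A.a i) y ≠ 0) ∧ dt (A.a i0) y < 0 ∧
      sg A s x = sg A s y) ∧ (∃ y, (∀ i ∈ s, dt (A.a i) y ≠ 0) ∧ 0 < dt (A.a i0) y ∧
      sg A s x = sg A s y) := by
  have main : ∀ c : ℝ, ∃ ε : ℝ, 0 < ε ∧ (∀ i ∈ s, dt (A.a i) (x + ε • c • A.a i0) ≠ 0) ∧
      sg A s x = sg A s (x + ε • c • A.a i0) := by
    intro c
    obtain ⟨ε, hε, h⟩ := exists_small (fun k => dt (A.a k) x) (fun k => dt (A.a k) (c • A.a i0))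
    have e : ∀ k, dt (A.a k) (x + ε • c • A.a i0) = dt (A.a k) x + ε * dt (A.a k) (c • A.a i0) := by
      intro k; rw [dt_add, dt_smul]
    refine ⟨ε, hε, fun i hi => ?_, ?_⟩
    · have h1 := h i (hx i hi)
      rw [← e] at h1
      intro h2
      rw [h2] at h1; simp at h1
    · ext i
      rw [mem_sg, mem_sg]
      refine and_congr_right fun hi => ?_
      have h1 := h i (hx i hi)
      rw [← e] at h1
      constructor
      · intro h2; exact (pos_iff_pos_of_mul_pos h1).1 h2
      · intro h2; exact (pos_iff_pos_of_mul_pos h1).2 h2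
  have hp := dt_self_pos (h0 i0)
  constructor
  · obtain ⟨ε, hε, h1, h2⟩ := main (-1)
    refine ⟨_, h1, ?_, h2⟩
    rw [dt_add, dt_smul, dt_smul, hz]
    have := mul_pos hε hp
    linarith
  · obtain ⟨ε, hε, h1, h2⟩ := main 1
    refine ⟨_, h1, ?_, h2⟩
    rw [dt_add, dt_smul, dt_smul, hz]
    have := mul_pos hε hp
    linarith

lemma topes_insert (h0 : ∀ i, A.a i ≠ 0) {s : Finset ι} {i0 : ι} (hi0 : i0 ∉ s) :
    (topes A (insert i0 s)).card = (topes A s).card + (rtopes A s i0).card := by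
  classical
  set X := s.powerset.filter (fun τ => IsTope A (insert i0 s) τ) with hX
  set Y := s.powerset.filter (fun τ => IsTope A (insert i0 s) (insert i0 τ)) with hY
  have h1 : (topes A (insert i0 s)).card = X.card + Y.card := by
    have e : topes A (insert i0 s) = X ∪ Y.image (insert i0) := by
      unfold topes
      rw [Finset.powerset_insert, Finset.filter_union, Finset.filter_image]
    rw [e, Finset.card_union_of_disjoint, Finset.card_image_of_injOn]
    · intro a ha b hb hab
      have ha' : a ⊆ s := Finset.mem_powerset.1 (Finset.mem_filter.1 ha).1
      have hb' : b ⊆ s := Finset.mem_powerset.1 (Finset.mem_filter.1 hb).1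
      have := congrArg (fun t => Finset.erase t i0) hab
      simpa [Finset.erase_insert (fun h => hi0 (ha' h)), Finset.erase_insert (fun h => hi0 (hb' h))] using this
    · rw [Finset.disjoint_left]
      intro a ha hb
      obtain ⟨b, -, rfl⟩ := Finset.mem_image.1 hb
      have ha' := Finset.mem_powerset.1 (Finset.mem_filter.1 ha).1
      exact hi0 (ha' (Finset.mem_insert_self _ _))
  have hU : X ∪ Y = topes A s := by
    ext τ
    simp only [hX, hY, topes, Finset.mem_union, Finset.mem_filter, Finset.mem_powerset]
    constructor
    · rintro (⟨hτ, h⟩ | ⟨hτ, h⟩)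
      · obtain ⟨x, a, -, b⟩ := (charX hi0 hτ).1 h
        exact ⟨hτ, x, a, b⟩
      · obtain ⟨x, a, -, b⟩ := (charY hi0 hτ).1 h
        exact ⟨hτ, x, a, b⟩
    · rintro ⟨hτ, x, a, b⟩
      rw [charX hi0 hτ, charY hi0 hτ]
      rcases lt_trichotomy (dt (A.a i0) x) 0 with h | h | h
      · exact Or.inl ⟨hτ, x, a, h, b⟩
      · obtain ⟨y, c1, c2, c3⟩ := (perturb h0 i0 a h).1
        exact Or.inl ⟨hτ, y, c1, c2, b.trans c3⟩
      · exact Or.inr ⟨hτ, x, a, h, b⟩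
  have hI : X ∩ Y = rtopes A s i0 := by
    ext τ
    simp only [hX, hY, rtopes, Finset.mem_inter, Finset.mem_filter, Finset.mem_powerset]
    constructor
    · rintro ⟨⟨hτ, h⟩, -, h'⟩
      obtain ⟨x, a1, a2, a3⟩ := (charX hi0 hτ).1 h
      obtain ⟨y, b1, b2, b3⟩ := (charY hi0 hτ).1 h'
      set α := dt (A.a i0) y
      set β := - dt (A.a i0) x
      have hβ : 0 < β := by simp only [β]; linarith
      have hsg : ∀ i ∈ s, (0 < dt (A.a i) x ↔ 0 < dt (A.a i) y) := by
        intro i hi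
        have : i ∈ sg A s x ↔ i ∈ sg A s y := by rw [← a3, ← b3]
        rw [mem_sg, mem_sg] at this
        tauto
      have hcomb : ∀ i ∈ s, dt (A.a i) (α • x + β • y) ≠ 0 ∧ (0 < dt (A.a i) x ↔ 0 < dt (A.a i) (α • x + β • y)) := by
        intro i hi
        simp only [dt_add, dt_smul]
        rcases lt_or_gt_of_ne (a1 i hi) with h | h
        · have h2 : dt (A.a i) y < 0 := lt_of_le_of_ne (not_lt.1 (fun hh => absurd ((hsg i hi).2 hh) (not_lt.2 h.le))) (b1 i hi)
          have h3 : α * dt (A.a i) x + β * dt (A.a i) y < 0 := by nlinarith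
          exact ⟨h3.ne, fun h4 => by linarith, fun h4 => by linarith⟩
        · have h2 := (hsg i hi).1 h
          have h3 : 0 < α * dt (A.a i) x + β * dt (A.a i) y := by positivity
          exact ⟨h3.ne', fun _ => h3, fun _ => h⟩
      refine ⟨hτ, α • x + β • y, ?_, fun i hi => (hcomb i hi).1, ?_⟩
      · simp only [dt_add, dt_smul, α, β]; ring
      · ext i
        rw [a3, mem_sg, mem_sg]
        exact and_congr_right fun hi => (hcomb i hi).2
    · rintro ⟨hτ, x, hz, a, b⟩
      rw [charX hi0 hτ, charY hi0 hτ]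
      obtain ⟨⟨y, c1, c2, c3⟩, ⟨y', c1', c2', c3'⟩⟩ := perturb h0 i0 a hz
      exact ⟨⟨hτ, y, c1, c2, b.trans c3⟩, hτ, y', c1', c2', b.trans c3'⟩
  rw [h1, ← hU, ← hI, Finset.card_union_add_card_inter]

/-- finiteness of the vertex set -/
lemma finite_vert (A : Arr ι) : {v | Vert A v}.Finite := by
  classical
  have : {v | Vert A v} ⊆ ⋃ p : ι × ι, ({‖cr (A.a p.1) (A.a p.2)‖⁻¹ • cr (A.a p.1) (A.a p.2),
      -(‖cr (A.a p.1) (A.a p.2)‖⁻¹ • cr (A.a p.1) (A.a p.2))} : Set V3) := by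
    rintro v ⟨hn, i, j, hij, h1, h2⟩
    rw [Set.mem_iUnion]
    refine ⟨(i, j), ?_⟩
    obtain ⟨c, hc⟩ := par_cr_of_perp (A.ne i j hij) h1 h2
    have h3 : |c| * ‖cr (A.a i) (A.a j)‖ = 1 := by rw [← hn, hc, norm_smul, Real.norm_eq_abs]
    have h4 : ‖cr (A.a i) (A.a j)‖ ≠ 0 := norm_ne_zero_iff.2 (A.ne i j hij)
    have h5 : |c| = ‖cr (A.a i) (A.a j)‖⁻¹ := by field_simp; exact h3
    simp only [Set.mem_insert_iff, Set.mem_singleton_iff]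
    rcases abs_choice c with h | h
    · left; rw [← h5, h]; exact hc
    · right; rw [← h5, h, neg_smul, neg_neg]; exact hc
  exact Set.Finite.subset (Set.finite_iUnion fun p => (Set.finite_singleton _).insert _) this

/-- the vertices -/
noncomputable def VS (A : Arr ι) : Finset V3 := (finite_vert A).toFinset

@[simp] lemma mem_VS {v : V3} : v ∈ VS A ↔ Vert A v := by simp [VS]

lemma rtopes_lower (h0 : ∀ i, A.a i ≠ 0) {s : Finset ι} {i0 : ι} (hi0 : i0 ∉ s) :
    ((VS A).filter (fun v => i0 ∈ lines A v ∧ (s ∩ lines A v).Nonempty)).card ≤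
      (rtopes A s i0).card := by
  classical
  have hε : ∀ v : V3, ∃ ε : ℝ, 0 < ε ∧ ∀ k, dt (A.a k) v ≠ 0 →
      0 < dt (A.a k) v * (dt (A.a k) v + ε * dt (A.a k) (cr (A.a i0) v)) :=
    fun v => exists_small _ _
  choose ε hε0 hε using hε
  set y : V3 → V3 := fun v => v + ε v • cr (A.a i0) v with hy
  have hdy : ∀ v k, dt (A.a k) (y v) = dt (A.a k) v + ε v * dt (A.a k) (cr (A.a i0) v) := by
    intro v k; simp [hy]
  have hy0 : ∀ v, dt (A.a i0) v = 0 → dt (A.a i0) (y v) = 0 := by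
    intro v hv; rw [hdy, hv, dt_left_cr]; simp
  -- the functional of another line through v on the line i0
  have hfun : ∀ v i, Vert A v → dt (A.a i0) v = 0 → dt (A.a i) v = 0 → i ≠ i0 →
      ∃ c : ℝ, c ≠ 0 ∧ ∀ x, dt (A.a i0) x = 0 → dt (A.a i) x = c * dt (cr (A.a i0) v) x := by
    intro v i hv h1 h2 hi
    have hp := dt_self_pos (h0 i0)
    have hv0 := dt_self_pos hv.ne_zero
    have hz := cr_ne_of_perp (h0 i0) hv.ne_zero h1
    have hz2 := dt_self_pos hz
    refine ⟨dt (A.a i) (cr (A.a i0) v) / dt (cr (A.a i0) v) (cr (A.a i0) v), ?_, ?_⟩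
    · refine div_ne_zero (fun h => ?_) hz2.ne'
      have : cr v (cr (A.a i0) v) ≠ 0 := cr_ne_of_perp hv.ne_zero hz (dt_right_cr _ _)
      exact hi (line_unique this h2 h h1 (dt_left_cr _ _))
    · intro x hx
      have hc := cramer (A.a i0) v (cr (A.a i0) v) x
      have e1 : d3 x v (cr (A.a i0) v) = 0 := by
        have : d3 x v (cr (A.a i0) v) = dt v v * dt (A.a i0) x - dt (A.a i0) v * dt v x := by
          simp [d3, dt]; ring
        rw [this, h1, hx]; ring
      have e2 : d3 (A.a i0) v (cr (A.a i0) v) = dt (cr (A.a i0) v) (cr (A.a i0) v) := rfl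
      rw [e1, e2, zero_smul, zero_add] at hc
      have := congrArg (dt (A.a i)) hc
      simp only [dt_add, dt_smul, h2, mul_zero, zero_add, d3] at this
      field_simp
      linarith
  have hoff : ∀ v, Vert A v → dt (A.a i0) v = 0 → ∀ i ∈ s, dt (A.a i) (y v) ≠ 0 := by
    intro v hv h1 i hi hz
    have hne : i ≠ i0 := by rintro rfl; exact hi0 hi
    by_cases h2 : dt (A.a i) v = 0
    · obtain ⟨c, hc, hf⟩ := hfun v i hv h1 h2 hne
      rw [hdy, h2, zero_add, hf _ (dt_left_cr _ _)] at hz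
      have hz' := cr_ne_of_perp (h0 i0) hv.ne_zero h1
      have hz2 := dt_self_pos hz'
      exact (mul_ne_zero (hε0 v).ne' (mul_ne_zero hc hz2.ne')) hz
    · have := hε v i h2
      rw [← hdy, hz] at this
      simp at this
  apply Finset.card_le_card_of_injOn (fun v => sg A s (y v))
  · intro v hv
    simp only [Finset.coe_filter, mem_VS, mem_lines, Set.mem_ofPred_eq] at hv
    simp only [rtopes, Finset.coe_filter, Finset.mem_powerset, Set.mem_ofPred_eq]
    exact ⟨sg_subset, y v, hy0 v hv.2.1, hoff v hv.1 hv.2.1, rfl⟩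
  · -- key one-sided claim
    have key : ∀ v v', Vert A v → dt (A.a i0) v = 0 → (∃ i ∈ s, dt (A.a i) v = 0) → Vert A v' →
        dt (A.a i0) v' = 0 → sg A s (y v) = sg A s (y v') →
        0 < d3 (A.a i0) v (y v') ∧ (d3 (A.a i0) v v' ≠ 0 → 0 < d3 (A.a i0) v v') := by
      rintro v v' hv h1 ⟨i, hi, h2⟩ hv' h1' hsg
      have hne : i ≠ i0 := by rintro rfl; exact hi0 hi
      obtain ⟨c, hc, hf⟩ := hfun v i hv h1 h2 hne
      have a1 := hf _ (hy0 v h1)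
      have a2 := hf _ (hy0 v' h1')
      have b1 := hoff v hv h1 i hi
      have b2 := hoff v' hv' h1' i hi
      have hz2 := dt_self_pos (cr_ne_of_perp (h0 i0) hv.ne_zero h1)
      have p1 : 0 < dt (cr (A.a i0) v) (y v) := by
        simp only [hy, dt_add, dt_smul, dt_cr_right, zero_add]
        exact mul_pos (hε0 v) hz2
      have hiff : 0 < dt (A.a i) (y v) ↔ 0 < dt (A.a i) (y v') := by
        have : i ∈ sg A s (y v) ↔ i ∈ sg A s (y v') := by rw [hsg]
        rw [mem_sg, mem_sg] at this
        tauto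
      rw [a1, a2] at hiff
      rw [a2] at b2
      have main : 0 < dt (cr (A.a i0) v) (y v') := by
       rcases lt_or_gt_of_ne hc with h | h
       · by_contra hn
         push Not at hn
         have h3 : 0 < c * dt (cr (A.a i0) v) (y v') :=
           lt_of_le_of_ne (mul_nonneg_of_nonpos_of_nonpos h.le hn) b2.symm
         have := hiff.2 h3
         nlinarith
       · have := hiff.1 (mul_pos h p1)
         exact (pos_iff_pos_of_mul_pos this).1 h
      refine ⟨main, fun hnz => ?_⟩
      have a3 := hf _ h1'
      have q := hε v' i (by rw [a3]; exact mul_ne_zero hc hnz)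
      rw [← hdy, a2, a3] at q
      change 0 < dt (cr (A.a i0) v) v'
      have hc2 : 0 < c ^ 2 := by positivity
      by_contra hn
      push Not at hn
      have : 0 ≤ c ^ 2 * (-(dt (cr (A.a i0) v) v') * dt (cr (A.a i0) v) (y v')) := by
        have : 0 ≤ -(dt (cr (A.a i0) v) v') := by linarith
        positivity
      nlinarith
    intro v hv v' hv' hsg
    simp only [Finset.coe_filter, mem_VS, mem_lines, Set.mem_ofPred_eq] at hv hv'
    obtain ⟨hv, h1, ⟨i, hi⟩⟩ := hv
    obtain ⟨hv', h1', ⟨i', hi'⟩⟩ := hv'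
    simp only [Finset.mem_inter, mem_lines] at hi hi'
    have k1 := key v v' hv h1 ⟨i, hi⟩ hv' h1' hsg
    have k2 := key v' v hv' h1' ⟨i', hi'⟩ hv h1 hsg.symm
    have e1 : d3 (A.a i0) v (y v') = d3 (A.a i0) v v' + ε v' * (dt (A.a i0) (A.a i0) * dt v v') := by
      simp only [d3, hy, dt_add, dt_smul]
      congr 2
      have : dt (cr (A.a i0) v) (cr (A.a i0) v') = dt (A.a i0) (A.a i0) * dt v v' - dt (A.a i0) v' * dt (A.a i0) v := by
        simp [dt]; ring
      rw [this, h1]; ring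
    have hz : d3 (A.a i0) v v' = 0 := by
      by_contra hn
      have q1 := k1.2 hn
      have hn2 : d3 (A.a i0) v' v ≠ 0 := by rw [d3_swap]; exact neg_ne_zero.2 hn
      have q2 := k2.2 hn2
      rw [d3_swap] at q2
      linarith
    have k1 := k1.1
    rw [e1, hz, zero_add] at k1
    have hp := dt_self_pos (h0 i0)
    have hpos : 0 < dt v v' := by
      have := hε0 v'
      exact (pos_iff_pos_of_mul_pos ((pos_iff_pos_of_mul_pos k1).1 this)).1 hp
    have hcr : cr v v' = 0 := by
      by_contra hn
      obtain ⟨c, hc⟩ := perp_par hn h1 h1'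
      have : dt (A.a i0) (cr v v') = 0 := by
        rw [← hz]; simp [d3, dt]; ring
      rw [hc, smul_dt] at this
      have hc0 : c ≠ 0 := by rintro rfl; exact h0 i0 (by rw [hc, zero_smul])
      exact (mul_ne_zero hc0 (dt_self_pos hn).ne') this
    obtain ⟨c, hc⟩ := par_of_cr hv.ne_zero hcr
    symm
    refine norm_eq_of_smul hv.1 hv'.1 ?_ hc
    rw [hc, dt_smul] at hpos
    exact (pos_iff_pos_of_mul_pos hpos).2 (dt_self_pos hv.ne_zero)

lemma topes_lower (h0 : ∀ i, A.a i ≠ 0) (s : Finset ι) :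
    ∑ v ∈ VS A, ((s ∩ lines A v).card - 1) ≤ (topes A s).card := by
  classical
  induction s using Finset.induction_on with
  | empty => simp
  | insert i0 s hi0 ih =>
    rw [topes_insert h0 hi0]
    have h1 := rtopes_lower h0 hi0
    rw [Finset.card_filter] at h1
    refine le_trans ?_ (Nat.add_le_add ih h1)
    rw [← Finset.sum_add_distrib]
    apply Finset.sum_le_sum
    intro v _
    by_cases hv : i0 ∈ lines A v
    · rw [Finset.insert_inter_of_mem hv, Finset.card_insert_of_notMem (by simp [hi0])]
      by_cases hs : (s ∩ lines A v).Nonempty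
      · simp only [hv, hs, and_self, if_true]
        have := hs.card_pos
        omega
      · rw [Finset.not_nonempty_iff_eq_empty] at hs
        simp [hs]
    · rw [Finset.insert_inter_of_notMem hv]
      omega

lemma rtopes_upper {v : V3} (hv : v ≠ 0) (h0 : ∀ i, A.a i ≠ 0) (s : Finset ι)
    (hs : ∀ i ∈ s, dt (A.a i) v = 0) (i0 : ι)
    (hi0 : dt (A.a i0) v = 0) : (rtopes A s i0).card ≤ 2 := by
  classical
  have hsub : rtopes A s i0 ⊆ {sg A s (cr (A.a i0) v), sg A s (-cr (A.a i0) v)} := by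
    intro τ hτ
    simp only [rtopes, Finset.mem_filter, Finset.mem_powerset] at hτ
    obtain ⟨-, x, hx, hx2, rfl⟩ := hτ
    have hz := cr_ne_of_perp (h0 i0) hv hi0
    have hz2 : cr v (cr (A.a i0) v) ≠ 0 := cr_ne_of_perp hv hz (dt_right_cr _ _)
    obtain ⟨c, hc⟩ := perp_par hz2 hi0 (dt_left_cr _ _)
    have hc0 : c ≠ 0 := by rintro rfl; exact h0 i0 (by rw [hc, zero_smul])
    have : d3 v (cr (A.a i0) v) x = 0 := by
      rw [hc, smul_dt] at hx
      exact (mul_eq_zero.1 hx).resolve_left hc0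
    obtain ⟨α, β, he⟩ := coplanar_decomp hz2 this
    have hk : ∀ i ∈ s, dt (A.a i) x = β * dt (A.a i) (cr (A.a i0) v) := by
      intro i hi; rw [he]; simp [hs i hi]
    rw [Finset.mem_insert, Finset.mem_singleton]
    rcases lt_trichotomy β 0 with hb | hb | hb
    · right
      ext i
      rw [mem_sg, mem_sg]
      refine and_congr_right fun hi => ?_
      rw [hk i hi, dt_neg]
      constructor <;> intro h <;> nlinarith
    · left
      ext i
      rw [mem_sg, mem_sg]
      refine and_congr_right fun hi => ?_
      have := hk i hi
      rw [hb, zero_mul] at this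
      exact absurd this (hx2 i hi)
    · left
      ext i
      rw [mem_sg, mem_sg]
      refine and_congr_right fun hi => ?_
      rw [hk i hi]
      exact mul_pos_iff_of_pos_left hb
  exact (Finset.card_le_card hsub).trans Finset.card_le_two

lemma topes_upper {v : V3} (hv : v ≠ 0) (h0 : ∀ i, A.a i ≠ 0) (s : Finset ι)
    (hne : s.Nonempty) (hs : ∀ i ∈ s, dt (A.a i) v = 0) : (topes A s).card ≤ 2 * s.card := by
  classical
  induction hne using Finset.Nonempty.cons_induction with
  | singleton i =>
    have : topes A {i} ⊆ ({i} : Finset ι).powerset := Finset.filter_subset _ _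
    simpa using Finset.card_le_card this
  | cons i0 s hi0 hne ih =>
    rw [Finset.cons_eq_insert] at *
    rw [topes_insert h0 hi0, Finset.card_insert_of_notMem hi0]
    have h1 := ih (fun i hi => hs i (Finset.mem_insert_of_mem hi))
    have h2 := rtopes_upper hv h0 s (fun i hi => hs i (Finset.mem_insert_of_mem hi)) i0
      (hs i0 (Finset.mem_insert_self _ _))
    omega

/-- closure of a tope -/
def Cl (A : Arr ι) (τ : Finset ι) (v : V3) : Prop :=
  ∀ i, (i ∈ τ → 0 ≤ dt (A.a i) v) ∧ (i ∉ τ → dt (A.a i) v ≤ 0)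

lemma cl_iff {x0 v : V3} (hx0 : ∀ k, dt (A.a k) x0 ≠ 0) :
    Cl A (sg A Finset.univ x0) v ↔ Compat A x0 v := by
  unfold Cl Compat
  refine forall_congr' fun i => ?_
  simp only [mem_sg, Finset.mem_univ, true_and]
  rcases lt_or_gt_of_ne (hx0 i) with h | h
  · constructor
    · rintro ⟨-, h2⟩
      exact mul_nonneg_of_nonpos_of_nonpos h.le (h2 (not_lt.2 h.le))
    · intro h2
      exact ⟨fun h3 => by linarith, fun _ => by by_contra hn; push Not at hn; nlinarith⟩
  · constructor
    · rintro ⟨h2, -⟩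
      exact mul_nonneg h.le (h2 h)
    · intro h2
      exact ⟨fun _ => by by_contra hn; push Not at hn; nlinarith, fun h3 => absurd h h3⟩

open Classical in
lemma incident_upper (h0 : ∀ i, A.a i ≠ 0) {v : V3} (hv : Vert A v) :
    ((topes A Finset.univ).filter (fun τ => Cl A τ v)).card ≤ 2 * (lines A v).card := by
  have hne : (lines A v).Nonempty := by
    obtain ⟨-, i, j, -, h, -⟩ := hv
    exact ⟨i, mem_lines.2 h⟩
  refine le_trans ?_ (topes_upper hv.ne_zero h0 (lines A v) hne (fun i hi => mem_lines.1 hi))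
  apply Finset.card_le_card_of_injOn (fun τ => τ ∩ lines A v)
  · intro τ hτ
    simp only [topes, Finset.coe_filter, Finset.mem_filter, Finset.mem_powerset, Set.mem_ofPred_eq] at hτ ⊢
    obtain ⟨⟨-, x, h1, h2⟩, -⟩ := hτ
    refine ⟨Finset.inter_subset_right, x, fun i _ => h1 i (Finset.mem_univ _), ?_⟩
    ext i
    rw [h2, Finset.mem_inter, mem_sg, mem_sg]
    simp only [Finset.mem_univ, true_and]
    tauto
  · intro τ hτ τ' hτ' he
    simp only [Finset.coe_filter, Set.mem_ofPred_eq] at hτ hτ'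
    ext i
    by_cases hi : i ∈ lines A v
    · have : i ∈ τ ∩ lines A v ↔ i ∈ τ' ∩ lines A v := by simp only at he; rw [he]
      simpa [hi] using this
    · rw [mem_lines] at hi
      have a := hτ.2 i
      have b := hτ'.2 i
      constructor
      · intro h; by_contra hn; exact hi (le_antisymm (b.2 hn) (a.1 h))
      · intro h; by_contra hn; exact hi (le_antisymm (a.2 hn) (b.1 h))

open Classical in
/-- vertices of a tope -/
noncomputable def tv (A : Arr ι) (τ : Finset ι) : Finset V3 := (VS A).filter (fun v => Cl A τ v)

lemma tope_real {τ : Finset ι} (hτ : τ ∈ topes A Finset.univ) :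
    ∃ x0, (∀ k, dt (A.a k) x0 ≠ 0) ∧ ∀ v, v ∈ tv A τ ↔ Vert A v ∧ Compat A x0 v := by
  classical
  simp only [topes, Finset.mem_filter] at hτ
  obtain ⟨-, x, h1, h2⟩ := hτ
  have h1 : ∀ k, dt (A.a k) x ≠ 0 := fun k => h1 k (Finset.mem_univ _)
  exact ⟨x, h1, fun v => by rw [tv, Finset.mem_filter, mem_VS, h2, cl_iff h1]⟩

lemma three_le (h2 : ∃ i j : ι, i ≠ j) {τ : Finset ι} (hτ : τ ∈ topes A Finset.univ) :
    3 ≤ (tv A τ).card := by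
  classical
  obtain ⟨x0, hx0, hm⟩ := tope_real hτ
  obtain ⟨i, j, hij⟩ := id h2
  have hne : x0 ≠ 0 := by rintro rfl; exact hx0 i (by simp)
  obtain ⟨v, hv, hcv⟩ := exists_vertex hne hx0 h2
  obtain ⟨w, hw, hcw⟩ := first_edge hx0 hv hcv
  obtain ⟨l, h3, h4⟩ := hw.line
  obtain ⟨x, hx, hcx, hl⟩ := third hx0 hw hcv hcw h3 h4
  have hvw : v ≠ w := by rintro rfl; exact hw.ind (cr_self _)
  have hvx : v ≠ x := by rintro rfl; exact hl h3
  have hwx : w ≠ x := by rintro rfl; exact hl h4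
  have : ({v, w, x} : Finset V3) ⊆ tv A τ := by
    intro y hy
    simp only [Finset.mem_insert, Finset.mem_singleton] at hy
    rw [hm]
    rcases hy with rfl | rfl | rfl
    · exact ⟨hv, hcv⟩
    · exact ⟨hw.vr, hcw⟩
    · exact ⟨hx.vr, hcx⟩
  have h := Finset.card_le_card this
  rwa [Finset.card_eq_three.2 ⟨v, w, x, hvw, hvx, hwx, rfl⟩] at h

lemma four_le {v w : V3} (h : Adj A v w) (hn : ¬ ∃ x, T A v w x) :
    ∃ τ ∈ topes A Finset.univ, v ∈ tv A τ ∧ 4 ≤ (tv A τ).card := by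
  classical
  obtain ⟨x0, hx0, hcv, hcw, hpos⟩ := edge_tope h
  have hτ : sg A Finset.univ x0 ∈ topes A Finset.univ := by
    simp only [topes, Finset.mem_filter, Finset.mem_powerset]
    exact ⟨sg_subset, x0, fun i _ => hx0 i, rfl⟩
  have hm : ∀ u, u ∈ tv A (sg A Finset.univ x0) ↔ Vert A u ∧ Compat A x0 u := fun u => by
    rw [tv, Finset.mem_filter, mem_VS, cl_iff hx0]
  refine ⟨_, hτ, (hm v).2 ⟨h.vl, hcv⟩, ?_⟩
  obtain ⟨l, h3, h4⟩ := h.line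
  obtain ⟨x, hx, hcx, hl⟩ := third hx0 h hcv hcw h3 h4
  obtain ⟨x', hx', hcx', hl'⟩ := third hx0 h.symm hcw hcv h4 h3
  have hvw : v ≠ w := by rintro rfl; exact h.ind (cr_self _)
  have hvx : v ≠ x := by rintro rfl; exact hl h3
  have hwx : w ≠ x := by rintro rfl; exact hl h4
  have hvx' : v ≠ x' := by rintro rfl; exact hl' h3
  have hwx' : w ≠ x' := by rintro rfl; exact hl' h4
  have hxx : x ≠ x' := by
    rintro rfl
    apply hn
    refine ⟨x, ?_, h, hx', hx.symm⟩
    have hs := h.side hcx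
    obtain ⟨c, hc0, hc⟩ := h.fun_eq h3 h4
    rw [hc] at hl
    have h5 : d3 v w x ≠ 0 := fun hh => hl (by rw [hh, mul_zero])
    have := lt_of_le_of_ne hs (mul_ne_zero hpos.ne' h5).symm
    exact (pos_iff_pos_of_mul_pos this).1 hpos
  have : ({v, w, x, x'} : Finset V3) ⊆ tv A (sg A Finset.univ x0) := by
    intro y hy
    simp only [Finset.mem_insert, Finset.mem_singleton] at hy
    rw [hm]
    rcases hy with rfl | rfl | rfl | rfl
    · exact ⟨h.vl, hcv⟩
    · exact ⟨h.vr, hcw⟩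
    · exact ⟨hx.vr, hcx⟩
    · exact ⟨hx'.vr, hcx'⟩
  have h := Finset.card_le_card this
  rwa [Finset.card_insert_of_notMem (by simp [hvw, hvx, hvx']),
    Finset.card_eq_three.2 ⟨w, x, x', hwx, hwx', hxx, rfl⟩] at h

end OL


set_option linter.unusedSectionVars false

namespace OL

variable {ι : Type} [Fintype ι] [DecidableEq ι] {A : Arr ι}

open Classical in
/-- number of vertices of degree two -/
noncomputable def N2 (A : Arr ι) : ℕ := ((VS A).filter (fun v => (lines A v).card = 2)).card

lemma two_le_deg {v : V3} (hv : Vert A v) : 2 ≤ (lines A v).card := by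
  obtain ⟨-, i, j, hij, h1, h2⟩ := hv
  rw [← Finset.card_pair hij]
  apply Finset.card_le_card
  intro k hk
  simp only [Finset.mem_insert, Finset.mem_singleton] at hk
  rcases hk with rfl | rfl <;> simpa

lemma arr_ne_zero (h2 : ∃ i j : ι, i ≠ j) (i : ι) : A.a i ≠ 0 := by
  obtain ⟨j, k, hjk⟩ := h2
  by_cases h : i = j
  · subst h; exact A_ne A hjk
  · exact A_ne A h

open Classical in
lemma sum_tv (h2 : ∃ i j : ι, i ≠ j) :
    ∑ τ ∈ topes A Finset.univ, ((tv A τ).card - 3 : ℤ) ≤ ∑ v ∈ VS A, (3 - (lines A v).card : ℤ) := by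
  have h0 := arr_ne_zero (A := A) h2
  have e1 : ∑ τ ∈ topes A Finset.univ, (tv A τ).card =
      ∑ v ∈ VS A, ((topes A Finset.univ).filter (fun τ => Cl A τ v)).card := by
    simp only [tv, Finset.card_filter]
    rw [Finset.sum_comm]
  have e2 : ∑ τ ∈ topes A Finset.univ, (tv A τ).card ≤ ∑ v ∈ VS A, 2 * (lines A v).card := by
    rw [e1]
    exact Finset.sum_le_sum fun v hv => incident_upper h0 (mem_VS.1 hv)
  have e3 := topes_lower h0 (Finset.univ : Finset ι)
  simp only [Finset.univ_inter] at e3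
  have e3' : ∑ v ∈ VS A, ((lines A v).card - 1 : ℤ) ≤ (topes A Finset.univ).card := by
    refine le_trans (le_of_eq ?_) (Int.ofNat_le.2 e3)
    push_cast
    refine Finset.sum_congr rfl fun v hv => ?_
    have := two_le_deg (mem_VS.1 hv)
    omega
  have e2' : (∑ τ ∈ topes A Finset.univ, ((tv A τ).card : ℤ)) ≤ ∑ v ∈ VS A, 2 * ((lines A v).card : ℤ) := by
    exact_mod_cast e2
  rw [Finset.sum_sub_distrib, Finset.sum_const, nsmul_eq_mul]
  have e4 : ∑ v ∈ VS A, (3 - (lines A v).card : ℤ) =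
      ∑ v ∈ VS A, 2 * ((lines A v).card : ℤ) - 3 * ∑ v ∈ VS A, ((lines A v).card - 1 : ℤ) := by
    rw [Finset.mul_sum, ← Finset.sum_sub_distrib]
    exact Finset.sum_congr rfl fun v _ => by ring
  rw [e4]
  linarith

open Classical in
/-- weight of bad vertices -/
lemma bad_weight (h2 : ∃ i j : ι, i ≠ j) :
    ∑ v ∈ (VS A).filter (fun v => ¬ Good A v), (lines A v).card ≤ 14 * N2 A := by
  have h := sum_tv (A := A) h2
  -- number of bad vertices of degree three
  set B3 := (VS A).filter (fun v => (lines A v).card = 3 ∧ ¬ Good A v) with hB3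
  have hb : B3 ⊆ ((topes A Finset.univ).filter (fun τ => 4 ≤ (tv A τ).card)).biUnion (tv A) := by
    intro v hv
    simp only [hB3, Finset.mem_filter, mem_VS] at hv
    obtain ⟨hv, hd, hg⟩ := hv
    have : ∃ w, Adj A v w ∧ ¬ ∃ x, T A v w x := by
      by_contra hn
      push Not at hn
      exact hg ⟨hd, hn⟩
    obtain ⟨w, hw, hx⟩ := this
    obtain ⟨τ, hτ, hvτ, h4⟩ := four_le hw hx
    rw [Finset.mem_biUnion]
    exact ⟨τ, by simp [hτ, h4], hvτ⟩
  have hb2 : (B3.card : ℤ) ≤ 4 * ∑ τ ∈ topes A Finset.univ, ((tv A τ).card - 3 : ℤ) := by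
    have h1 := (Finset.card_le_card hb).trans Finset.card_biUnion_le
    have h1' : (B3.card : ℤ) ≤ ∑ τ ∈ (topes A Finset.univ).filter (fun τ => 4 ≤ (tv A τ).card), ((tv A τ).card : ℤ) := by
      exact_mod_cast h1
    refine h1'.trans ?_
    rw [Finset.sum_filter, Finset.mul_sum]
    refine Finset.sum_le_sum fun τ hτ => ?_
    have h3 := three_le h2 hτ
    split_ifs <;> omega
  have hN : (N2 A : ℤ) = ∑ v ∈ VS A, (if (lines A v).card = 2 then 1 else 0 : ℤ) := by
    rw [N2, Finset.card_filter]; push_cast; rfl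
  have hB : (B3.card : ℤ) = ∑ v ∈ VS A, (if (lines A v).card = 3 ∧ ¬ Good A v then 1 else 0 : ℤ) := by
    rw [hB3, Finset.card_filter]; push_cast; rfl
  have key : (∑ v ∈ (VS A).filter (fun v => ¬ Good A v), ((lines A v).card : ℤ)) ≤ 14 * N2 A := by
    have hnn : 0 ≤ ∑ τ ∈ topes A Finset.univ, ((tv A τ).card - 3 : ℤ) :=
      Finset.sum_nonneg fun τ hτ => by have := three_le h2 hτ; omega
    have : (∑ v ∈ (VS A).filter (fun v => ¬ Good A v), ((lines A v).card : ℤ)) ≤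
        14 * (∑ v ∈ VS A, (if (lines A v).card = 2 then 1 else 0 : ℤ))
        - 12 * (∑ v ∈ VS A, (3 - (lines A v).card : ℤ)) +
        3 * ∑ v ∈ VS A, (if (lines A v).card = 3 ∧ ¬ Good A v then 1 else 0 : ℤ) := by
      rw [Finset.sum_filter, Finset.mul_sum, Finset.mul_sum, Finset.mul_sum, ← Finset.sum_sub_distrib,
        ← Finset.sum_add_distrib]
      refine Finset.sum_le_sum fun v hv => ?_
      have h3 := two_le_deg (mem_VS.1 hv)
      by_cases hg : Good A v
      · have := hg.deg
        simp [hg, this]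
      · by_cases e2 : (lines A v).card = 2
        · simp [hg, e2]
        · by_cases e3 : (lines A v).card = 3
          · simp [hg, e3]
          · simp only [hg, not_false_eq_true, if_true, e2, if_false, e3, false_and]
            omega
    rw [← hN, ← hB] at this
    linarith
  exact_mod_cast key

open Classical in
/-- neighbours -/
noncomputable def nb (A : Arr ι) (u : V3) : Finset V3 := (VS A).filter (fun w => Adj A u w)

lemma mem_nb {u w : V3} : w ∈ nb A u ↔ Adj A u w := by
  simp only [nb, Finset.mem_filter, mem_VS]
  exact ⟨fun h => h.2, fun h => ⟨h.vr, h⟩⟩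

lemma nb_card (u : V3) : (nb A u).card ≤ 2 * (lines A u).card := by
  classical
  have hl : ∀ w, ∃ i : Option ι, w ∈ nb A u → ∃ j, i = some j ∧ dt (A.a j) u = 0 ∧ dt (A.a j) w = 0 := by
    intro w
    by_cases h : w ∈ nb A u
    · obtain ⟨j, h1⟩ := (mem_nb.1 h).line
      exact ⟨some j, fun _ => ⟨j, rfl, h1⟩⟩
    · exact ⟨none, fun h' => absurd h' h⟩
  choose f hf using hl
  have : (nb A u).card ≤ (((lines A u).image some) ×ˢ (Finset.univ : Finset Bool)).card := by
    apply Finset.card_le_card_of_injOn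
      (fun w => (f w, match f w with | some j => decide (0 < dt (A.a j) (cr u w)) | none => true))
    · intro w hw
      obtain ⟨j, h1, h2, h3⟩ := hf w hw
      simp [h1, h2, lt_or_ge]
    · intro w hw w' hw' he
      obtain ⟨j, h1, h2, h3⟩ := hf w hw
      obtain ⟨j', h1', h2', h3'⟩ := hf w' hw'
      simp only [h1, h1', Prod.mk.injEq, Option.some.injEq] at he
      obtain ⟨rfl, he⟩ := he
      have hw := mem_nb.1 hw
      have hw' := mem_nb.1 hw'
      obtain ⟨c, hc⟩ := perp_par hw.ind h2 h3
      obtain ⟨c', hc'⟩ := perp_par hw'.ind h2 h3'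
      have hne := hw.vl.a_ne j
      have hc0 : c ≠ 0 := by rintro rfl; exact hne (by rw [hc, zero_smul])
      have hc0' : c' ≠ 0 := by rintro rfl; exact hne (by rw [hc', zero_smul])
      have e1 : dt (A.a j) (cr u w) = c * dt (cr u w) (cr u w) := by rw [hc, smul_dt]
      have e2 : dt (A.a j) (cr u w') = c' * dt (cr u w') (cr u w') := by rw [hc', smul_dt]
      have p1 := dt_self_pos hw.ind
      have p2 := dt_self_pos hw'.ind
      rw [decide_eq_decide, e1, e2, mul_pos_iff_of_pos_right p1, mul_pos_iff_of_pos_right p2] at he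
      have hpos : 0 < c / c' := by
        rcases lt_or_gt_of_ne hc0 with h | h
        · have : c' < 0 := lt_of_le_of_ne (not_lt.1 fun hh => by have := he.2 hh; linarith) hc0'
          exact div_pos_of_neg_of_neg h this
        · exact div_pos h (he.1 h)
      symm
      refine Adj.unique hw hw' hpos ?_
      rw [div_eq_inv_mul, mul_smul, ← hc, hc', smul_smul, inv_mul_cancel₀ hc0', one_smul]
  refine this.trans ?_
  rw [Finset.card_product, Finset.card_image_of_injective _ (Option.some_injective _)]
  simp [mul_comm]

/-- very good vertex -/
def VG (A : Arr ι) (v : V3) : Prop :=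
  Good A v ∧ ∀ w, Adj A v w → Good A w ∧ ∀ x, Adj A w x → Good A x

open Classical in
lemma nonVG_weight (h2 : ∃ i j : ι, i ≠ j) :
    ∑ v ∈ (VS A).filter (fun v => ¬ VG A v), (lines A v).card ≤ 602 * N2 A := by
  have hW := bad_weight (A := A) h2
  set B := (VS A).filter (fun v => ¬ Good A v) with hB
  set W := ∑ v ∈ B, (lines A v).card with hWd
  set B1 := B.biUnion (nb A) with hB1
  have c1 : B1.card ≤ 2 * W := by
    refine Finset.card_biUnion_le.trans ?_
    rw [hWd, Finset.mul_sum]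
    exact Finset.sum_le_sum fun v _ => nb_card v
  set G1 := B1.filter (fun v => Good A v) with hG1
  set B2 := G1.biUnion (nb A) with hB2
  have c2 : B2.card ≤ 12 * W := by
    refine Finset.card_biUnion_le.trans ?_
    have : ∑ u ∈ G1, (nb A u).card ≤ ∑ u ∈ G1, 6 := by
      refine Finset.sum_le_sum fun u hu => ?_
      have := nb_card (A := A) u
      rw [(Finset.mem_filter.1 hu).2.deg] at this
      exact this
    rw [Finset.sum_const, smul_eq_mul] at this
    have h3 := Finset.card_filter_le B1 (fun v => Good A v)
    rw [← hG1] at h3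
    omega
  have hsub : (VS A).filter (fun v => ¬ VG A v) ⊆ B ∪ (G1 ∪ B2.filter (fun v => Good A v)) := by
    intro v hv
    obtain ⟨hv, hn⟩ := Finset.mem_filter.1 hv
    by_cases hg : Good A v
    · rw [Finset.mem_union, Finset.mem_union]
      right
      have : ∃ w, Adj A v w ∧ (¬ Good A w ∨ ∃ x, Adj A w x ∧ ¬ Good A x) := by
        by_contra hc
        push Not at hc
        exact hn ⟨hg, hc⟩
      obtain ⟨w, hw, hx⟩ := this
      by_cases hgw : Good A w
      · obtain ⟨x, hx, hgx⟩ := hx.resolve_left (not_not.2 hgw)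
        right
        refine Finset.mem_filter.2 ⟨Finset.mem_biUnion.2 ⟨w, Finset.mem_filter.2 ⟨Finset.mem_biUnion.2 ⟨x, ?_, mem_nb.2 hx.symm⟩, hgw⟩, mem_nb.2 hw.symm⟩, hg⟩
        exact Finset.mem_filter.2 ⟨mem_VS.2 hx.vr, hgx⟩
      · left
        refine Finset.mem_filter.2 ⟨Finset.mem_biUnion.2 ⟨w, ?_, mem_nb.2 hw.symm⟩, hg⟩
        exact Finset.mem_filter.2 ⟨mem_VS.2 hw.vr, hgw⟩
    · exact Finset.mem_union_left _ (Finset.mem_filter.2 ⟨hv, hg⟩)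
  have s1 : ∑ v ∈ (VS A).filter (fun v => ¬ VG A v), (lines A v).card ≤
      ∑ v ∈ B ∪ (G1 ∪ B2.filter (fun v => Good A v)), (lines A v).card :=
    Finset.sum_le_sum_of_subset hsub
  have hun : ∀ (s t : Finset V3), ∑ v ∈ s ∪ t, (lines A v).card ≤ ∑ v ∈ s, (lines A v).card + ∑ v ∈ t, (lines A v).card := by
    intro s t
    rw [← Finset.sum_union_inter]
    exact Nat.le_add_right _ _
  have h3 : ∀ s : Finset V3, ∑ v ∈ s.filter (fun v => Good A v), (lines A v).card ≤ 3 * s.card := by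
    intro s
    have : ∑ v ∈ s.filter (fun v => Good A v), (lines A v).card = ∑ v ∈ s.filter (fun v => Good A v), 3 :=
      Finset.sum_congr rfl fun v hv => (Finset.mem_filter.1 hv).2.deg
    rw [this, Finset.sum_const, smul_eq_mul]
    have := Finset.card_filter_le s (fun v => Good A v)
    omega
  have q1 := hun B (G1 ∪ B2.filter (fun v => Good A v))
  have q2 := hun G1 (B2.filter (fun v => Good A v))
  have q3 := h3 B1
  have q4 := h3 B2
  rw [← hG1] at q3
  omega

open Classical in
/-- bad vertices on a line -/
noncomputable def bl (A : Arr ι) (p : ι) : Finset V3 :=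
  (VS A).filter (fun v => dt (A.a p) v = 0 ∧ ¬ VG A v)

lemma sum_bl (h2 : ∃ i j : ι, i ≠ j) : ∑ p, (bl A p).card ≤ 602 * N2 A := by
  classical
  refine le_trans (le_of_eq ?_) (nonVG_weight (A := A) h2)
  simp only [bl, lines, Finset.card_filter]
  rw [Finset.sum_comm, Finset.sum_filter]
  refine Finset.sum_congr rfl fun v _ => ?_
  by_cases h : VG A v <;> simp [h]

end OL


namespace OL

open MvPolynomial

/-- ternary real polynomials -/
abbrev MP := MvPolynomial (Fin 3) ℝ

/-- forms of degree `m` -/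
abbrev Hm (m : ℕ) : Submodule ℝ MP := homogeneousSubmodule (Fin 3) ℝ m

instance (m : ℕ) : Module.Finite ℝ (Hm m) :=
  Module.Finite.iff_fg.mpr (homogeneousSubmodule_fg (σ := Fin 3) (R := ℝ) m)

lemma finrank_Hm (m : ℕ) : Module.finrank ℝ (Hm m) = (m + 2).choose 2 := by
  have e : (Hm m) = AddMonoidAlgebra.supported ℝ ℝ {d : Fin 3 →₀ ℕ | d.degree = m} :=
    homogeneousSubmodule_eq_finsupp_supported _ _ m
  have hs : {d : Fin 3 →₀ ℕ | d.degree = m}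
      = ((Finset.univ : Finset (Fin 3)).finsuppAntidiag m : Set (Fin 3 →₀ ℕ)) := by
    ext d
    simp [Finsupp.degree_eq_sum]
  rw [hs] at e
  rw [e, (AddMonoidAlgebra.supportedEquivFinsupp (R := ℝ) (S := ℝ) _).finrank_eq,
    Module.finrank_finsupp_self]
  rw [show Fintype.card (((Finset.univ : Finset (Fin 3)).finsuppAntidiag m : Set (Fin 3 →₀ ℕ)))
    = ((Finset.univ : Finset (Fin 3)).finsuppAntidiag m).card from Fintype.card_coe _]
  rw [Finset.card_finsuppAntidiag_nat_eq_choose]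
  simp only [Finset.card_univ, Fintype.card_fin]
  rw [show 3 + m - 1 = m + 2 by omega]
  exact Nat.choose_symm_add

/-- a linear condition count -/
lemma exists_form (m : ℕ) {N : ℕ} (x : Fin N → V3) (h : N < (m + 2).choose 2) :
    ∃ F : MP, F ≠ 0 ∧ F.IsHomogeneous m ∧ ∀ i, eval (x i) F = 0 := by
  let φ : Hm m →ₗ[ℝ] (Fin N → ℝ) :=
    LinearMap.pi fun i => (aeval (R := ℝ) (x i)).toLinearMap ∘ₗ (Hm m).subtype
  have hk : LinearMap.ker φ ≠ ⊥ := by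
    apply LinearMap.ker_ne_bot_of_finrank_lt
    rw [finrank_Hm]; simpa using h
  obtain ⟨F, hF, hF0⟩ := Submodule.exists_mem_ne_zero_of_ne_bot hk
  refine ⟨F, by simpa using hF0, F.2, fun i => ?_⟩
  have := congrFun (LinearMap.mem_ker.1 hF) i
  simpa [φ, aeval_eq_eval] using this

lemma cubic_exists (s : Finset V3) (h : s.card ≤ 9) :
    ∃ F : MP, F ≠ 0 ∧ F.IsHomogeneous 3 ∧ ∀ x ∈ s, eval x F = 0 := by
  obtain ⟨F, h0, h1, h2⟩ := exists_form 3 (fun i => ((s.equivFin.symm i : s) : V3))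
    (by norm_num [Nat.choose]; omega)
  refine ⟨F, h0, h1, fun x hx => ?_⟩
  simpa using h2 (s.equivFin ⟨x, hx⟩)

lemma hc_mul {F G : MP} {d : ℕ} (hF : F.IsHomogeneous d) (k : ℕ) :
    homogeneousComponent (d + k) (F * G) = F * homogeneousComponent k G := by
  conv_lhs => rw [← sum_homogeneousComponent G, Finset.mul_sum, map_sum]
  have : ∀ i ∈ Finset.range (G.totalDegree + 1),
      homogeneousComponent (d + k) (F * homogeneousComponent i G)
        = if i = k then F * homogeneousComponent k G else 0 := by
    intro i _
    rw [homogeneousComponent_of_mem (hF.mul (homogeneousComponent_isHomogeneous i G))]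
    by_cases h : i = k
    · subst h; simp
    · rw [if_neg h, if_neg (by omega)]
  rw [Finset.sum_congr rfl this, Finset.sum_ite_eq']
  split_ifs with h
  · rfl
  · rw [homogeneousComponent_eq_zero _ _ (by simpa using h), mul_zero]

lemma hquot {F B : MP} {d k : ℕ} (hF : F.IsHomogeneous d) (hB : B.IsHomogeneous (d + k))
    (h : F ∣ B) : ∃ C : MP, C.IsHomogeneous k ∧ B = F * C := by
  obtain ⟨G, rfl⟩ := h
  refine ⟨_, homogeneousComponent_isHomogeneous k G, ?_⟩
  rw [← hc_mul hF, homogeneousComponent_eq_self hB]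

lemma not_dvd_of_deg {F B : MP} {d k : ℕ} (hF : F.IsHomogeneous d) (hB : B.IsHomogeneous k)
    (hB0 : B ≠ 0) (hkd : k < d) : ¬ F ∣ B := by
  rintro ⟨G, rfl⟩
  have h1 := totalDegree_mul_of_isDomain (left_ne_zero_of_mul hB0) (right_ne_zero_of_mul hB0)
  rw [hB.totalDegree hB0, hF.totalDegree (left_ne_zero_of_mul hB0)] at h1
  omega

lemma top_mul (A B : MP) {a b : ℕ} (ha : A.totalDegree = a) (hb : B.totalDegree = b) :
    homogeneousComponent (a + b) (A * B)
      = homogeneousComponent a A * homogeneousComponent b B := by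
  conv_lhs => rw [← sum_homogeneousComponent A, Finset.sum_mul, map_sum]
  rw [Finset.sum_eq_single a]
  · exact hc_mul (homogeneousComponent_isHomogeneous _ _) _
  · intro i hi hne
    have : i < a := by
      have := Finset.mem_range.1 hi; omega
    rw [show a + b = i + (a - i + b) by omega,
      hc_mul (homogeneousComponent_isHomogeneous _ _),
      homogeneousComponent_eq_zero _ B (by omega), mul_zero]
  · intro h; simp [ha] at h

lemma isUnit_of_deg {A : MP} (h0 : A ≠ 0) (h : A.totalDegree = 0) : IsUnit A := by
  rw [totalDegree_eq_zero_iff_eq_C] at h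
  rw [h] at h0 ⊢
  refine IsUnit.map C (IsUnit.mk0 _ ?_)
  rintro h1; rw [h1] at h0; simp at h0

lemma form_split {F : MP} {d : ℕ} (hd : 0 < d) (h0 : F ≠ 0) (hF : F.IsHomogeneous d)
    (hirr : ¬ Irreducible F) :
    ∃ (A B : MP) (a b : ℕ), 0 < a ∧ 0 < b ∧ a + b = d ∧ A.IsHomogeneous a ∧ B.IsHomogeneous b ∧
      F = A * B := by
  have hnu : ¬ IsUnit F := by
    intro hu
    obtain ⟨G, hG⟩ := hu.exists_right_inv
    have hG0 : G ≠ 0 := by rintro rfl; simp at hG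
    have := totalDegree_mul_of_isDomain h0 hG0
    rw [hG, hF.totalDegree h0, totalDegree_one] at this
    omega
  rw [irreducible_iff] at hirr
  push Not at hirr
  obtain ⟨A, B, hAB, hA, hB⟩ := hirr hnu
  have hA0 : A ≠ 0 := by rintro rfl; simp [hAB] at h0
  have hB0 : B ≠ 0 := by rintro rfl; simp [hAB] at h0
  have ht : d = A.totalDegree + B.totalDegree := by
    rw [← hF.totalDegree h0, hAB, totalDegree_mul_of_isDomain hA0 hB0]
  refine ⟨_, _, A.totalDegree, B.totalDegree, ?_, ?_, ht.symm,
    homogeneousComponent_isHomogeneous _ A, homogeneousComponent_isHomogeneous _ B, ?_⟩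
  · by_contra h; exact hA (isUnit_of_deg hA0 (by omega))
  · by_contra h; exact hB (isUnit_of_deg hB0 (by omega))
  · rw [← top_mul A B rfl rfl, ← hAB, ← ht, homogeneousComponent_eq_self hF]

/-- the linear form -/
noncomputable def lin (a : V3) : MP := C (a 0) * X 0 + C (a 1) * X 1 + C (a 2) * X 2

@[simp] lemma eval_lin (a x : V3) : eval x (lin a) = dt a x := by simp [lin, dt]

lemma lin_hom (a : V3) : (lin a).IsHomogeneous 1 :=
  ((isHomogeneous_C_mul_X _ _).add (isHomogeneous_C_mul_X _ _)).add (isHomogeneous_C_mul_X _ _)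

lemma lin_ne {a : V3} (h : a ≠ 0) : lin a ≠ 0 := by
  intro h0
  have := eval_lin a a
  rw [h0, map_zero] at this
  exact (dt_self_pos h).ne this

lemma eq_lin {L : MP} (h : L.IsHomogeneous 1) : ∃ a : V3, L = lin a := by
  have : L ∈ homogeneousSubmodule (Fin 3) ℝ 1 := h
  rw [homogeneousSubmodule_one_eq_span_X] at this
  clear h
  induction this using Submodule.span_induction with
  | mem x hx =>
    obtain ⟨i, rfl⟩ := hx
    fin_cases i
    · exact ⟨![1, 0, 0], by simp [lin]⟩
    · exact ⟨![0, 1, 0], by simp [lin]⟩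
    · exact ⟨![0, 0, 1], by simp [lin]⟩
  | zero => exact ⟨0, by simp [lin]⟩
  | add x y _ _ hx hy =>
    obtain ⟨a, rfl⟩ := hx
    obtain ⟨b, rfl⟩ := hy
    exact ⟨a + b, by simp [lin]; ring⟩
  | smul c x _ hx =>
    obtain ⟨a, rfl⟩ := hx
    exact ⟨c • a, by simp [lin, smul_eq_C_mul]; ring⟩

lemma lin_irred {a : V3} (h : a ≠ 0) : Irreducible (lin a) := by
  by_contra hi
  obtain ⟨_, _, x, y, hx, hy, hxy, _⟩ := form_split one_pos (lin_ne h) (lin_hom a) hi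
  omega

lemma cubic_split {F : MP} (h0 : F ≠ 0) (hF : F.IsHomogeneous 3) :
    Irreducible F ∨ ∃ (a : V3) (Q : MP), a ≠ 0 ∧ Q ≠ 0 ∧ Q.IsHomogeneous 2 ∧ F = lin a * Q := by
  by_cases hi : Irreducible F
  · exact Or.inl hi
  right
  obtain ⟨A, B, x, y, hx, hy, hxy, hA, hB, rfl⟩ := form_split (by norm_num) h0 hF hi
  have : (x = 1 ∧ y = 2) ∨ (x = 2 ∧ y = 1) := by omega
  rcases this with ⟨rfl, rfl⟩ | ⟨rfl, rfl⟩
  · obtain ⟨a, rfl⟩ := eq_lin hA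
    refine ⟨a, B, ?_, right_ne_zero_of_mul h0, hB, rfl⟩
    rintro rfl; simp [lin] at h0
  · obtain ⟨a, rfl⟩ := eq_lin hB
    refine ⟨a, A, ?_, left_ne_zero_of_mul h0, hA, mul_comm _ _⟩
    rintro rfl; simp [lin] at h0

lemma conic_split {F : MP} (h0 : F ≠ 0) (hF : F.IsHomogeneous 2) :
    Irreducible F ∨ ∃ (a b : V3), a ≠ 0 ∧ b ≠ 0 ∧ F = lin a * lin b := by
  by_cases hi : Irreducible F
  · exact Or.inl hi
  right
  obtain ⟨A, B, x, y, hx, hy, hxy, hA, hB, rfl⟩ := form_split (by norm_num) h0 hF hi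
  obtain ⟨rfl, rfl⟩ : x = 1 ∧ y = 1 := by omega
  obtain ⟨a, rfl⟩ := eq_lin hA
  obtain ⟨b, rfl⟩ := eq_lin hB
  refine ⟨a, b, ?_, ?_, rfl⟩
  · rintro rfl; simp [lin] at h0
  · rintro rfl; simp [lin] at h0

end OL


namespace OL

open MvPolynomial

lemma two_choose (t : ℕ) : 2 * (t + 2).choose 2 = (t + 2) * (t + 1) := by
  induction t with
  | zero => rfl
  | succ t ih =>
    rw [show t + 1 + 2 = (t + 2) + 1 by ring, Nat.choose_succ_succ' (t + 2) 1, mul_add, ih,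
      Nat.choose_one_right]
    ring

/-- multiplication by a form -/
noncomputable def mulF {F : MP} {d : ℕ} (hF : F.IsHomogeneous d) (a b : ℕ) (h : b = d + a) :
    Hm a →ₗ[ℝ] Hm b :=
  LinearMap.codRestrict _ ((LinearMap.mulLeft ℝ F).comp (Hm a).subtype)
    (fun x => by subst h; exact hF.mul x.2)

@[simp] lemma mulF_coe {F : MP} {d : ℕ} (hF : F.IsHomogeneous d) (a b : ℕ) (h : b = d + a)
    (x : Hm a) : (mulF hF a b h x : MP) = F * x := rfl

/-- evaluation at points -/
noncomputable def evN (m : ℕ) {N : ℕ} (x : Fin N → V3) : Hm m →ₗ[ℝ] (Fin N → ℝ) :=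
  LinearMap.pi fun i => (aeval (R := ℝ) (x i)).toLinearMap ∘ₗ (Hm m).subtype

@[simp] lemma evN_apply (m : ℕ) {N : ℕ} (x : Fin N → V3) (F : Hm m) (i : Fin N) :
    evN m x F i = eval (x i) (F : MP) := by
  simp [evN, aeval_eq_eval]

lemma sep_form {u v : V3} (h : cr u v ≠ 0) :
    dt (cr u (cr u v)) u = 0 ∧ dt (cr u (cr u v)) v ≠ 0 := by
  refine ⟨dt_cr_left _ _, ?_⟩
  have : dt (cr u (cr u v)) v = - dt (cr u v) (cr u v) := by simp [dt]; ring
  rw [this]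
  exact neg_ne_zero.2 (dt_self_pos h).ne'

lemma evN_surj (m : ℕ) {N : ℕ} (x : Fin N → V3) (h0 : ∀ i, x i ≠ 0)
    (hx : ∀ i j, i ≠ j → cr (x i) (x j) ≠ 0) (hm : N ≤ m + 1) :
    Function.Surjective (evN m x) := by
  have key : ∀ i, ∃ F : Hm m, evN m x F = Pi.single i 1 := by
    intro i
    let G : MP := (∏ j ∈ Finset.univ.erase i, lin (cr (x j) (cr (x j) (x i)))) *
      lin (x i) ^ (m - (N - 1))
    have hG : G.IsHomogeneous m := by
      have h1 := IsHomogeneous.prod (Finset.univ.erase i)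
        (fun j => lin (cr (x j) (cr (x j) (x i)))) (fun _ => 1) (fun j _ => lin_hom _)
      have h2 := h1.mul ((lin_hom (x i)).pow (m - (N - 1)))
      convert h2 using 1
      simp; omega
    have hGi : eval (x i) G ≠ 0 := by
      simp only [G, map_mul, map_prod, map_pow, eval_lin]
      refine mul_ne_zero (Finset.prod_ne_zero_iff.2 fun j hj => ?_)
        (pow_ne_zero _ (dt_self_pos (h0 i)).ne')
      exact (sep_form (hx j i (Finset.ne_of_mem_erase hj))).2
    have hGj : ∀ j, j ≠ i → eval (x j) G = 0 := by
      intro j hj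
      simp only [G, map_mul, map_prod, map_pow, eval_lin]
      rw [Finset.prod_eq_zero (Finset.mem_erase.2 ⟨hj, Finset.mem_univ j⟩), zero_mul]
      exact (sep_form (hx j i hj)).1
    refine ⟨(eval (x i) G)⁻¹ • ⟨G, hG⟩, ?_⟩
    funext j
    rw [evN_apply]
    by_cases hj : j = i
    · subst hj; simp [smul_eval, hGi]
    · simp [smul_eval, hGj j hj, hj]
  rw [← LinearMap.range_eq_top, eq_top_iff]
  intro y _
  rw [pi_eq_sum_univ' y]
  refine Submodule.sum_mem _ fun i _ => Submodule.smul_mem _ _ ?_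
  obtain ⟨F, hF⟩ := key i
  exact ⟨F, by rw [hF]⟩

/-- weak form of Bezout's theorem -/
lemma bezout {F G : MP} {d e : ℕ} (hirr : Irreducible F) (hF : F.IsHomogeneous d)
    (hG : G.IsHomogeneous e) (hnd : ¬ F ∣ G) {N : ℕ} (x : Fin N → V3) (h0 : ∀ i, x i ≠ 0)
    (hx : ∀ i j, i ≠ j → cr (x i) (x j) ≠ 0) (hFx : ∀ i, eval (x i) F = 0)
    (hGx : ∀ i, eval (x i) G = 0) : N ≤ d * e := by
  let m := N + d + e
  let φ : (Hm (N + e) × Hm (N + d)) →ₗ[ℝ] Hm m :=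
    (mulF hF (N + e) m (by simp only [m]; ring)).coprod (mulF hG (N + d) m (by simp only [m]; ring))
  let χ : Hm N →ₗ[ℝ] (Hm (N + e) × Hm (N + d)) :=
    (-(mulF hG N (N + e) (by ring))).prod (mulF hF N (N + d) (by ring))
  have h1 : LinearMap.ker φ ≤ LinearMap.range χ := by
    rintro ⟨A, B⟩ hAB
    have e1 : F * (A : MP) + G * (B : MP) = 0 := congrArg (fun z : Hm m => (z : MP)) hAB
    have hdvd : F ∣ G * (B : MP) := ⟨-A, by linear_combination e1⟩
    have hB : F ∣ (B : MP) := (hirr.prime.dvd_or_dvd hdvd).resolve_left hnd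
    obtain ⟨c, hc, hBc⟩ := hquot hF (k := N) (by have h := B.2; rw [mem_homogeneousSubmodule] at h; exact (Nat.add_comm N d) ▸ h) hB
    refine ⟨⟨c, hc⟩, ?_⟩
    have hA : (A : MP) = -(G * c) := by
      apply mul_left_cancel₀ hirr.ne_zero
      rw [hBc] at e1
      linear_combination e1
    apply Prod.ext
    · apply Subtype.ext
      simp [χ, hA]
    · apply Subtype.ext
      simp [χ, hBc]
  have h2 : LinearMap.range φ ≤ LinearMap.ker (evN m x) := by
    rintro _ ⟨⟨A, B⟩, rfl⟩
    rw [LinearMap.mem_ker]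
    funext i
    rw [evN_apply]
    simp [φ, hFx, hGx]
  have r1 := LinearMap.finrank_range_add_finrank_ker φ
  have r2 := LinearMap.finrank_range_add_finrank_ker (evN m x)
  have r3 := Submodule.finrank_mono h1
  have r4 := LinearMap.finrank_range_le χ
  have r5 := Submodule.finrank_mono h2
  rw [LinearMap.range_eq_top.2 (evN_surj m x h0 hx (by simp only [m]; omega)), finrank_top,
    Module.finrank_fin_fun] at r2
  rw [Module.finrank_prod] at r1
  rw [finrank_Hm] at r1 r2 r4
  rw [finrank_Hm] at r1
  have t1 := two_choose N
  have t2 := two_choose (N + e)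
  have t3 := two_choose (N + d)
  have t4 := two_choose m
  have t5 : (m + 2) * (m + 1) + (N + 2) * (N + 1) =
    (N + e + 2) * (N + e + 1) + (N + d + 2) * (N + d + 1) + 2 * (d * e) := by
    simp only [m]; ring
  omega

/-- Bezout for a finite set -/
lemma bezout_fin {F G : MP} {d e : ℕ} (hirr : Irreducible F) (hF : F.IsHomogeneous d)
    (hG : G.IsHomogeneous e) (hnd : ¬ F ∣ G) {α : Type*} (s : Finset α) (x : α → V3)
    (h0 : ∀ i ∈ s, x i ≠ 0)
    (hx : ∀ i ∈ s, ∀ j ∈ s, i ≠ j → cr (x i) (x j) ≠ 0) (hFx : ∀ i ∈ s, eval (x i) F = 0)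
    (hGx : ∀ i ∈ s, eval (x i) G = 0) : s.card ≤ d * e := by
  refine bezout hirr hF hG hnd (fun i : Fin s.card => x (s.equivFin.symm i)) ?_ ?_ ?_ ?_
  · intro i; exact h0 _ (s.equivFin.symm i).2
  · intro i j hij
    refine hx _ (s.equivFin.symm i).2 _ (s.equivFin.symm j).2 ?_
    intro h; exact hij (s.equivFin.symm.injective (Subtype.ext h))
  · intro i; exact hFx _ (s.equivFin.symm i).2
  · intro i; exact hGx _ (s.equivFin.symm i).2

/-- enough zeros on a line -/
lemma line_dvd {G : MP} {e : ℕ} {a : V3} (ha : a ≠ 0) (hG : G.IsHomogeneous e)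
    (x : Fin (e + 1) → V3) (h0 : ∀ i, x i ≠ 0) (hx : ∀ i j, i < j → cr (x i) (x j) ≠ 0)
    (hl : ∀ i, dt a (x i) = 0) (hGx : ∀ i, eval (x i) G = 0) : lin a ∣ G := by
  by_contra h
  have := bezout (lin_irred ha) (lin_hom a) hG h x h0 (fun i j hij => ?_)
    (fun i => by rw [eval_lin]; exact hl i) hGx
  · omega
  · rcases lt_or_gt_of_ne hij with h | h
    · exact hx i j h
    · exact cr_ne_swap (hx j i h)

lemma line_dvd4 {G : MP} {a p q r s : V3} (ha : a ≠ 0) (hG : G.IsHomogeneous 3)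
    (h01 : cr p q ≠ 0) (h02 : cr p r ≠ 0) (h03 : cr p s ≠ 0) (h12 : cr q r ≠ 0)
    (h13 : cr q s ≠ 0) (h23 : cr r s ≠ 0) (lp : dt a p = 0) (lq : dt a q = 0)
    (lr : dt a r = 0) (ls : dt a s = 0) (gp : eval p G = 0) (gq : eval q G = 0)
    (gr : eval r G = 0) (gs : eval s G = 0) : lin a ∣ G := by
  refine line_dvd ha hG ![p, q, r, s] ?_ ?_ ?_ ?_
  · intro i; fin_cases i
    exacts [cr_ne_left h01, cr_ne_right h01, cr_ne_right h02, cr_ne_right h03]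
  · intro i j hij
    fin_cases i <;> fin_cases j <;>
      first
        | exact absurd hij (by decide)
        | exact h01
        | exact h02
        | exact h03
        | exact h12
        | exact h13
        | exact h23
  · intro i; fin_cases i
    exacts [lp, lq, lr, ls]
  · intro i; fin_cases i
    exacts [gp, gq, gr, gs]

lemma line_dvd3 {G : MP} {a p q r : V3} (ha : a ≠ 0) (hG : G.IsHomogeneous 2)
    (h01 : cr p q ≠ 0) (h02 : cr p r ≠ 0) (h12 : cr q r ≠ 0)
    (lp : dt a p = 0) (lq : dt a q = 0)
    (lr : dt a r = 0) (gp : eval p G = 0) (gq : eval q G = 0)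
    (gr : eval r G = 0) : lin a ∣ G := by
  refine line_dvd ha hG ![p, q, r] ?_ ?_ ?_ ?_
  · intro i; fin_cases i
    exacts [cr_ne_left h01, cr_ne_right h01, cr_ne_right h02]
  · intro i j hij
    fin_cases i <;> fin_cases j <;>
      first
        | exact absurd hij (by decide)
        | exact h01
        | exact h02
        | exact h12
  · intro i; fin_cases i
    exacts [lp, lq, lr]
  · intro i; fin_cases i
    exacts [gp, gq, gr]

lemma line_dvd2 {G : MP} {a p q : V3} (ha : a ≠ 0) (hG : G.IsHomogeneous 1)
    (h01 : cr p q ≠ 0) (lp : dt a p = 0) (lq : dt a q = 0)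
    (gp : eval p G = 0) (gq : eval q G = 0) : lin a ∣ G := by
  refine line_dvd ha hG ![p, q] ?_ ?_ ?_ ?_
  · intro i; fin_cases i
    exacts [cr_ne_left h01, cr_ne_right h01]
  · intro i j hij
    fin_cases i <;> fin_cases j <;>
      first
        | exact absurd hij (by decide)
        | exact h01
  · intro i; fin_cases i
    exacts [lp, lq]
  · intro i; fin_cases i
    exacts [gp, gq]

lemma off_line {x y p q : V3} (hpq : cr p q ≠ 0) (hxy : cr x y ≠ 0) (xp : dt x p = 0)
    (xq : dt x q = 0) (yq : dt y q = 0) : dt y p ≠ 0 := by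
  intro yp
  obtain ⟨c, rfl⟩ := perp_par hpq xp xq
  obtain ⟨d, rfl⟩ := perp_par hpq yp yq
  apply hxy
  rw [cr_smul, cr_swap, cr_smul, cr_self, smul_zero, neg_zero, smul_zero]

lemma chasles22 {F : MP} (hF : F.IsHomogeneous 3) (X Y : Fin 3 → V3) (M : Fin 3 → Fin 3 → V3)
    (hX : ∀ i j, dt (X i) (M i j) = 0) (hY : ∀ i j, dt (Y j) (M i j) = 0)
    (hr : ∀ i j j', j ≠ j' → cr (M i j) (M i j') ≠ 0)
    (hc : ∀ i i' j, i ≠ i' → cr (M i j) (M i' j) ≠ 0)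
    (hXY : ∀ i j, cr (X i) (Y j) ≠ 0)
    (hz : ∀ i j, (i, j) ≠ (2, 2) → eval (M i j) F = 0) : eval (M 2 2) F = 0 := by
  have X0 : ∀ i, X i ≠ 0 := fun i => cr_ne_left (hXY i 0)
  have offY : ∀ i j j', j ≠ j' → dt (Y j') (M i j) ≠ 0 := fun i j j' h =>
    off_line (hr i j j' h) (hXY i j') (hX i j) (hX i j') (hY i j')
  have offX : ∀ i i' j, i ≠ i' → dt (X i') (M i j) ≠ 0 := fun i i' j h =>
    off_line (hc i i' j h) (cr_ne_swap (hXY i' j)) (hY i j) (hY i' j) (hX i' j)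
  obtain ⟨Q, hQX, hQY⟩ : ∃ Q, dt (X 0) Q = 0 ∧ ∀ j, dt (Y j) Q ≠ 0 := by
    have : ∃ t : ℝ, t ≠ 0 ∧ dt (Y 2) (M 0 0) + t * dt (Y 2) (M 0 1) ≠ 0 := by
      by_contra hcon
      push Not at hcon
      have h1 := hcon 1 (by norm_num)
      have h2 := hcon (-1) (by norm_num)
      exact offY 0 0 2 (by decide) (by linarith)
    obtain ⟨t, ht, ht2⟩ := this
    refine ⟨M 0 0 + t • M 0 1, by simp [hX], ?_⟩
    intro j
    fin_cases j
    · simp [hY, ht, offY 0 1 0 (by decide)]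
    · simp [hY, offY 0 0 1 (by decide)]
    · simpa using ht2
  have hQM : ∀ j, cr (M 0 j) Q ≠ 0 := by
    intro j h
    have hM : M 0 j ≠ 0 := by
      rcases eq_or_ne j 0 with rfl | hj
      · exact cr_ne_left (hr 0 0 1 (by decide))
      · exact cr_ne_left (hr 0 j 0 hj)
    obtain ⟨c, rfl⟩ := par_of_cr hM h
    apply hQY j
    simp [hY]
  set y : MP := lin (Y 0) * lin (Y 1) * lin (Y 2) with hy
  have hyh : y.IsHomogeneous 3 := ((lin_hom _).mul (lin_hom _)).mul (lin_hom _)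
  have hyM : ∀ i j, eval (M i j) y = 0 := by
    intro i j
    simp only [hy, map_mul, eval_lin]
    fin_cases j
    · simp [hY i 0]
    · simp [hY i 1]
    · simp [hY i 2]
  have hyQ : eval Q y ≠ 0 := by
    simp only [hy, map_mul, eval_lin]
    exact mul_ne_zero (mul_ne_zero (hQY 0) (hQY 1)) (hQY 2)
  set G : MP := F - C (eval Q F / eval Q y) * y with hGdef
  have hG : G.IsHomogeneous 3 := hF.sub (hyh.C_mul _)
  have hGM : ∀ i j, eval (M i j) G = eval (M i j) F := by
    intro i j; simp [hGdef, hyM]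
  have hGQ : eval Q G = 0 := by
    simp only [hGdef, map_sub, map_mul, eval_C]
    field_simp
    ring
  have d1 : lin (X 0) ∣ G := by
    refine line_dvd4 (X0 0) hG (hr 0 0 1 (by decide)) (hr 0 0 2 (by decide)) (hQM 0)
      (hr 0 1 2 (by decide)) (hQM 1) (hQM 2) (hX 0 0) (hX 0 1) (hX 0 2) hQX ?_ ?_ ?_ hGQ
    · rw [hGM]; exact hz _ _ (by decide)
    · rw [hGM]; exact hz _ _ (by decide)
    · rw [hGM]; exact hz _ _ (by decide)
  obtain ⟨G1, hG1, e1⟩ := hquot (lin_hom _) (k := 2) hG d1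
  have z1 : ∀ i j, i ≠ 0 → (i, j) ≠ (2, 2) → eval (M i j) G1 = 0 := by
    intro i j hi hij
    have := hGM i j
    rw [hz i j hij, e1, map_mul, eval_lin] at this
    exact (mul_eq_zero.1 this).resolve_left (offX i 0 j hi)
  have d2 : lin (X 1) ∣ G1 := by
    refine line_dvd3 (X0 1) hG1 (hr 1 0 1 (by decide)) (hr 1 0 2 (by decide))
      (hr 1 1 2 (by decide)) (hX 1 0) (hX 1 1) (hX 1 2) ?_ ?_ ?_ <;>
      exact z1 _ _ (by decide) (by decide)
  obtain ⟨G2, hG2, e2⟩ := hquot (lin_hom _) (k := 1) hG1 d2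
  have z2 : ∀ j, j ≠ 2 → eval (M 2 j) G2 = 0 := by
    intro j hj
    have := z1 2 j (by decide) (by simpa using hj)
    rw [e2, map_mul, eval_lin] at this
    exact (mul_eq_zero.1 this).resolve_left (offX 2 1 j (by decide))
  have d3 : lin (X 2) ∣ G2 :=
    line_dvd2 (X0 2) hG2 (hr 2 0 1 (by decide)) (hX 2 0) (hX 2 1)
      (z2 _ (by decide)) (z2 _ (by decide))
  obtain ⟨G3, e3⟩ := d3
  rw [← hGM, e1, e2, e3]
  simp [hX]

/-- Chasles -/
lemma chasles {F : MP} (hF : F.IsHomogeneous 3) (X Y : Fin 3 → V3) (M : Fin 3 → Fin 3 → V3)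
    (hX : ∀ i j, dt (X i) (M i j) = 0) (hY : ∀ i j, dt (Y j) (M i j) = 0)
    (hr : ∀ i j j', j ≠ j' → cr (M i j) (M i j') ≠ 0)
    (hc : ∀ i i' j, i ≠ i' → cr (M i j) (M i' j) ≠ 0)
    (hXY : ∀ i j, cr (X i) (Y j) ≠ 0) (i0 j0 : Fin 3)
    (hz : ∀ i j, (i, j) ≠ (i0, j0) → eval (M i j) F = 0) : eval (M i0 j0) F = 0 := by
  let s := Equiv.swap i0 2
  let t := Equiv.swap j0 2
  have := chasles22 hF (X ∘ s) (Y ∘ t) (fun i j => M (s i) (t j)) (fun i j => hX _ _)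
    (fun i j => hY _ _) (fun i j j' h => hr _ _ _ (t.injective.ne h))
    (fun i i' j h => hc _ _ _ (s.injective.ne h)) (fun i j => hXY _ _) (fun i j h => ?_)
  · simpa [s, t] using this
  · apply hz
    intro h'
    apply h
    rw [Prod.mk.injEq] at h' ⊢
    refine ⟨s.injective ?_, t.injective ?_⟩
    · rw [h'.1]; simp [s]
    · rw [h'.2]; simp [t]

end OL


namespace OL

set_option linter.unusedSectionVars false
variable {ι : Type} [Fintype ι] [DecidableEq ι] {A : Arr ι}

open MvPolynomial

/-- the form vanishes on all lines through `v` -/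
def KZ (A : Arr ι) (F : MP) (v : V3) : Prop := ∀ i, dt (A.a i) v = 0 → eval (A.a i) F = 0

lemma nine_core {F : MP} (hF : F.IsHomogeneous 3) (X Y : Fin 3 → V3) (l : Fin 3 → Fin 3 → ι)
    (hX : ∀ i j, dt (A.a (l i j)) (X i) = 0) (hY : ∀ i j, dt (A.a (l i j)) (Y j) = 0)
    (hr : ∀ i j j', j ≠ j' → l i j ≠ l i j') (hc : ∀ i i' j, i ≠ i' → l i j ≠ l i' j)
    (hXY : ∀ i j, cr (X i) (Y j) ≠ 0)
    (hl : ∀ i k, dt (A.a k) (X i) = 0 → ∃ j, k = l i j) (i0 : ι)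
    (hz : ∀ i k, dt (A.a k) (X i) = 0 → k ≠ i0 → eval (A.a k) F = 0) :
    ∀ i, KZ A F (X i) := by
  intro i k hk
  by_cases hk0 : k = i0
  swap
  · exact hz i k hk hk0
  obtain ⟨j, rfl⟩ := hl i k hk
  refine chasles hF X Y (fun i j => A.a (l i j)) (fun i j => by rw [dt_comm]; exact hX i j)
    (fun i j => by rw [dt_comm]; exact hY i j) (fun i j j' h => A.ne _ _ (hr i j j' h))
    (fun i i' j h => A.ne _ _ (hc i i' j h)) hXY i j ?_
  intro i' j' hij
  refine hz i' _ (hX i' j') ?_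
  rw [← hk0]
  intro he
  by_cases h1 : i' = i
  · subst h1
    by_cases h2 : j' = j
    · subst h2; exact hij rfl
    · exact hr _ _ _ h2 he
  · by_cases h2 : j' = j
    · subst h2
      exact hc _ _ _ h1 he
    · have e1 : l i' j' = l i j' :=
        line_unique (hXY i j') (by rw [he]; exact hX i j) (hY i' j') (hX i j') (hY i j')
      exact hc _ _ _ h1 e1

lemma T.ne {v p q : V3} (h : T A v p q) {i j : ι} (h1 : dt (A.a i) v = 0)
    (h2 : dt (A.a i) p = 0) (h4 : dt (A.a j) q = 0) : i ≠ j := by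
  rintro rfl
  obtain ⟨c, hc, hf⟩ := h.a1.fun_eq h1 h2
  rw [hf] at h4
  exact (mul_ne_zero hc h.pos.ne') h4

lemma tri_lines {v p q r : V3} (hd : (lines A v).card = 3) (h1 : T A v p q) (h2 : T A v q r)
    {i j k : ι} (iv : dt (A.a i) v = 0) (ip : dt (A.a i) p = 0) (jv : dt (A.a j) v = 0)
    (jq : dt (A.a j) q = 0) (kv : dt (A.a k) v = 0) (kr : dt (A.a k) r = 0) :
    i ≠ j ∧ j ≠ k ∧ i ≠ k ∧ ∀ l, dt (A.a l) v = 0 → l = i ∨ l = j ∨ l = k := by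
  have a1 : i ≠ j := h1.ne iv ip jq
  have a2 : j ≠ k := h2.ne jv jq kr
  have a3 : i ≠ k := by
    rintro rfl
    obtain ⟨c, hc, hf⟩ := h1.a1.fun_eq iv ip
    rw [hf] at kr
    exact (mul_ne_zero hc (T.not_col hd h1 h2)) kr
  refine ⟨a1, a2, a3, fun l hl => ?_⟩
  have hs : ({i, j, k} : Finset ι) = lines A v := by
    apply Finset.eq_of_subset_of_card_le
    · intro x hx
      simp only [Finset.mem_insert, Finset.mem_singleton] at hx
      rw [mem_lines]
      rcases hx with rfl | rfl | rfl <;> assumption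
    · rw [hd, Finset.card_eq_three.2 ⟨i, j, k, a1, a3, a2, rfl⟩]
  have : l ∈ ({i, j, k} : Finset ι) := by rw [hs, mem_lines]; exact hl
  simpa using this

lemma three_dirs {v p q r : V3} (hd : (lines A v).card = 3) (h1 : T A v p q) (h2 : T A v q r)
    {l : ι} (hl : dt (A.a l) v = 0) :
    dt (A.a l) p = 0 ∨ dt (A.a l) q = 0 ∨ dt (A.a l) r = 0 := by
  obtain ⟨i, iv, ip⟩ := h1.a1.line
  obtain ⟨j, jv, jq⟩ := h2.a1.line
  obtain ⟨k, kr, kv⟩ := h2.a3.line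
  rcases (tri_lines hd h1 h2 iv ip jv jq kv kr).2.2.2 l hl with rfl | rfl | rfl
  · exact Or.inl ip
  · exact Or.inr (Or.inl jq)
  · exact Or.inr (Or.inr kr)

lemma opp_ne {y p q : V3} (h1 : Adj A y p) (h2 : Adj A y q) {β : ℝ} (hβ : β < 0)
    (he : cr y q = β • cr y p) (dy : (lines A y).card = 3) (dp : (lines A p).card = 3)
    (hn : 7 ≤ Fintype.card ι) : cr p q ≠ 0 := by
  intro h0
  obtain ⟨c, hc⟩ := par_of_cr h1.vr.ne_zero h0
  have hcb : c = β := by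
    rw [hc, cr_smul] at he
    have : (c - β) • cr y p = 0 := by rw [sub_smul, he, sub_self]
    rcases smul_eq_zero.1 this with h | h
    · linarith
    · exact absurd h h1.ind
  subst hcb
  have hall : (Finset.univ : Finset ι) ⊆ lines A y ∪ lines A p := by
    intro j _
    have e1 := h1.compat j
    have e2 := h2.compat j
    rw [hc, dt_smul] at e2
    have : dt (A.a j) y * dt (A.a j) p = 0 := by nlinarith
    rw [Finset.mem_union, mem_lines, mem_lines]
    exact mul_eq_zero.1 this
  have := Finset.card_le_card hall
  have h3 := Finset.card_union_le (lines A y) (lines A p)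
  rw [Finset.card_univ] at this
  omega

lemma opp_line {y p q : V3} (h1 : Adj A y p) {β : ℝ}
    (he : cr y q = β • cr y p) {i : ι} (hy : dt (A.a i) y = 0) (hp : dt (A.a i) p = 0) :
    dt (A.a i) q = 0 := by
  obtain ⟨c, hc, hf⟩ := h1.fun_eq hy hp
  rw [hf]
  have : d3 y p q = - dt (cr y q) p := by simp [d3, dt]; ring
  rw [this, he, smul_dt, dt_cr_right]; simp

lemma T.adj12 {v p q : V3} (h : T A v p q) : Adj A v p := h.a1
lemma T.adj13 {v p q : V3} (h : T A v p q) : Adj A v q := h.a3.symm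
lemma T.adj23 {v p q : V3} (h : T A v p q) : Adj A p q := h.a2

lemma nine {y0 y1 y2 a b c d : V3} (hn : 7 ≤ Fintype.card ι)
    (d0 : (lines A y0).card = 3) (d1 : (lines A y1).card = 3) (d2 : (lines A y2).card = 3)
    (da : (lines A a).card = 3) (db : (lines A b).card = 3) (dc : (lines A c).card = 3)
    (dd : (lines A d).card = 3)
    (t1 : T A y0 y1 a) (t2 : T A y1 y2 b) (t3 : T A y1 b a) (t4 : T A y1 y0 c)
    (t5 : T A y2 y1 d) (t6 : T A y1 c d) {F : MP} (hF : F.IsHomogeneous 3) (i0 : ι)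
    (z0 : ∀ k, dt (A.a k) y0 = 0 → k ≠ i0 → eval (A.a k) F = 0)
    (zb : ∀ k, dt (A.a k) b = 0 → k ≠ i0 → eval (A.a k) F = 0)
    (zd : ∀ k, dt (A.a k) d = 0 → k ≠ i0 → eval (A.a k) F = 0) :
    KZ A F y0 ∧ KZ A F b ∧ KZ A F d := by
  -- straightness at y1
  obtain ⟨β1, hβ1, o1⟩ := T.straight d1 t2 t3 t1.cyc
  obtain ⟨β2, hβ2, o2⟩ := T.straight d1 t3 t1.cyc t4
  obtain ⟨β3, hβ3, o3⟩ := T.straight d1 t1.cyc t4 t6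
  have c02 : cr y0 y2 ≠ 0 := cr_ne_swap (opp_ne t2.adj12 t1.adj12.symm hβ1 o1 d1 d2 hn)
  have cbc : cr b c ≠ 0 := opp_ne t3.adj12 t4.adj13 hβ2 o2 d1 db hn
  have cda : cr d a ≠ 0 := cr_ne_swap (opp_ne t3.adj13 t6.adj13 hβ3 o3 d1 da hn)
  obtain ⟨l00, p00, q00⟩ := t1.adj13.line
  obtain ⟨l01, p01, q01⟩ := t4.adj23.line
  obtain ⟨l02, r02, q02⟩ := t2.adj12.line
  obtain ⟨l10, p10, q10⟩ := t3.adj23.line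
  obtain ⟨l11, r11, p11⟩ := t3.adj12.line
  obtain ⟨l12, q12, p12⟩ := t2.adj23.line
  obtain ⟨l20, r20, q20⟩ := t3.adj13.line
  obtain ⟨l21, q21, p21⟩ := t6.adj23.line
  obtain ⟨l22, q22, p22⟩ := t5.adj13.line
  have p02 := opp_line t2.adj12 o1 r02 q02
  have q11 := opp_line t3.adj12 o2 r11 p11
  have p20 := opp_line t3.adj13 o3 r20 q20
  obtain ⟨R0a, R0b, R0c, R0⟩ := tri_lines d0 t4.cyc t1 p01 q01 p02 r02 p00 q00
  obtain ⟨R1a, R1b, R1c, R1⟩ := tri_lines db t3.cyc t2.cyc.cyc p10 q10 p11 r11 p12 q12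
  obtain ⟨R2a, R2b, R2c, R2⟩ := tri_lines dd t5.cyc.cyc t6.cyc.cyc p22 q22 p20 r20 p21 q21
  obtain ⟨C0a, C0b, C0c, -⟩ := tri_lines da t1.cyc.cyc t3.cyc.cyc q00 p00 q20 r20 q10 p10
  obtain ⟨C1a, C1b, C1c, -⟩ := tri_lines dc t6.cyc t4.cyc.cyc q21 p21 q11 r11 q01 p01
  obtain ⟨C2a, C2b, C2c, -⟩ := tri_lines d2 t2.cyc t5 q12 p12 q02 r02 q22 p22
  have key := nine_core hF ![y0, b, d] ![a, c, y2]
    ![![l00, l01, l02], ![l10, l11, l12], ![l20, l21, l22]]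
    (by intro i j; fin_cases i <;> fin_cases j <;> assumption)
    (by intro i j; fin_cases i <;> fin_cases j <;> assumption)
    (by
      intro i j j' h
      fin_cases i <;> fin_cases j <;> fin_cases j' <;>
        first
          | exact absurd rfl h
          | assumption
          | (apply Ne.symm; assumption))
    (by
      intro i i' j h
      fin_cases j <;> fin_cases i <;> fin_cases i' <;>
        first
          | exact absurd rfl h
          | assumption
          | (apply Ne.symm; assumption))
    (by
      intro i j
      fin_cases i <;> fin_cases j
      exacts [t1.adj13.ind, t4.adj23.ind, c02, t3.adj23.ind, cbc, t2.adj23.symm.ind, cda,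
        t6.adj23.symm.ind, t5.adj13.symm.ind])
    (by
      intro i k hk
      fin_cases i
      · rcases R0 k hk with rfl | rfl | rfl
        exacts [⟨1, rfl⟩, ⟨2, rfl⟩, ⟨0, rfl⟩]
      · rcases R1 k hk with rfl | rfl | rfl
        exacts [⟨0, rfl⟩, ⟨1, rfl⟩, ⟨2, rfl⟩]
      · rcases R2 k hk with rfl | rfl | rfl
        exacts [⟨2, rfl⟩, ⟨0, rfl⟩, ⟨1, rfl⟩])
    i0
    (by
      intro i k hk
      fin_cases i
      exacts [z0 k hk, zb k hk, zd k hk])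
  exact ⟨key 0, key 1, key 2⟩

end OL


namespace OL

set_option linter.unusedSectionVars false
variable {ι : Type} [Fintype ι] [DecidableEq ι] {A : Arr ι}

open MvPolynomial

/-- straight chain of good vertices -/
structure SC (A : Arr ι) (m : ℕ) (v : ℕ → V3) : Prop where
  good : ∀ i, i ≤ m → Good A (v i)
  adj : ∀ i, i < m → Adj A (v i) (v (i + 1))
  str : ∀ i, i + 2 ≤ m → ∃ β : ℝ, β < 0 ∧ cr (v (i + 1)) (v (i + 2)) = β • cr (v (i + 1)) (v i)

lemma SC.col {m : ℕ} {v : ℕ → V3} (h : SC A m v) (hm : 1 ≤ m) :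
    ∃ s : ι, ∀ i, i ≤ m → dt (A.a s) (v i) = 0 := by
  obtain ⟨s, h0, h1⟩ := (h.adj 0 (by omega)).line
  refine ⟨s, ?_⟩
  have key : ∀ i, i + 1 ≤ m → dt (A.a s) (v i) = 0 ∧ dt (A.a s) (v (i + 1)) = 0 := by
    intro i
    induction i with
    | zero => intro _; exact ⟨h0, h1⟩
    | succ i ih =>
      intro hi
      obtain ⟨e1, e2⟩ := ih (by omega)
      obtain ⟨β, _, hb⟩ := h.str i (by omega)
      exact ⟨e2, opp_line (h.adj i (by omega)).symm hb e2 e1⟩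
  intro i hi
  rcases Nat.lt_or_ge i m with h' | h'
  · exact (key i (by omega)).1
  · have := (key (i - 1) (by omega)).2
    rwa [Nat.sub_add_cancel (by omega)] at this

lemma inv_str {x p q : V3} {β : ℝ} (hβ : β < 0) (h : cr x p = β • cr x q) :
    ∃ β' : ℝ, β' < 0 ∧ cr x q = β' • cr x p :=
  ⟨β⁻¹, inv_lt_zero.2 hβ, by rw [h, smul_smul, inv_mul_cancel₀ hβ.ne, one_smul]⟩

lemma SC.up {m : ℕ} {v w : ℕ → V3} (h : SC A m v)
    (hw : ∀ i, i < m → T A (v i) (v (i + 1)) (w i)) :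
    ∀ i, i + 1 < m → T A (v (i + 1)) (w (i + 1)) (w i) := by
  intro i hi
  obtain ⟨β, hβ, hb⟩ := h.str i (by omega)
  obtain ⟨β', hβ', hb'⟩ := inv_str hβ hb
  exact fan (h.good (i + 1) (by omega)) (hw (i + 1) hi) (h.adj i (by omega)).symm hβ' hb'
    (hw i (by omega)).cyc

lemma SC.up_sc {m : ℕ} {v w : ℕ → V3} (h : SC A (m + 1) v)
    (hw : ∀ i, i < m + 1 → T A (v i) (v (i + 1)) (w i))
    (hg : ∀ i, i ≤ m → Good A (w i)) : SC A m w := by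
  have hu := h.up hw
  refine ⟨hg, fun i hi => (hu i (by omega)).adj23.symm, fun i hi => ?_⟩
  exact T.straight (hg (i + 1) (by omega)).deg (hu i (by omega)).cyc
    (hw (i + 1) (by omega)).cyc.cyc (hu (i + 1) (by omega)).cyc.cyc

lemma SC.low {m : ℕ} {v u : ℕ → V3} (h : SC A m v)
    (hw : ∀ i, i < m → T A (v (i + 1)) (v i) (u i)) :
    ∀ i, i + 1 < m → T A (v (i + 1)) (u i) (u (i + 1)) := by
  intro i hi
  obtain ⟨β, hβ, hb⟩ := h.str i (by omega)
  exact fan (h.good (i + 1) (by omega)) (hw i (by omega)) (h.adj (i + 1) (by omega)) hβ hb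
    (hw (i + 1) (by omega)).cyc

lemma SC.low_sc {m : ℕ} {v u : ℕ → V3} (h : SC A (m + 1) v)
    (hw : ∀ i, i < m + 1 → T A (v (i + 1)) (v i) (u i))
    (hg : ∀ i, i ≤ m → Good A (u i)) : SC A m u := by
  have hu := h.low hw
  refine ⟨hg, fun i hi => (hu i (by omega)).adj23, fun i hi => ?_⟩
  obtain ⟨β, hβ, hb⟩ := T.straight (hg (i + 1) (by omega)).deg (hu (i + 1) (by omega)).cyc
    (hw (i + 1) (by omega)).cyc.cyc (hu i (by omega)).cyc.cyc
  exact inv_str hβ hb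

lemma chain_small {m : ℕ} {v : ℕ → V3} (h : SC A m v) (hm : m ≤ 2) :
    ∃ F : MP, F ≠ 0 ∧ F.IsHomogeneous 3 ∧ ∀ i, i ≤ m → KZ A F (v i) := by
  let U := (Finset.range (m + 1)).biUnion (fun i => lines A (v i))
  have hU : U.card ≤ 9 := by
    have := Finset.card_biUnion_le_card_mul (Finset.range (m + 1)) (fun i => lines A (v i)) 3
      (fun i hi => ((h.good i (by have := Finset.mem_range.1 hi; omega)).deg).le)
    rw [Finset.card_range] at this
    simp only [U]
    omega
  obtain ⟨F, h0, h1, h2⟩ := cubic_exists (U.image A.a) (Finset.card_image_le.trans hU)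
  refine ⟨F, h0, h1, fun i hi j hj => h2 _ (Finset.mem_image_of_mem _ ?_)⟩
  exact Finset.mem_biUnion.2 ⟨i, Finset.mem_range.2 (by omega), mem_lines.2 hj⟩

lemma chain_cubic {m : ℕ} {v : ℕ → V3} (hn : 7 ≤ Fintype.card ι) (h : SC A m v)
    (hv : ∀ i, i ≤ m → VG A (v i)) :
    ∃ F : MP, F ≠ 0 ∧ F.IsHomogeneous 3 ∧ ∀ i, i ≤ m → KZ A F (v i) := by
  by_cases hm : m ≤ 2
  · exact chain_small h hm
  obtain ⟨m, rfl⟩ : ∃ k, m = k + 2 := ⟨m - 2, by omega⟩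
  have e1 : ∀ i, i < m + 2 → ∃ x, T A (v i) (v (i + 1)) x := fun i hi =>
    (h.good i (by omega)).ex _ (h.adj i hi)
  choose! w hw using e1
  have e2 : ∀ i, i < m + 2 → ∃ x, T A (v (i + 1)) (v i) x := fun i hi =>
    (h.good (i + 1) (by omega)).ex _ (h.adj i hi).symm
  choose! u hu using e2
  have gw : ∀ i, i ≤ m + 1 → Good A (w i) := fun i hi =>
    ((hv i (by omega)).2 _ (hw i (by omega)).adj13).1
  have gu : ∀ i, i ≤ m + 1 → Good A (u i) := fun i hi =>
    ((hv (i + 1) (by omega)).2 _ (hu i (by omega)).adj13).1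
  have scw : SC A (m + 1) w := h.up_sc hw gw
  have scu : SC A (m + 1) u := h.low_sc hu gu
  have e3 : ∀ i, i < m + 1 → ∃ x, T A (w i) (w (i + 1)) x := fun i hi =>
    (gw i (by omega)).ex _ (scw.adj i hi)
  choose! x hx using e3
  have gx : ∀ i, i ≤ m → Good A (x i) := fun i hi =>
    ((hv i (by omega)).2 _ (hw i (by omega)).adj13).2 _ (hx i (by omega)).adj13
  have scx : SC A m x := scw.up_sc hx gx
  have uw := h.up hw
  have lu := h.low hu
  have ux := scw.up hx
  obtain ⟨s, hs⟩ := scw.col (by omega)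
  obtain ⟨s', hs'⟩ := scx.col (by omega)
  obtain ⟨t, ht⟩ := scu.col (by omega)
  obtain ⟨sv, hsv⟩ := h.col (by omega)
  obtain ⟨A0, hA0v, hA0w⟩ := (hw 0 (by omega)).adj13.line
  -- the cubic
  let U : Finset ι := (lines A (v 1) ∪ lines A (v 2)) ∪ {s, s', t, A0}
  have hU : U.card ≤ 9 := by
    have c1 : (lines A (v 1) ∪ lines A (v 2)).card ≤ 5 := by
      have := Finset.card_union_add_card_inter (lines A (v 1)) (lines A (v 2))
      rw [(h.good 1 (by omega)).deg, (h.good 2 (by omega)).deg] at this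
      have h2 : 0 < (lines A (v 1) ∩ lines A (v 2)).card := by
        rw [Finset.card_pos]
        exact ⟨sv, Finset.mem_inter.2 ⟨mem_lines.2 (hsv 1 (by omega)),
          mem_lines.2 (hsv 2 (by omega))⟩⟩
      omega
    have c2 : ({s, s', t, A0} : Finset ι).card ≤ 4 := Finset.card_le_four
    have := Finset.card_union_le (lines A (v 1) ∪ lines A (v 2)) {s, s', t, A0}
    simp only [U]
    omega
  obtain ⟨F, F0, F1, F2⟩ := cubic_exists (U.image A.a) (Finset.card_image_le.trans hU)
  have hZ : ∀ i ∈ U, eval (A.a i) F = 0 := fun i hi => F2 _ (Finset.mem_image_of_mem _ hi)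
  have Zs : eval (A.a s) F = 0 := hZ s (by simp [U])
  have Zs' : eval (A.a s') F = 0 := hZ s' (by simp [U])
  have Zt : eval (A.a t) F = 0 := hZ t (by simp [U])
  have ZA : eval (A.a A0) F = 0 := hZ A0 (by simp [U])
  have K1 : KZ A F (v 1) := fun i hi => hZ i (by simp [U, hi])
  have K2 : KZ A F (v 2) := fun i hi => hZ i (by simp [U, hi])
  -- lines through w i
  have Lw : ∀ i, i < m + 2 → ∀ k, dt (A.a k) (w i) = 0 →
      dt (A.a k) (v i) = 0 ∨ dt (A.a k) (v (i + 1)) = 0 ∨ k = s := by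
    intro i hi k hk
    rcases Nat.eq_zero_or_pos i with rfl | hpos
    · rcases three_dirs (gw 0 (by omega)).deg (hw 0 hi).cyc.cyc (uw 0 (by omega)).cyc.cyc hk
        with h1 | h1 | h1
      · exact Or.inl h1
      · exact Or.inr (Or.inl h1)
      · right; right
        exact line_unique (scw.adj 0 (by omega)).ind hk h1 (hs 0 (by omega)) (hs 1 (by omega))
    · obtain ⟨j, rfl⟩ : ∃ j, i = j + 1 := ⟨i - 1, by omega⟩
      rcases three_dirs (gw (j + 1) (by omega)).deg (uw j (by omega)).cyc (hw (j + 1) hi).cyc.cyc hk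
        with h1 | h1 | h1
      · right; right
        exact line_unique (scw.adj j (by omega)).ind h1 hk (hs j (by omega)) (hs (j + 1) (by omega))
      · exact Or.inl h1
      · exact Or.inr (Or.inl h1)
  -- lines through u (j+1)
  have Lu : ∀ j, j + 1 < m + 2 → ∀ k, dt (A.a k) (u (j + 1)) = 0 →
      dt (A.a k) (v (j + 1)) = 0 ∨ dt (A.a k) (v (j + 2)) = 0 ∨ k = t := by
    intro j hj k hk
    rcases three_dirs (gu (j + 1) (by omega)).deg (hu (j + 1) (by omega)).cyc.cyc
        (lu j (by omega)).cyc.cyc hk with h1 | h1 | h1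
    · exact Or.inr (Or.inl h1)
    · exact Or.inl h1
    · right; right
      exact line_unique (scu.adj j (by omega)).ind h1 hk (ht j (by omega)) (ht (j + 1) (by omega))
  -- nine points for the `v` chain
  have nineV : ∀ j, j + 2 ≤ m + 2 → ∀ i0,
      (∀ k, dt (A.a k) (v j) = 0 → k ≠ i0 → eval (A.a k) F = 0) →
      (∀ k, dt (A.a k) (w (j + 1)) = 0 → k ≠ i0 → eval (A.a k) F = 0) →
      (∀ k, dt (A.a k) (u (j + 1)) = 0 → k ≠ i0 → eval (A.a k) F = 0) →
      KZ A F (v j) ∧ KZ A F (w (j + 1)) ∧ KZ A F (u (j + 1)) := by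
    intro j hj i0 z0 zb zd
    exact nine hn (h.good j (by omega)).deg (h.good (j + 1) (by omega)).deg
      (h.good (j + 2) (by omega)).deg (gw j (by omega)).deg (gw (j + 1) (by omega)).deg
      (gu j (by omega)).deg (gu (j + 1) (by omega)).deg
      (hw j (by omega)) (hw (j + 1) (by omega)) (uw j (by omega)) (hu j (by omega))
      (hu (j + 1) (by omega)) (lu j (by omega)) F1 i0 z0 zb zd
  have nineW : ∀ j, j + 2 ≤ m + 1 → ∀ i0,
      (∀ k, dt (A.a k) (w j) = 0 → k ≠ i0 → eval (A.a k) F = 0) →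
      (∀ k, dt (A.a k) (x (j + 1)) = 0 → k ≠ i0 → eval (A.a k) F = 0) →
      (∀ k, dt (A.a k) (v (j + 2)) = 0 → k ≠ i0 → eval (A.a k) F = 0) →
      KZ A F (w j) ∧ KZ A F (x (j + 1)) ∧ KZ A F (v (j + 2)) := by
    intro j hj i0 z0 zb zd
    exact nine hn (gw j (by omega)).deg (gw (j + 1) (by omega)).deg
      (gw (j + 2) (by omega)).deg (gx j (by omega)).deg (gx (j + 1) (by omega)).deg
      (h.good (j + 1) (by omega)).deg (h.good (j + 2) (by omega)).deg
      (hx j (by omega)) (hx (j + 1) (by omega)) (ux j (by omega)) (uw j (by omega)).cyc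
      (uw (j + 1) (by omega)).cyc (hw (j + 1) (by omega)).cyc.cyc F1 i0 z0 zb zd
  -- `v 0`
  have K0 : KZ A F (v 0) := by
    obtain ⟨b0, hb0v, hb0u⟩ := (hu 0 (by omega)).adj23.line
    refine (nineV 0 (by omega) b0 ?_ ?_ ?_).1
    · intro k hk hne
      rcases three_dirs (h.good 0 (by omega)).deg (hu 0 (by omega)).cyc (hw 0 (by omega)) hk
        with h1 | h1 | h1
      · exact absurd (line_unique (hu 0 (by omega)).adj23.ind hk h1 hb0v hb0u) hne
      · exact K1 k h1
      · rw [line_unique (hw 0 (by omega)).adj13.ind hk h1 hA0v hA0w]; exact ZA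
    · intro k hk _
      rcases Lw 1 (by omega) k hk with h1 | h1 | rfl
      exacts [K1 k h1, K2 k h1, Zs]
    · intro k hk _
      rcases Lu 0 (by omega) k hk with h1 | h1 | rfl
      exacts [K1 k h1, K2 k h1, Zt]
  have step : ∀ j, j + 3 ≤ m + 2 → KZ A F (v j) → KZ A F (v (j + 1)) → KZ A F (v (j + 2)) →
      KZ A F (v (j + 3)) := by
    intro j hj k0 k1 k2
    obtain ⟨B, hBw, hBv⟩ := (hw (j + 2) (by omega)).adj23.symm.line
    have hBx : dt (A.a B) (x (j + 1)) = 0 := by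
      obtain ⟨β, hβ, hb⟩ := T.straight (gw (j + 2) (by omega)).deg
        (hx (j + 1) (by omega)).cyc (uw (j + 1) (by omega)).cyc (hw (j + 2) (by omega)).cyc.cyc
      obtain ⟨β', _, hb'⟩ := inv_str hβ hb
      exact opp_line (hw (j + 2) (by omega)).adj23.symm hb' hBw hBv
    have hB : eval (A.a B) F = 0 := by
      have := nineW j (by omega) B ?_ ?_ ?_
      · exact this.2.1 B hBx
      · intro k hk _
        rcases Lw j (by omega) k hk with h1 | h1 | rfl
        exacts [k0 k h1, k1 k h1, Zs]
      · intro k hk hne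
        rcases three_dirs (gx (j + 1) (by omega)).deg (ux j (by omega)).cyc
          (hx (j + 1) (by omega)).cyc.cyc hk with h1 | h1 | h1
        · rw [line_unique (scx.adj j (by omega)).ind h1 hk (hs' j (by omega))
            (hs' (j + 1) (by omega))]
          exact Zs'
        · obtain ⟨β, hβ, hb⟩ := T.straight (gw (j + 1) (by omega)).deg
            (ux j (by omega)) (hx j (by omega)).cyc (uw j (by omega)).cyc
          exact k1 k (opp_line (ux j (by omega)).adj12 hb h1 hk)
        · exact absurd (line_unique (hx (j + 1) (by omega)).adj23.ind h1 hk hBw hBx) hne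
      · intro k hk _
        exact k2 k hk
    obtain ⟨a, hav, hau⟩ := (hu (j + 2) (by omega)).adj13.line
    have ha : eval (A.a a) F = 0 := by
      have := nineV (j + 1) (by omega) a ?_ ?_ ?_
      · exact this.2.2 a hau
      · intro k hk _
        exact k1 k hk
      · intro k hk _
        rcases Lw (j + 2) (by omega) k hk with h1 | h1 | rfl
        · exact k2 k h1
        · rw [line_unique (hw (j + 2) (by omega)).adj23.ind h1 hk hBv hBw]; exact hB
        · exact Zs
      · intro k hk hne
        rcases Lu (j + 1) (by omega) k hk with h1 | h1 | rfl
        · exact k2 k h1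
        · exact absurd (line_unique (hu (j + 2) (by omega)).adj13.ind h1 hk hav hau) hne
        · exact Zt
    intro k hk
    rcases three_dirs (h.good (j + 3) (by omega)).deg (hw (j + 2) (by omega)).cyc
      (hu (j + 2) (by omega)) hk with h1 | h1 | h1
    · rw [line_unique (hw (j + 2) (by omega)).adj23.ind hk h1 hBv hBw]; exact hB
    · exact k2 k h1
    · rw [line_unique (hu (j + 2) (by omega)).adj13.ind hk h1 hav hau]; exact ha
  have all : ∀ i, (i + 2 ≤ m + 2 → KZ A F (v i) ∧ KZ A F (v (i + 1)) ∧ KZ A F (v (i + 2))) := by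
    intro i
    induction i with
    | zero => intro _; exact ⟨K0, K1, K2⟩
    | succ i ih =>
      intro hi
      obtain ⟨a, b, c⟩ := ih (by omega)
      exact ⟨b, c, step i (by omega) a b c⟩
  refine ⟨F, F0, F1, fun i hi => ?_⟩
  rcases Nat.lt_or_ge i 2 with h' | h'
  · have : i = 0 ∨ i = 1 := by omega
    rcases this with rfl | rfl
    · exact K0
    · exact K1
  · have := (all (i - 2) (by omega)).2.2
    rwa [show i - 2 + 2 = i by omega] at this

end OL


namespace OL

set_option linter.unusedSectionVars false
variable {ι : Type} [Fintype ι] [DecidableEq ι] {A : Arr ι}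

open MvPolynomial

open Classical in
/-- decomposition of a long chain into runs of very good vertices -/
lemma blocks (hn : 7 ≤ Fintype.card ι) (k : ℕ) (V : ℕ → V3)
    (hadj : ∀ i, i + 1 < k → Adj A (V i) (V (i + 1)))
    (hstr : ∀ i, i + 2 < k → ∃ β : ℝ, β < 0 ∧
      cr (V (i + 1)) (V (i + 2)) = β • cr (V (i + 1)) (V i)) :
    ∃ F : ℕ → MP, (∀ c, F c ≠ 0 ∧ (F c).IsHomogeneous 3) ∧
      ∀ i, i < k → VG A (V i) →
        KZ A (F (((Finset.range i).filter (fun j => ¬ VG A (V j))).card)) (V i) := by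
  let cnt : ℕ → ℕ := fun i => ((Finset.range i).filter (fun j => ¬ VG A (V j))).card
  have key : ∀ c, ∃ F : MP, (F ≠ 0 ∧ F.IsHomogeneous 3) ∧
      ∀ i, i < k → VG A (V i) → cnt i = c → KZ A F (V i) := by
    intro c
    let S := (Finset.range k).filter (fun i => VG A (V i) ∧ cnt i = c)
    have memS : ∀ i, i ∈ S ↔ i < k ∧ VG A (V i) ∧ cnt i = c := by
      intro i; simp [S]
    rcases S.eq_empty_or_nonempty with hS | hS
    · obtain ⟨F, h0, h1, -⟩ := cubic_exists ∅ (by simp)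
      refine ⟨F, ⟨h0, h1⟩, fun i hi hv hc => ?_⟩
      have := (memS i).2 ⟨hi, hv, hc⟩
      rw [hS] at this; simp at this
    · set i0 := S.min' hS
      set i1 := S.max' hS
      obtain ⟨a0, b0, c0⟩ := (memS _).1 (S.min'_mem hS)
      obtain ⟨a1, b1, c1⟩ := (memS _).1 (S.max'_mem hS)
      have h01 : i0 ≤ i1 := S.min'_le _ (S.max'_mem hS)
      have mid : ∀ j, i0 ≤ j → j ≤ i1 → VG A (V j) := by
        intro j hj0 hj1
        by_contra hb
        have hne : j ≠ i1 := by rintro rfl; exact hb b1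
        have : cnt i0 < cnt i1 := by
          apply Finset.card_lt_card
          rw [Finset.ssubset_iff_of_subset]
          · refine ⟨j, ?_, ?_⟩
            · simp only [Finset.mem_filter, Finset.mem_range]; exact ⟨by omega, hb⟩
            · simp only [Finset.mem_filter, Finset.mem_range]; omega
          · apply Finset.filter_subset_filter
            exact Finset.range_mono h01
        have e0 : cnt i0 = c := c0
        have e1 : cnt i1 = c := c1
        omega
      have a1' : i1 < k := a1
      obtain ⟨F, h0, h1, h2⟩ := chain_cubic (A := A) (m := i1 - i0) (v := fun i => V (i0 + i)) hn
        ⟨fun i hi => (mid _ (by omega) (by omega)).1,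
          fun i hi => hadj (i0 + i) (by omega),
          fun i hi => hstr (i0 + i) (by omega)⟩ (fun i hi => mid _ (by omega) (by omega))
      refine ⟨F, ⟨h0, h1⟩, fun i hi hv hc => ?_⟩
      have hm := (memS i).2 ⟨hi, hv, hc⟩
      have q0 : i0 ≤ i := S.min'_le _ hm
      have q1 : i ≤ i1 := S.le_max' _ hm
      have := h2 (i - i0) (by omega)
      rwa [show i0 + (i - i0) = i by omega] at this
  choose F hF using key
  exact ⟨F, fun c => (hF c).1, fun i hi hv => (hF _).2 i hi hv rfl⟩

/-- coordinates on a plane -/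
lemma plane_coord {a e : V3} (ha : a ≠ 0) (he : e ≠ 0) (hae : dt a e = 0) :
    ∃ (f N : V3), N ≠ 0 ∧ dt f e = 0 ∧ ∀ v v', dt a v = 0 → dt a v' = 0 →
      cr v v' = (dt e v * dt f v' - dt f v * dt e v') • N := by
  have pa := dt_self_pos ha
  have pe := dt_self_pos he
  refine ⟨cr a e, (dt a a * dt e e)⁻¹ • a, ?_, dt_cr_right a e, ?_⟩
  · exact smul_ne_zero (by positivity) ha
  · intro v v' hv hv'
    have hcr : cr (cr v v') a = 0 := by
      have h1 : cr (cr v v') a = dt a v • v' - dt a v' • v := by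
        apply v3_ext <;> simp [dt] <;> ring
      rw [h1, hv, hv']; simp
    have hcr' : cr a (cr v v') = 0 := by rw [cr_swap, hcr, neg_zero]
    obtain ⟨c, hc⟩ := par_of_cr ha hcr'
    have h2 : dt e v * dt (cr a e) v' - dt (cr a e) v * dt e v'
        = dt (cr e (cr a e)) (cr v v') := by simp [dt]; ring
    have h3 : cr e (cr a e) = dt e e • a - dt a e • e := by
      apply v3_ext <;> simp [dt] <;> ring
    rw [h2, h3, hae, zero_smul, sub_zero, smul_dt, hc, dt_smul, smul_smul]
    congr 1
    field_simp

/-- sorted enumeration of a finite set by a real function -/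
lemma enum_sorted {α : Type} [Inhabited α] (S : Finset α) (τ : α → ℝ)
    (hinj : ∀ v ∈ S, ∀ v' ∈ S, τ v = τ v' → v = v') :
    ∃ V : ℕ → α, (∀ i, i < S.card → V i ∈ S) ∧ (∀ i j, i < j → j < S.card → τ (V i) < τ (V j)) ∧
      ∀ v ∈ S, ∃ i, i < S.card ∧ V i = v := by
  have hc : (S.image τ).card = S.card := Finset.card_image_of_injOn (fun v hv v' hv' h =>
    hinj v hv v' hv' h)
  let f := (S.image τ).orderEmbOfFin hc
  have h1 : ∀ i : ℕ, ∃ v : α, ∀ h : i < S.card, v ∈ S ∧ τ v = f ⟨i, h⟩ := by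
    intro i
    by_cases h : i < S.card
    · have := Finset.orderEmbOfFin_mem (S.image τ) hc ⟨i, h⟩
      obtain ⟨v, hv, e⟩ := Finset.mem_image.1 this
      exact ⟨v, fun _ => ⟨hv, e⟩⟩
    · exact ⟨default, fun h' => absurd h' h⟩
  choose V hV using h1
  refine ⟨V, fun i hi => (hV i hi).1, fun i j hij hj => ?_, fun v hv => ?_⟩
  · rw [(hV i (hij.trans hj)).2, (hV j hj).2]
    exact f.strictMono hij
  · have : τ v ∈ Set.range f := by
      rw [Finset.range_orderEmbOfFin]
      exact Finset.mem_coe.2 (Finset.mem_image_of_mem _ hv)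
    obtain ⟨⟨i, hi⟩, e⟩ := this
    exact ⟨i, hi, hinj _ (hV i hi).1 _ hv (by rw [(hV i hi).2, e])⟩

open Classical in
lemma propA (hn : 7 ≤ Fintype.card ι) (p : ι) :
    ∃ (B : Finset V3) (Fs : Finset MP), B.card ≤ (bl A p).card + 1 ∧
      Fs.card ≤ (bl A p).card + 1 ∧ (∀ F ∈ Fs, F ≠ 0 ∧ F.IsHomogeneous 3) ∧
      (∀ b ∈ B, b ≠ 0 ∧ dt (A.a p) b = 0) ∧
      ∀ q, q ≠ p → (∃ b ∈ B, dt (A.a q) b = 0) ∨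
        (∃ v, dt (A.a p) v = 0 ∧ dt (A.a q) v = 0 ∧ (lines A v).card = 3 ∧
          ∃ F ∈ Fs, KZ A F v) := by
  obtain ⟨q0, hq0⟩ : ∃ q, q ≠ p := by
    have : Nontrivial ι := Fintype.one_lt_card_iff_nontrivial.1 (by omega)
    exact exists_ne p
  have hap : A.a p ≠ 0 := A_ne A hq0.symm
  have vx : ∀ q, q ≠ p → ∃ v, Vert A v ∧ dt (A.a p) v = 0 ∧ dt (A.a q) v = 0 := by
    intro q hq
    have h := A.ne p q hq.symm
    exact ⟨_, vert_normalize h hq.symm (dt_left_cr _ _) (dt_right_cr _ _),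
      by rw [dt_smul, dt_left_cr, mul_zero], by rw [dt_smul, dt_right_cr, mul_zero]⟩
  obtain ⟨e, ve, hpe, -⟩ := vx q0 hq0
  obtain ⟨f, N, hN, hfe, hcr⟩ := plane_coord hap ve.ne_zero hpe
  let S := (VS A).filter (fun v => dt (A.a p) v = 0 ∧ 0 < dt f v)
  have memS : ∀ v, v ∈ S ↔ Vert A v ∧ dt (A.a p) v = 0 ∧ 0 < dt f v := by
    intro v; simp [S]
  let τ : V3 → ℝ := fun v => dt e v / dt f v
  have hcrτ : ∀ v ∈ S, ∀ v' ∈ S, cr v v' = (dt f v * dt f v' * (τ v - τ v')) • N := by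
    intro v hv v' hv'
    obtain ⟨_, b, c⟩ := (memS v).1 hv
    obtain ⟨_, b', c'⟩ := (memS v').1 hv'
    rw [hcr v v' b b']
    congr 1
    simp only [τ]
    field_simp
  have hinj : ∀ v ∈ S, ∀ v' ∈ S, τ v = τ v' → v = v' := by
    intro v hv v' hv' h
    have h0 := hcrτ v hv v' hv'
    rw [h, sub_self, mul_zero, zero_smul] at h0
    obtain ⟨a, b, c⟩ := (memS v).1 hv
    obtain ⟨a', b', c'⟩ := (memS v').1 hv'
    obtain ⟨k, hk⟩ := par_of_cr a.ne_zero h0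
    rw [hk, dt_smul] at c'
    exact (norm_eq_of_smul a.1 a'.1 ((pos_iff_pos_of_mul_pos c').2 c) hk).symm
  obtain ⟨V, V1, V2, V3'⟩ := enum_sorted S τ hinj
  have hadj : ∀ i, i + 1 < S.card → Adj A (V i) (V (i + 1)) := by
    intro i hi
    have m1 := V1 i (by omega)
    have m2 := V1 (i + 1) hi
    obtain ⟨a, b, c⟩ := (memS _).1 m1
    obtain ⟨a', b', c'⟩ := (memS _).1 m2
    have hlt := V2 i (i + 1) (by omega) hi
    refine ⟨a, a', ?_, ⟨p, b, b'⟩, ?_⟩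
    · rw [hcrτ _ m1 _ m2]
      refine smul_ne_zero (mul_ne_zero (mul_pos c c').ne' ?_) hN
      exact (sub_neg.2 hlt).ne
    · intro j
      by_contra hneg
      push Not at hneg
      set v := V i
      set v' := V (i + 1)
      set s := dt (A.a j) v
      set s' := dt (A.a j) v'
      have hs : s ≠ 0 := by intro h; rw [h] at hneg; simp at hneg
      have hs' : s' ≠ 0 := by intro h; rw [h] at hneg; simp at hneg
      have hss : |s'| * s + |s| * s' = 0 := by
        rcases lt_or_gt_of_ne hs with h | h
        · have h' : 0 < s' := by nlinarith
          rw [abs_of_neg h, abs_of_pos h']; ring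
        · have h' : s' < 0 := by nlinarith
          rw [abs_of_pos h, abs_of_neg h']; ring
      have ps := abs_pos.2 hs
      have ps' := abs_pos.2 hs'
      let z := |s'| • v + |s| • v'
      have zf : 0 < dt f z := by
        simp only [z, dt_add, dt_smul]; positivity
      have zne : z ≠ 0 := by intro h; rw [h] at zf; simp at zf
      have zp : dt (A.a p) z = 0 := by simp [z, b, b']
      have zj : dt (A.a j) z = 0 := by simp only [z, dt_add, dt_smul]; exact hss
      have hjp : p ≠ j := by rintro rfl; exact hs b
      have zV := vert_normalize zne hjp zp zj
      have nz : 0 < ‖z‖⁻¹ := inv_pos.2 (norm_pos_iff.2 zne)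
      have zS : ‖z‖⁻¹ • z ∈ S := (memS _).2 ⟨zV, by simp [zp], by
        rw [dt_smul]; positivity⟩
      have zτ : τ (‖z‖⁻¹ • z) = dt e z / dt f z := by
        simp only [τ, dt_smul]
        rw [mul_div_mul_left _ _ nz.ne']
      have ev : dt e v = τ v * dt f v := by simp only [τ]; field_simp
      have ev' : dt e v' = τ v' * dt f v' := by simp only [τ]; field_simp
      have z1 : τ v < dt e z / dt f z := by
        rw [lt_div_iff₀ zf]
        simp only [z, dt_add, dt_smul, ev, ev']
        have : 0 < |s| * dt f v' * (τ v' - τ v) := mul_pos (mul_pos ps c') (sub_pos.2 hlt)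
        nlinarith
      have z2 : dt e z / dt f z < τ v' := by
        rw [div_lt_iff₀ zf]
        simp only [z, dt_add, dt_smul, ev, ev']
        have : 0 < |s'| * dt f v * (τ v' - τ v) := mul_pos (mul_pos ps' c) (sub_pos.2 hlt)
        nlinarith
      obtain ⟨l, hl, hVl⟩ := V3' _ zS
      rw [← zτ, ← hVl] at z1 z2
      rcases Nat.lt_or_ge i l with h | h
      · rcases Nat.lt_or_ge (i + 1) l with h' | h'
        · exact absurd (V2 _ _ h' hl) (not_lt.2 z2.le)
        · obtain rfl : l = i + 1 := by omega
          exact lt_irrefl _ z2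
      · rcases Nat.lt_or_ge l i with h' | h'
        · exact absurd (V2 _ _ h' (by omega)) (not_lt.2 z1.le)
        · obtain rfl : l = i := by omega
          exact lt_irrefl _ z1
  have hstr : ∀ i, i + 2 < S.card → ∃ β : ℝ, β < 0 ∧
      cr (V (i + 1)) (V (i + 2)) = β • cr (V (i + 1)) (V i) := by
    intro i hi
    have m0 := V1 i (by omega)
    have m1 := V1 (i + 1) (by omega)
    have m2 := V1 (i + 2) hi
    have c0 := ((memS _).1 m0).2.2
    have c1 := ((memS _).1 m1).2.2
    have c2 := ((memS _).1 m2).2.2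
    have l1 := V2 i (i + 1) (by omega) (by omega)
    have l2 := V2 (i + 1) (i + 2) (by omega) hi
    rw [hcrτ _ m1 _ m2, hcrτ _ m1 _ m0]
    refine ⟨(dt f (V (i + 1)) * dt f (V (i + 2)) * (τ (V (i + 1)) - τ (V (i + 2)))) /
      (dt f (V (i + 1)) * dt f (V i) * (τ (V (i + 1)) - τ (V i))), ?_, ?_⟩
    · apply div_neg_of_neg_of_pos
      · exact mul_neg_of_pos_of_neg (mul_pos c1 c2) (sub_neg.2 l2)
      · exact mul_pos (mul_pos c1 c0) (sub_pos.2 l1)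
    · rw [smul_smul, div_mul_cancel₀]
      exact (mul_pos (mul_pos c1 c0) (sub_pos.2 l1)).ne'
  obtain ⟨F, hF, hK⟩ := blocks hn S.card V hadj hstr
  have Vbl : ∀ i, i < S.card → ¬ VG A (V i) → V i ∈ bl A p := by
    intro i hi h
    obtain ⟨a, b, c⟩ := (memS _).1 (V1 i hi)
    simp [bl, a, b, h]
  refine ⟨insert e (bl A p), (Finset.range ((bl A p).card + 1)).image F,
    Finset.card_insert_le _ _, Finset.card_image_le.trans (by simp), ?_, ?_, ?_⟩
  · intro G hG
    obtain ⟨c, -, rfl⟩ := Finset.mem_image.1 hG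
    exact hF c
  · intro b hb
    rcases Finset.mem_insert.1 hb with rfl | hb
    · exact ⟨ve.ne_zero, hpe⟩
    · simp only [bl, Finset.mem_filter, mem_VS] at hb
      exact ⟨hb.1.ne_zero, hb.2.1⟩
  · intro q hq
    obtain ⟨v0, hv0, hpv0, hqv0⟩ := vx q hq
    by_cases hf0 : dt f v0 = 0
    · left
      refine ⟨e, Finset.mem_insert_self _ _, ?_⟩
      have := hcr e v0 hpe hpv0
      rw [hf0, hfe] at this
      simp only [mul_zero, zero_mul, sub_zero, zero_smul] at this
      obtain ⟨c, hc⟩ := par_of_cr ve.ne_zero this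
      rw [hc, dt_smul] at hqv0
      refine (mul_eq_zero.1 hqv0).resolve_left ?_
      rintro rfl
      exact hv0.ne_zero (by rw [hc, zero_smul])
    · obtain ⟨v, hv, hqv⟩ : ∃ v ∈ S, dt (A.a q) v = 0 := by
        rcases lt_or_gt_of_ne hf0 with h | h
        · refine ⟨-v0, (memS _).2 ⟨?_, by simp [hpv0], by simpa using h⟩, by simp [hqv0]⟩
          refine ⟨by rw [norm_neg]; exact hv0.1, ?_⟩
          obtain ⟨-, i, j, hij, h1, h2⟩ := hv0
          exact ⟨i, j, hij, by simp [h1], by simp [h2]⟩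
        · exact ⟨v0, (memS _).2 ⟨hv0, hpv0, h⟩, hqv0⟩
      obtain ⟨i, hi, rfl⟩ := V3' v hv
      by_cases hg : VG A (V i)
      · right
        refine ⟨V i, ((memS _).1 hv).2.1, hqv, hg.1.deg, _, ?_, hK i hi hg⟩
        refine Finset.mem_image_of_mem _ (Finset.mem_range.2 (Nat.lt_succ_of_le ?_))
        refine Finset.card_le_card_of_injOn V ?_ ?_
        · intro j hj
          simp only [Finset.coe_filter, Finset.mem_range, Set.mem_ofPred_eq] at hj
          exact Vbl j (by omega) hj.2
        · intro j hj j' hj' h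
          simp only [Finset.coe_filter, Finset.mem_range, Set.mem_ofPred_eq] at hj hj'
          rcases lt_trichotomy j j' with h' | h' | h'
          · have := V2 j j' h' (by omega)
            rw [h] at this; exact absurd this (lt_irrefl _)
          · exact h'
          · have := V2 j' j h' (by omega)
            rw [h] at this; exact absurd this (lt_irrefl _)
      · left
        exact ⟨V i, Finset.mem_insert_of_mem (Vbl i hi hg), hqv⟩

end OL


namespace OL

open MvPolynomial

/-- the projective line with a given normal vector -/
def PL (b : V3) : Set RP2 := {x | dt b x.rep = 0}

lemma mem_PL {b : V3} {x : RP2} : x ∈ PL b ↔ dt b x.rep = 0 := Iff.rfl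

/-- dot product with a fixed vector -/
def dtL (b : V3) : V3 →ₗ[ℝ] ℝ where
  toFun := dt b
  map_add' := dt_add b
  map_smul' := fun c x => by simp

lemma rep_ne (x : RP2) : x.rep ≠ 0 := x.rep_nonzero

lemma cr_rep {x y : RP2} (h : x ≠ y) : cr x.rep y.rep ≠ 0 := by
  intro h0
  obtain ⟨c, hc⟩ := par_of_cr (rep_ne x) h0
  apply h
  rw [← x.mk_rep, ← y.mk_rep, eq_comm, Projectivization.mk_eq_mk_iff']
  exact ⟨c, hc.symm⟩

lemma sub_le_iff (x : RP2) (W : Submodule ℝ V3) : x.submodule ≤ W ↔ x.rep ∈ W := by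
  rw [Projectivization.submodule_eq, Submodule.span_singleton_le_iff_mem]

lemma isProjLine_PL {b : V3} (hb : b ≠ 0) : IsProjLine (PL b) := by
  refine ⟨LinearMap.ker (dtL b), ?_, ?_⟩
  · have h1 := LinearMap.finrank_range_add_finrank_ker (dtL b)
    have h2 : LinearMap.range (dtL b) = ⊤ := by
      rw [LinearMap.range_eq_top]
      apply LinearMap.surjective
      intro h
      have : dtL b b = 0 := by rw [h]; rfl
      exact (dt_self_pos hb).ne' this
    rw [h2, finrank_top] at h1
    have h3 : Module.finrank ℝ V3 = 3 := by simp
    rw [Module.finrank_self, h3] at h1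
    exact Nat.add_left_cancel (n := 1) (k := 2) h1
  · ext x
    rw [Set.mem_ofPred_eq, sub_le_iff]
    rfl

lemma exists_PL {L : Set RP2} (h : IsProjLine L) : ∃ b : V3, b ≠ 0 ∧ L = PL b := by
  obtain ⟨W, hW, rfl⟩ := h
  obtain ⟨f, hf⟩ : ∃ u v : V3, cr u v ≠ 0 ∧ W = Submodule.span ℝ {u, v} := by
    have e := Module.finBasisOfFinrankEq ℝ W hW
    refine ⟨e 0, e 1, ?_, ?_⟩
    · intro h0
      have h00 : (e 0 : V3) ≠ 0 := by
        intro h; exact e.ne_zero 0 (Subtype.ext h)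
      obtain ⟨c, hc⟩ := par_of_cr h00 h0
      have := e.linearIndependent
      rw [linearIndependent_fin2] at this
      by_cases hc0 : c = 0
      · rw [hc0, zero_smul] at hc
        exact e.ne_zero 1 (Subtype.ext hc)
      · apply this.2 c⁻¹
        apply Subtype.ext
        simp [hc, smul_smul, inv_mul_cancel₀ hc0]
    · have h1 := e.span_eq
      have h2 := congrArg (Submodule.map W.subtype) h1
      rw [Submodule.map_span, Submodule.map_top, Submodule.range_subtype] at h2
      refine h2.symm.trans ?_
      congr 1
      ext x
      simp only [Set.mem_image, Set.mem_range, Set.mem_insert_iff, Set.mem_singleton_iff]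
      constructor
      · rintro ⟨y, ⟨i, rfl⟩, rfl⟩
        fin_cases i <;> simp
      · rintro (rfl | rfl)
        · exact ⟨_, ⟨0, rfl⟩, rfl⟩
        · exact ⟨_, ⟨1, rfl⟩, rfl⟩
  obtain ⟨v, h, rfl⟩ := hf
  refine ⟨cr f v, h, ?_⟩
  ext x
  rw [Set.mem_ofPred_eq, sub_le_iff, mem_PL, Submodule.mem_span_pair]
  constructor
  · rintro ⟨a, b, e⟩
    rw [← e]
    simp [dt_cr_left, dt_cr_right]
  · intro h1
    obtain ⟨a, b, e⟩ := coplanar_decomp h h1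
    exact ⟨a, b, e.symm⟩

/-- two vectors perpendicular to two points of a line are parallel -/
lemma PL_par {b c : V3} (hb : b ≠ 0) {x y : RP2} (hxy : x ≠ y)
    (h1 : dt b x.rep = 0) (h2 : dt b y.rep = 0) (h3 : dt c x.rep = 0) (h4 : dt c y.rep = 0) :
    ∃ t : ℝ, c = t • b := by
  obtain ⟨s, hs⟩ := perp_par (cr_rep hxy) h1 h2
  obtain ⟨t, ht⟩ := perp_par (cr_rep hxy) h3 h4
  have hs0 : s ≠ 0 := by rintro rfl; simp at hs; exact hb hs
  exact ⟨t / s, by rw [ht, hs, smul_smul, div_mul_cancel₀ _ hs0]⟩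

lemma PL_eq {b c : V3} (hb : b ≠ 0) (hc : c ≠ 0) {x y : RP2} (hxy : x ≠ y)
    (h1 : dt b x.rep = 0) (h2 : dt b y.rep = 0) (h3 : dt c x.rep = 0) (h4 : dt c y.rep = 0) :
    PL b = PL c := by
  obtain ⟨t, rfl⟩ := PL_par hb hxy h1 h2 h3 h4
  have ht : t ≠ 0 := by rintro rfl; simp at hc
  ext z
  simp [mem_PL, ht]

lemma line_eq {L M : Set RP2} (hL : IsProjLine L) (hM : IsProjLine M) {x y : RP2} (hxy : x ≠ y)
    (h1 : x ∈ L) (h2 : y ∈ L) (h3 : x ∈ M) (h4 : y ∈ M) : L = M := by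
  obtain ⟨b, hb, rfl⟩ := exists_PL hL
  obtain ⟨c, hc, rfl⟩ := exists_PL hM
  exact PL_eq hb hc hxy h1 h2 h3 h4

lemma ord_finite {P : Set RP2} (hP : P.Finite) :
    {L : Set RP2 | IsProjLine L ∧ (P ∩ L).ncard = 2}.Finite := by
  apply Set.Finite.of_finite_image (f := fun L => P ∩ L)
  · apply hP.finite_subsets.subset
    rintro _ ⟨L, -, rfl⟩
    exact Set.inter_subset_left
  · rintro L ⟨hL, h2⟩ M ⟨hM, -⟩ h
    simp only at h
    obtain ⟨x, y, hxy, e⟩ := Set.ncard_eq_two.1 h2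
    have hx : x ∈ P ∩ L := by rw [e]; simp
    have hy : y ∈ P ∩ L := by rw [e]; simp
    have hx' := hx; have hy' := hy
    rw [h] at hx' hy'
    exact line_eq hL hM hxy hx.2 hy.2 hx'.2 hy'.2

noncomputable def dualArr (P : Finset RP2) (hP : ¬ ∃ L, IsProjLine L ∧ (P : Set RP2) ⊆ L) :
    Arr {x // x ∈ P} where
  a := fun x => x.1.rep
  ne := fun x y h => cr_rep (fun e => h (Subtype.ext e))
  span := fun b hb => by
    by_contra h0
    exact hP ⟨PL b, isProjLine_PL h0, fun x hx => by
      rw [mem_PL, dt_comm]; exact hb ⟨x, hx⟩⟩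

lemma lines_card {P : Finset RP2} (hP : ¬ ∃ L, IsProjLine L ∧ (P : Set RP2) ⊆ L) [DecidableEq RP2]
    (v : V3) : (lines (dualArr P hP) v).card = ((P : Set RP2) ∩ PL v).ncard := by
  rw [← Finset.card_map (Function.Embedding.subtype _), ← Set.ncard_coe_finset]
  congr 1
  ext x
  simp only [Finset.coe_map, Set.mem_image, Finset.mem_coe, mem_lines, Set.mem_inter_iff, mem_PL]
  constructor
  · rintro ⟨y, hy, rfl⟩
    exact ⟨y.2, by rw [dt_comm]; exact hy⟩
  · rintro ⟨hx, h⟩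
    exact ⟨⟨x, hx⟩, by rw [dt_comm] at h; exact h, rfl⟩

open Classical in
lemma N2_le {P : Finset RP2} (hP : ¬ ∃ L, IsProjLine L ∧ (P : Set RP2) ⊆ L) :
    N2 (dualArr P hP) ≤ 2 * numOrdinaryLines (P : Set RP2) := by
  have hf := ord_finite P.finite_toSet
  unfold N2 numOrdinaryLines
  rw [Set.ncard_eq_toFinset_card _ hf]
  apply Finset.card_le_mul_card_image_of_maps_to (f := PL)
  · intro v hv
    simp only [Finset.mem_filter, mem_VS] at hv
    rw [Set.Finite.mem_toFinset]
    exact ⟨isProjLine_PL hv.1.ne_zero, by rw [← lines_card hP]; exact hv.2⟩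
  · intro L hL
    by_cases hne : ∃ w ∈ (VS (dualArr P hP)).filter (fun v => (lines (dualArr P hP) v).card = 2),
      PL w = L
    · obtain ⟨w, hw, rfl⟩ := hne
      simp only [Finset.mem_filter, mem_VS] at hw
      refine le_trans (Finset.card_le_card (t := {w, -w}) ?_) Finset.card_le_two
      intro v hv
      simp only [Finset.mem_filter, mem_VS] at hv
      obtain ⟨⟨hv, -⟩, e⟩ := hv
      obtain ⟨hwn, i, j, hij, h1, h2⟩ := hw.1
      have h1' : dt w i.1.rep = 0 := by rw [dt_comm]; exact h1
      have h2' : dt w j.1.rep = 0 := by rw [dt_comm]; exact h2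
      have h3 : i.1 ∈ PL v := by rw [e]; exact h1'
      have h4 : j.1 ∈ PL v := by rw [e]; exact h2'
      obtain ⟨t, ht⟩ := PL_par hw.1.ne_zero (fun e => hij (Subtype.ext e)) h1' h2' h3 h4
      have : ‖v‖ = |t| * ‖w‖ := by rw [ht, norm_smul, Real.norm_eq_abs]
      rw [hv.1, hwn, mul_one] at this
      rcases abs_choice t with h | h
      · rw [h] at this
        simp [ht, ← this]
      · rw [h] at this
        have : t = -1 := by linarith
        simp [ht, this]
    · push Not at hne
      rw [Finset.filter_false_of_mem hne]
      simp

open Classical in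
/-- The local structure at every point. -/
theorem propB {P : Finset RP2} (hP : ¬ ∃ L, IsProjLine L ∧ (P : Set RP2) ⊆ L) (hn : 7 ≤ P.card) :
    ∃ (β : RP2 → ℕ) (B : RP2 → Finset V3) (Fs : RP2 → Finset MP),
      ∑ p ∈ P, β p ≤ 1204 * numOrdinaryLines (P : Set RP2) + P.card ∧
      ∀ p ∈ P, (B p).card ≤ β p ∧ (Fs p).card ≤ β p ∧
        (∀ F ∈ Fs p, F ≠ 0 ∧ F.IsHomogeneous 3) ∧
        (∀ b ∈ B p, b ≠ 0 ∧ dt b p.rep = 0) ∧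
        ∀ q ∈ P, q ≠ p → (∃ b ∈ B p, dt b q.rep = 0) ∨
          (∃ r ∈ P, r ≠ p ∧ r ≠ q ∧ ∃ b : V3, b ≠ 0 ∧
            (∀ x ∈ P, dt b x.rep = 0 ↔ x = p ∨ x = q ∨ x = r) ∧
            ∃ F ∈ Fs p, eval p.rep F = 0 ∧ eval q.rep F = 0 ∧ eval r.rep F = 0) := by
  have hn' : 7 ≤ Fintype.card {x // x ∈ P} := by rw [Fintype.card_coe]; exact hn
  choose B0 F0 h using fun p => propA (A := dualArr P hP) hn' p
  refine ⟨fun p => if hp : p ∈ P then (bl (dualArr P hP) ⟨p, hp⟩).card + 1 else 0,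
    fun p => if hp : p ∈ P then B0 ⟨p, hp⟩ else ∅,
    fun p => if hp : p ∈ P then F0 ⟨p, hp⟩ else ∅, ?_, ?_⟩
  · rw [← Finset.sum_attach]
    have : ∀ x ∈ P.attach, (if hp : x.1 ∈ P then (bl (dualArr P hP) ⟨x.1, hp⟩).card + 1 else 0)
        = (bl (dualArr P hP) x).card + 1 := by
      intro x _
      rw [dif_pos x.2]
    rw [Finset.sum_congr rfl this, Finset.sum_add_distrib, Finset.sum_const, Finset.card_attach]
    have h2 : ∃ i j : {x // x ∈ P}, i ≠ j := by
      have : 1 < Fintype.card {x // x ∈ P} := by omega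
      exact Fintype.one_lt_card_iff.1 this
    have h3 := sum_bl (A := dualArr P hP) h2
    have h4 := N2_le hP
    rw [Finset.univ_eq_attach] at h3
    simp only [smul_eq_mul, mul_one]
    omega
  · intro p hp
    simp only [dif_pos hp]
    obtain ⟨h1, h2, h3, h4, h5⟩ := h ⟨p, hp⟩
    refine ⟨h1, h2, h3, fun b hb => ⟨(h4 b hb).1, by rw [dt_comm]; exact (h4 b hb).2⟩, ?_⟩
    intro q hq hqp
    rcases h5 ⟨q, hq⟩ (fun e => hqp (congrArg Subtype.val e)) with ⟨b, hb, h6⟩ | ⟨v, hv1, hv2, hv3, F, hF, hK⟩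
    · exact Or.inl ⟨b, hb, by rw [dt_comm]; exact h6⟩
    · right
      have hpm : (⟨p, hp⟩ : {x // x ∈ P}) ∈ lines (dualArr P hP) v := mem_lines.2 hv1
      have hqm : (⟨q, hq⟩ : {x // x ∈ P}) ∈ lines (dualArr P hP) v := mem_lines.2 hv2
      have hpq : (⟨p, hp⟩ : {x // x ∈ P}) ≠ ⟨q, hq⟩ := fun e => hqp (congrArg Subtype.val e).symm
      have hc2 : (((lines (dualArr P hP) v).erase ⟨p, hp⟩).erase ⟨q, hq⟩).card = 1 := by
        rw [Finset.card_erase_of_mem (Finset.mem_erase.2 ⟨hpq.symm, hqm⟩),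
          Finset.card_erase_of_mem hpm, hv3]
      obtain ⟨r, hr⟩ := Finset.card_eq_one.1 hc2
      have key : ∀ x, x ∈ lines (dualArr P hP) v ↔ x = ⟨p, hp⟩ ∨ x = ⟨q, hq⟩ ∨ x = r := by
        intro x
        have : x ∈ ((lines (dualArr P hP) v).erase ⟨p, hp⟩).erase ⟨q, hq⟩ ↔ x = r := by
          rw [hr]; simp
        rw [Finset.mem_erase, Finset.mem_erase] at this
        constructor
        · intro hx
          by_cases e1 : x = ⟨p, hp⟩
          · exact Or.inl e1
          by_cases e2 : x = ⟨q, hq⟩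
          · exact Or.inr (Or.inl e2)
          exact Or.inr (Or.inr (this.1 ⟨e2, e1, hx⟩))
        · rintro (rfl | rfl | e)
          · exact hpm
          · exact hqm
          · exact (this.2 e).2.2
      have hrm : r ∈ ((lines (dualArr P hP) v).erase ⟨p, hp⟩).erase ⟨q, hq⟩ := by rw [hr]; simp
      rw [Finset.mem_erase, Finset.mem_erase] at hrm
      have e1 : eval p.rep F = 0 := hK ⟨p, hp⟩ hv1
      have e2 : eval q.rep F = 0 := hK ⟨q, hq⟩ hv2
      have e3 : eval r.1.rep F = 0 := hK r (mem_lines.1 hrm.2.2)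
      refine ⟨r.1, r.2, fun e => hrm.2.1 (Subtype.ext e), fun e => hrm.1 (Subtype.ext e), v, ?_, ?_,
        F, hF, e1, e2, e3⟩
      · rintro rfl
        have hall : (lines (dualArr P hP) 0) = Finset.univ := by
          ext x; simp [mem_lines]
        rw [hall, Finset.card_univ] at hv3
        omega
      · intro x hx
        have := key ⟨x, hx⟩
        rw [mem_lines, dt_comm] at this
        simp only [Subtype.ext_iff] at this
        exact this

end OL


namespace OL

open MvPolynomial

/-- the local structure of `P` at `p` -/
def LocAt (P : Finset RP2) (p : RP2) (β : ℕ) (B : Finset V3) (Fs : Finset MP) : Prop :=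
  B.card ≤ β ∧ Fs.card ≤ β ∧
    (∀ F ∈ Fs, F ≠ 0 ∧ F.IsHomogeneous 3) ∧
    (∀ b ∈ B, b ≠ 0 ∧ dt b p.rep = 0) ∧
    ∀ q ∈ P, q ≠ p → (∃ b ∈ B, dt b q.rep = 0) ∨
      (∃ r ∈ P, r ≠ p ∧ r ≠ q ∧ ∃ b : V3, b ≠ 0 ∧
        (∀ x ∈ P, dt b x.rep = 0 ↔ x = p ∨ x = q ∨ x = r) ∧
        ∃ F ∈ Fs, eval p.rep F = 0 ∧ eval q.rep F = 0 ∧ eval r.rep F = 0)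

lemma bez {F G : MP} {d e : ℕ} (hirr : Irreducible F) (hF : F.IsHomogeneous d)
    (hG : G.IsHomogeneous e) (hnd : ¬ F ∣ G) (s : Finset RP2)
    (hFx : ∀ x ∈ s, eval x.rep F = 0) (hGx : ∀ x ∈ s, eval x.rep G = 0) : s.card ≤ d * e :=
  bezout_fin hirr hF hG hnd s (fun x => x.rep) (fun x _ => rep_ne x)
    (fun _ _ _ _ h => cr_rep h) hFx hGx

open Classical in
lemma cubic_count {P : Finset RP2} {q : RP2} {β : ℕ} {B : Finset V3} {Fs : Finset MP}
    (h : LocAt P q β B Fs) {F : MP} (hirr : Irreducible F) (hF : F.IsHomogeneous 3)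
    (hq : eval q.rep F ≠ 0) : (P.filter (fun x => eval x.rep F = 0)).card ≤ 12 * β := by
  obtain ⟨hB, hFs, h3, h4, h5⟩ := h
  set P' := P.filter (fun x => eval x.rep F = 0) with hP'
  have hsub : P' ⊆ (B.biUnion fun b => P'.filter fun x => dt b x.rep = 0) ∪
      (Fs.filter fun G => eval q.rep G = 0).biUnion fun G => P'.filter fun x => eval x.rep G = 0 := by
    intro x hx
    have hx' := Finset.mem_filter.1 hx
    have hxq : x ≠ q := by rintro rfl; exact hq hx'.2
    rw [Finset.mem_union]
    rcases h5 x hx'.1 hxq with ⟨b, hb, hbx⟩ | ⟨r, -, -, -, b, -, -, G, hG, g1, g2, -⟩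
    · left
      exact Finset.mem_biUnion.2 ⟨b, hb, Finset.mem_filter.2 ⟨hx, hbx⟩⟩
    · right
      exact Finset.mem_biUnion.2 ⟨G, Finset.mem_filter.2 ⟨hG, g1⟩, Finset.mem_filter.2 ⟨hx, g2⟩⟩
  have c1 : (B.biUnion fun b => P'.filter fun x => dt b x.rep = 0).card ≤ B.card * 3 := by
    apply Finset.card_biUnion_le_card_mul
    intro b hb
    have := bez hirr hF (lin_hom b) (not_dvd_of_deg hF (lin_hom b) (lin_ne (h4 b hb).1) (by norm_num))
      (P'.filter fun x => dt b x.rep = 0)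
      (fun x hx => (Finset.mem_filter.1 (Finset.mem_filter.1 hx).1).2)
      (fun x hx => by rw [eval_lin]; exact (Finset.mem_filter.1 hx).2)
    simpa using this
  have c2 : ((Fs.filter fun G => eval q.rep G = 0).biUnion
      fun G => P'.filter fun x => eval x.rep G = 0).card
      ≤ (Fs.filter fun G => eval q.rep G = 0).card * 9 := by
    apply Finset.card_biUnion_le_card_mul
    intro G hG
    obtain ⟨hG, hGq⟩ := Finset.mem_filter.1 hG
    obtain ⟨hG0, hGh⟩ := h3 G hG
    have := bez hirr hF hGh ?_ (P'.filter fun x => eval x.rep G = 0)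
      (fun x hx => (Finset.mem_filter.1 (Finset.mem_filter.1 hx).1).2)
      (fun x hx => (Finset.mem_filter.1 hx).2)
    · simpa using this
    · intro hd
      obtain ⟨D, hD, rfl⟩ := hquot (k := 0) hF hGh hd
      have hD' := totalDegree_eq_zero_iff_eq_C.1 (hD.totalDegree (right_ne_zero_of_mul hG0))
      rw [map_mul, mul_eq_zero] at hGq
      rcases hGq with h | h
      · exact hq h
      · rw [hD', eval_C] at h
        rw [h, C_0] at hD'
        exact hG0 (by rw [hD', mul_zero])
  have c3 : (Fs.filter fun G => eval q.rep G = 0).card ≤ Fs.card := Finset.card_filter_le _ _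
  have := (Finset.card_le_card hsub).trans (Finset.card_union_le _ _)
  omega

open Classical in
theorem case_cubic {P : Finset RP2} {β : RP2 → ℕ} {B : RP2 → Finset V3} {Fs : RP2 → Finset MP}
    (h : ∀ p ∈ P, LocAt P p (β p) (B p) (Fs p)) {C : ℝ} (hC : 0 < C)
    (hS : ((∑ p ∈ P, β p : ℕ) : ℝ) ≤ C * P.card) {F : MP} (hirr : Irreducible F)
    (hF : F.IsHomogeneous 3)
    (hT : 24 * C ≤ (P.filter (fun x => eval x.rep F = 0)).card) :
    ((P.filter (fun x => ¬ eval x.rep F = 0)).card : ℝ) ≤ 24 * C := by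
  have hn := Finset.card_filter_add_card_filter_not (s := P) (fun x => eval x.rep F = 0)
  set a := (P.filter (fun x => eval x.rep F = 0)).card
  set b := (P.filter (fun x => ¬ eval x.rep F = 0)).card with hb
  have h1 : b * a ≤ 12 * ∑ p ∈ P, β p := by
    calc b * a = ∑ q ∈ P.filter (fun x => ¬ eval x.rep F = 0), a := by
          rw [Finset.sum_const, smul_eq_mul]
      _ ≤ ∑ q ∈ P.filter (fun x => ¬ eval x.rep F = 0), 12 * β q := by
          apply Finset.sum_le_sum
          intro q hq
          obtain ⟨hq, hq2⟩ := Finset.mem_filter.1 hq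
          exact cubic_count (h q hq) hirr hF hq2
      _ ≤ ∑ q ∈ P, 12 * β q :=
          Finset.sum_le_sum_of_subset (Finset.filter_subset _ _)
      _ = _ := by rw [Finset.mul_sum]
  have h1' : (b : ℝ) * a ≤ 12 * (C * P.card) := by
    have : (b : ℝ) * a ≤ 12 * ((∑ p ∈ P, β p : ℕ) : ℝ) := by exact_mod_cast h1
    linarith
  have hn' : (P.card : ℝ) = a + b := by exact_mod_cast hn.symm
  rw [hn'] at h1'
  by_contra hc
  push Not at hc
  have ha0 : (0 : ℝ) ≤ a := Nat.cast_nonneg _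
  have hb0 : (0 : ℝ) ≤ b := Nat.cast_nonneg _
  have hap : (0 : ℝ) < a := by linarith
  nlinarith [mul_pos (sub_pos.2 hc) hap, mul_nonneg (sub_nonneg.2 hT) hb0]

end OL


namespace OL

open MvPolynomial

/-- `p` on the conic, `q` off it, and the line through them meets `P` in exactly one more point,
again on the conic -/
def Nice (P : Finset RP2) (Q : MP) (q p : RP2) : Prop :=
  ∃ r ∈ P, eval r.rep Q = 0 ∧ r ≠ p ∧ ∃ b : V3, b ≠ 0 ∧
    ∀ x ∈ P, dt b x.rep = 0 ↔ x = q ∨ x = p ∨ x = r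

open Classical in
lemma conic_line {Q : MP} (hirr : Irreducible Q) (hQ : Q.IsHomogeneous 2) {b : V3} (hb : b ≠ 0)
    (s : Finset RP2) (h1 : ∀ x ∈ s, eval x.rep Q = 0) (h2 : ∀ x ∈ s, dt b x.rep = 0) :
    s.card ≤ 2 := by
  have := bez hirr hQ (lin_hom b) (not_dvd_of_deg hQ (lin_hom b) (lin_ne hb) (by norm_num)) s h1
    (fun x hx => by rw [eval_lin]; exact h2 x hx)
  simpa using this

lemma conic_dvd {Q F : MP} (hQ : Q.IsHomogeneous 2) (hF : F.IsHomogeneous 3) (hF0 : F ≠ 0)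
    (h : Q ∣ F) : ∃ a : V3, a ≠ 0 ∧ F = Q * lin a := by
  obtain ⟨D, hD, rfl⟩ := hquot (k := 1) hQ hF h
  obtain ⟨a, rfl⟩ := eq_lin hD
  refine ⟨a, ?_, rfl⟩
  rintro rfl
  apply hF0
  have : lin (0 : V3) = 0 := by simp [lin]
  rw [this, mul_zero]

section
variable {P : Finset RP2} {Q : MP} (hirr : Irreducible Q) (hQ : Q.IsHomogeneous 2)

open Classical in
/-- few bad pairs at a point off the conic -/
lemma conic_count (hirr : Irreducible Q) (hQ : Q.IsHomogeneous 2)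
    {q : RP2} {β : ℕ} {B : Finset V3} {Fs : Finset MP}
    (h : LocAt P q β B Fs) (hqP : q ∈ P) (hq : eval q.rep Q ≠ 0) :
    (P.filter (fun p => eval p.rep Q = 0 ∧ ¬ Nice P Q q p)).card ≤ 8 * β := by
  obtain ⟨hB, hFs, h3, h4, h5⟩ := h
  set R := P.filter (fun p => eval p.rep Q = 0 ∧ ¬ Nice P Q q p) with hR
  let cond : MP → RP2 → Prop := fun G p => eval p.rep G = 0 ∧
    (∀ a : V3, a ≠ 0 → G = Q * lin a → dt a p.rep = 0)
  have hsub : R ⊆ (B.biUnion fun b => R.filter fun x => dt b x.rep = 0) ∪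
      Fs.biUnion fun G => R.filter fun x => cond G x := by
    intro x hx
    obtain ⟨hxP, hxQ, hxn⟩ := Finset.mem_filter.1 hx
    have hxq : x ≠ q := by rintro rfl; exact hq hxQ
    rw [Finset.mem_union]
    rcases h5 x hxP hxq with ⟨b, hb, hbx⟩ | ⟨r, hr, hrq, hrx, b, hb, hbl, G, hG, g1, g2, g3⟩
    · left
      exact Finset.mem_biUnion.2 ⟨b, hb, Finset.mem_filter.2 ⟨hx, hbx⟩⟩
    · right
      refine Finset.mem_biUnion.2 ⟨G, hG, Finset.mem_filter.2 ⟨hx, g2, ?_⟩⟩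
      intro a ha hGa
      have hrQ : eval r.rep Q ≠ 0 := fun hrQ => hxn ⟨r, hr, hrQ, hrx, b, hb, hbl⟩
      rw [hGa, map_mul, eval_lin] at g1 g3
      have g1' := (mul_eq_zero.1 g1).resolve_left hq
      have g3' := (mul_eq_zero.1 g3).resolve_left hrQ
      have e := PL_eq hb ha hrq ((hbl r hr).2 (by simp)) ((hbl q hqP).2 (by simp)) g3' g1'
      have : x ∈ PL b := (hbl x hxP).2 (by simp)
      rw [e] at this
      exact this
  have c1 : (B.biUnion fun b => R.filter fun x => dt b x.rep = 0).card ≤ B.card * 2 := by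
    apply Finset.card_biUnion_le_card_mul
    intro b hb
    exact conic_line hirr hQ (h4 b hb).1 _
      (fun x hx => (Finset.mem_filter.1 (Finset.mem_filter.1 hx).1).2.1)
      (fun x hx => (Finset.mem_filter.1 hx).2)
  have c2 : (Fs.biUnion fun G => R.filter fun x => cond G x).card ≤ Fs.card * 6 := by
    apply Finset.card_biUnion_le_card_mul
    intro G hG
    obtain ⟨hG0, hGh⟩ := h3 G hG
    by_cases hd : Q ∣ G
    · obtain ⟨a, ha, hGa⟩ := conic_dvd hQ hGh hG0 hd
      refine (conic_line hirr hQ ha _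
        (fun x hx => (Finset.mem_filter.1 (Finset.mem_filter.1 hx).1).2.1)
        (fun x hx => (Finset.mem_filter.1 hx).2.2 a ha hGa)).trans (by norm_num)
    · have := bez hirr hQ hGh hd (R.filter fun x => cond G x)
        (fun x hx => (Finset.mem_filter.1 (Finset.mem_filter.1 hx).1).2.1)
        (fun x hx => (Finset.mem_filter.1 hx).2.1)
      simpa using this
  have := (Finset.card_le_card hsub).trans (Finset.card_union_le _ _)
  omega

open Classical in
/-- (1) -/
lemma conic_upper {p : RP2} (hp : p ∈ P) (hpQ : eval p.rep Q = 0) :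
    (P.filter (fun q => ¬ eval q.rep Q = 0)).card ≤ (P.filter (fun q => eval q.rep Q = 0)).card +
      (P.filter (fun q => ¬ eval q.rep Q = 0 ∧ ¬ Nice P Q q p)).card := by
  have h1 : (P.filter (fun q => ¬ eval q.rep Q = 0 ∧ Nice P Q q p)).card
      ≤ (P.filter (fun q => eval q.rep Q = 0)).card := by
    have hex : ∀ q ∈ P.filter (fun q => ¬ eval q.rep Q = 0 ∧ Nice P Q q p), Nice P Q q p :=
      fun q hq => (Finset.mem_filter.1 hq).2.2
    choose! r hr1 hr2 hr3 b hb hbl using hex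
    refine Finset.card_le_card_of_injOn r (fun q hq => Finset.mem_filter.2 ⟨hr1 q hq, hr2 q hq⟩) ?_
    intro q hq q' hq' e
    have hqm := Finset.mem_filter.1 hq
    have hqm' := Finset.mem_filter.1 hq'
    have e1 := PL_eq (hb q hq) (hb q' hq') (hr3 q hq)
      ((hbl q hq _ (hr1 q hq)).2 (by simp)) ((hbl q hq p hp).2 (by simp))
      ((hbl q' hq' _ (hr1 q hq)).2 (by simp [e])) ((hbl q' hq' p hp).2 (by simp))
    have : q ∈ PL (b q) := (hbl q hq q hqm.1).2 (by simp)
    rw [e1] at this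
    rcases (hbl q' hq' q hqm.1).1 this with h | h | h
    · exact h
    · exact absurd (by rw [h]; exact hpQ) hqm.2.1
    · exact absurd (by rw [h]; exact hr2 q' hq') hqm.2.1
  have h2 := Finset.card_filter_add_card_filter_not
    (s := P.filter (fun q => ¬ eval q.rep Q = 0)) (fun q => Nice P Q q p)
  rw [Finset.filter_filter, Finset.filter_filter] at h2
  omega

open Classical in
/-- (2) -/
lemma conic_lower (hirr : Irreducible Q) (hQ : Q.IsHomogeneous 2)
    {p : RP2} {β : ℕ} {B : Finset V3} {Fs : Finset MP}
    (h : LocAt P p β B Fs) (hp : p ∈ P) (hpQ : eval p.rep Q = 0) :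
    (P.filter (fun q => eval q.rep Q = 0)).card ≤
      (P.filter (fun q => ¬ eval q.rep Q = 0)).card + 2 * β + 1 := by
  obtain ⟨hB, hFs, h3, h4, h5⟩ := h
  set P' := P.filter (fun q => eval q.rep Q = 0) with hP'
  set P'' := P.filter (fun q => ¬ eval q.rep Q = 0) with hP''
  let good : RP2 → Prop := fun q => ∃ r ∈ P'', ∃ b : V3, b ≠ 0 ∧
        (∀ x ∈ P, dt b x.rep = 0 ↔ x = p ∨ x = q ∨ x = r)
  have hsub : P' ⊆ ({p} ∪ B.biUnion fun b => P'.filter fun x => dt b x.rep = 0) ∪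
      (P'.erase p).filter good := by
    intro x hx
    obtain ⟨hxP, hxQ⟩ := Finset.mem_filter.1 hx
    by_cases hxp : x = p
    · simp [hxp]
    rw [Finset.mem_union, Finset.mem_union]
    rcases h5 x hxP hxp with ⟨b, hb, hbx⟩ | ⟨r, hr, hrq, hrx, b, hb, hbl, G, hG, g1, g2, g3⟩
    · left; right
      exact Finset.mem_biUnion.2 ⟨b, hb, Finset.mem_filter.2 ⟨hx, hbx⟩⟩
    · right
      refine Finset.mem_filter.2 ⟨Finset.mem_erase.2 ⟨hxp, hx⟩, r, Finset.mem_filter.2 ⟨hr, ?_⟩, b, hb, hbl⟩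
      intro hrQ
      have := conic_line hirr hQ hb {p, x, r} ?_ ?_
      · rw [Finset.card_eq_three.2 ⟨p, x, r, Ne.symm hxp, hrq.symm, hrx.symm, rfl⟩] at this
        omega
      · intro y hy
        simp only [Finset.mem_insert, Finset.mem_singleton] at hy
        rcases hy with rfl | rfl | rfl <;> assumption
      · intro y hy
        simp only [Finset.mem_insert, Finset.mem_singleton] at hy
        rcases hy with rfl | rfl | rfl
        · exact (hbl _ hp).2 (by simp)
        · exact (hbl _ hxP).2 (by simp)
        · exact (hbl _ hr).2 (by simp)
  have c1 : (B.biUnion fun b => P'.filter fun x => dt b x.rep = 0).card ≤ B.card * 2 := by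
    apply Finset.card_biUnion_le_card_mul
    intro b hb
    exact conic_line hirr hQ (h4 b hb).1 _
      (fun x hx => (Finset.mem_filter.1 (Finset.mem_filter.1 hx).1).2)
      (fun x hx => (Finset.mem_filter.1 hx).2)
  have c2 : ((P'.erase p).filter good).card ≤ P''.card := by
    have hex : ∀ q ∈ (P'.erase p).filter good, good q :=
      fun q hq => (Finset.mem_filter.1 hq).2
    choose! r hr b hb hbl using hex
    refine Finset.card_le_card_of_injOn r (fun q hq => hr q hq) ?_
    intro q hq q' hq' e
    obtain ⟨hqp, hqP⟩ := Finset.mem_erase.1 (Finset.mem_filter.1 hq).1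
    obtain ⟨hqP, hqQ⟩ := Finset.mem_filter.1 hqP
    obtain ⟨hrP, hrQ⟩ := Finset.mem_filter.1 (hr q hq)
    have hrp : r q ≠ p := by intro h; rw [h] at hrQ; exact hrQ hpQ
    have e1 := PL_eq (hb q hq) (hb q' hq') hrp
      ((hbl q hq _ hrP).2 (by simp)) ((hbl q hq p hp).2 (by simp))
      ((hbl q' hq' _ hrP).2 (by simp [e])) ((hbl q' hq' p hp).2 (by simp))
    have : q ∈ PL (b q) := (hbl q hq q hqP).2 (by simp)
    rw [e1] at this
    rcases (hbl q' hq' q hqP).1 this with h | h | h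
    · exact absurd h hqp
    · exact h
    · rw [h, ← e] at hqQ; exact absurd hqQ hrQ
  have := (Finset.card_le_card hsub).trans (Finset.card_union_le _ _)
  have h6 := Finset.card_union_le {p} (B.biUnion fun b => P'.filter fun x => dt b x.rep = 0)
  rw [Finset.card_singleton] at h6
  omega

open Classical in
/-- lines covering the points off the conic -/
lemma conic_lines (hirr : Irreducible Q) (hQ : Q.IsHomogeneous 2)
    {p : RP2} {β : ℕ} {B : Finset V3} {Fs : Finset MP}
    (h : LocAt P p β B Fs) (hp : p ∈ P) (hpQ : eval p.rep Q = 0) :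
    ∃ Ls : Finset (Set RP2), (∀ L ∈ Ls, IsProjLine L) ∧
      Ls.card ≤ 8 * β + (P.filter (fun q => ¬ eval q.rep Q = 0 ∧ ¬ Nice P Q q p)).card ∧
      ∀ q ∈ P, eval q.rep Q ≠ 0 → ∃ L ∈ Ls, q ∈ L := by
  obtain ⟨hB, hFs, h3, h4, h5⟩ := h
  set X := P.filter (fun q => ¬ eval q.rep Q = 0 ∧ ¬ Nice P Q q p) with hX
  let J : RP2 → Set RP2 := fun q => PL (cr p.rep q.rep)
  have hlin : ∀ F, ∃ a : V3, a ≠ 0 ∧ (F ∈ Fs → Q ∣ F → F = Q * lin a) := by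
    intro F
    by_cases hF : F ∈ Fs ∧ Q ∣ F
    · obtain ⟨a, ha, e⟩ := conic_dvd hQ (h3 F hF.1).2 (h3 F hF.1).1 hF.2
      exact ⟨a, ha, fun _ _ => e⟩
    · exact ⟨p.rep, rep_ne p, fun h1 h2 => absurd ⟨h1, h2⟩ hF⟩
  choose la la0 hla using hlin
  let Z : MP → Finset RP2 := fun F => if Q ∣ F then ∅ else
    (P.erase p).filter fun r => eval r.rep Q = 0 ∧ eval r.rep F = 0
  refine ⟨((B.image PL ∪ Fs.image fun F => PL (la F)) ∪ Fs.biUnion fun F => (Z F).image J) ∪ X.image J,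
    ?_, ?_, ?_⟩
  · intro L hL
    simp only [Finset.mem_union, Finset.mem_image, Finset.mem_biUnion] at hL
    rcases hL with ((⟨b, hb, rfl⟩ | ⟨F, hF, rfl⟩) | ⟨F, hF, r, hr, rfl⟩) | ⟨q, hq, rfl⟩
    · exact isProjLine_PL (h4 b hb).1
    · exact isProjLine_PL (la0 F)
    · apply isProjLine_PL
      apply cr_rep
      simp only [Z] at hr
      split_ifs at hr with hd
      · simp at hr
      · exact (Finset.mem_erase.1 (Finset.mem_filter.1 hr).1).1.symm
    · apply isProjLine_PL
      apply cr_rep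
      rintro rfl
      exact (Finset.mem_filter.1 hq).2.1 hpQ
  · have c0 := Finset.card_union_le ((B.image PL ∪ Fs.image fun F => PL (la F)) ∪
      Fs.biUnion fun F => (Z F).image J) (X.image J)
    have c1 := Finset.card_union_le (B.image PL ∪ Fs.image fun F => PL (la F))
      (Fs.biUnion fun F => (Z F).image J)
    have c2 := Finset.card_union_le (B.image PL) (Fs.image fun F => PL (la F))
    have c3 : (B.image PL).card ≤ B.card := Finset.card_image_le
    have c4 : (Fs.image fun F => PL (la F)).card ≤ Fs.card := Finset.card_image_le
    have c5 : (X.image J).card ≤ X.card := Finset.card_image_le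
    have c6 : (Fs.biUnion fun F => (Z F).image J).card ≤ Fs.card * 6 := by
      apply Finset.card_biUnion_le_card_mul
      intro F hF
      refine Finset.card_image_le.trans ?_
      simp only [Z]
      split_ifs with hd
      · simp
      · exact bez hirr hQ (h3 F hF).2 hd _
          (fun x hx => (Finset.mem_filter.1 hx).2.1) (fun x hx => (Finset.mem_filter.1 hx).2.2)
    omega
  · intro q hq hqQ
    have hqp : q ≠ p := by rintro rfl; exact hqQ hpQ
    simp only [Finset.mem_union, Finset.mem_image, Finset.mem_biUnion]
    by_cases hn : Nice P Q q p
    · rcases h5 q hq hqp with ⟨b, hb, hbx⟩ | ⟨r, hr, hrp, hrq, b, hb, hbl, F, hF, g1, g2, g3⟩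
      · exact ⟨PL b, Or.inl (Or.inl (Or.inl ⟨b, hb, rfl⟩)), hbx⟩
      by_cases hd : Q ∣ F
      · refine ⟨PL (la F), Or.inl (Or.inl (Or.inr ⟨F, hF, rfl⟩)), ?_⟩
        rw [hla F hF hd, map_mul, eval_lin] at g2
        exact (mul_eq_zero.1 g2).resolve_left hqQ
      · obtain ⟨r', hr', hrQ', hrp', b', hb', hbl'⟩ := hn
        have e := PL_eq hb hb' hqp ((hbl q hq).2 (by simp)) ((hbl p hp).2 (by simp))
          ((hbl' q hq).2 (by simp)) ((hbl' p hp).2 (by simp))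
        have hrr : r ∈ PL b := (hbl r hr).2 (by simp)
        have hrr' := hrr
        rw [e] at hrr'
        have hrQ : eval r.rep Q = 0 := by
          rcases (hbl' r hr).1 hrr' with h | h | h
          · exact absurd h hrq
          · exact absurd h hrp
          · rw [h]; exact hrQ'
        refine ⟨J r, Or.inl (Or.inr ⟨F, hF, r, ?_, rfl⟩), ?_⟩
        · simp only [Z, if_neg hd]
          exact Finset.mem_filter.2 ⟨Finset.mem_erase.2 ⟨hrp, hr⟩, hrQ, g3⟩
        · have e2 := PL_eq hb (cr_rep hrp.symm) hrp.symm ((hbl p hp).2 (by simp)) hrr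
            (dt_cr_left _ _) (dt_cr_right _ _)
          simp only [J]
          rw [← e2]
          exact (hbl q hq).2 (by simp)
    · exact ⟨J q, Or.inr ⟨q, Finset.mem_filter.2 ⟨hq, hqQ, hn⟩, rfl⟩, dt_cr_right _ _⟩

open Classical in
/-- ordinary lines of the part off the conic -/
lemma conic_ord (σ : Set RP2) (hσ : ∀ x, x ∈ σ ↔ eval x.rep Q = 0) :
    numOrdinaryLines ((P : Set RP2) \ σ) ≤ numOrdinaryLines (P : Set RP2) +
      ((P ×ˢ P).filter fun z : RP2 × RP2 => ¬ eval z.1.rep Q = 0 ∧ eval z.2.rep Q = 0 ∧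
        ¬ Nice P Q z.1 z.2).card := by
  set X := (P ×ˢ P).filter fun z : RP2 × RP2 => ¬ eval z.1.rep Q = 0 ∧ eval z.2.rep Q = 0 ∧
        ¬ Nice P Q z.1 z.2 with hX
  have hsub : {L : Set RP2 | IsProjLine L ∧ (((P : Set RP2) \ σ) ∩ L).ncard = 2} ⊆
      {L : Set RP2 | IsProjLine L ∧ ((P : Set RP2) ∩ L).ncard = 2} ∪
      ((X.image fun z => PL (cr z.1.rep z.2.rep) : Finset (Set RP2)) : Set (Set RP2)) := by
    rintro L ⟨hL, h2⟩
    by_cases hex : ∃ p ∈ P, p ∈ L ∧ p ∈ σ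
    · right
      obtain ⟨p, hp, hpL, hpσ⟩ := hex
      have hpQ := (hσ p).1 hpσ
      obtain ⟨q, q', hqq, e⟩ := Set.ncard_eq_two.1 h2
      have hq : q ∈ ((P : Set RP2) \ σ) ∩ L := by rw [e]; simp
      have hq' : q' ∈ ((P : Set RP2) \ σ) ∩ L := by rw [e]; simp
      have hqQ : ¬ eval q.rep Q = 0 := fun h => hq.1.2 ((hσ q).2 h)
      have hqQ' : ¬ eval q'.rep Q = 0 := fun h => hq'.1.2 ((hσ q').2 h)
      have hqp : q ≠ p := by rintro rfl; exact hqQ hpQ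
      have eL : PL (cr q.rep p.rep) = L :=
        line_eq (isProjLine_PL (cr_rep hqp)) hL hqp (dt_cr_left _ _) (dt_cr_right _ _) hq.2 hpL
      rw [Finset.mem_coe, Finset.mem_image]
      refine ⟨(q, p), Finset.mem_filter.2 ⟨Finset.mk_mem_product hq.1.1 hp, hqQ, hpQ, ?_⟩, eL⟩
      rintro ⟨r, hr, hrQ, hrp, b, hb, hbl⟩
      have eL' : PL b = L := line_eq (isProjLine_PL hb) hL hqp ((hbl q hq.1.1).2 (by simp))
        ((hbl p hp).2 (by simp)) hq.2 hpL
      have : q' ∈ PL b := by rw [eL']; exact hq'.2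
      rcases (hbl q' hq'.1.1).1 this with h | h | h
      · exact hqq h.symm
      · rw [h] at hqQ'; exact hqQ' hpQ
      · rw [h] at hqQ'; exact hqQ' hrQ
    · left
      refine ⟨hL, ?_⟩
      rw [← h2]
      congr 1
      ext x
      simp only [Set.mem_inter_iff, Set.mem_sdiff, Finset.mem_coe]
      constructor
      · rintro ⟨h1, h2⟩
        exact ⟨⟨h1, fun h3 => hex ⟨x, h1, h2, h3⟩⟩, h2⟩
      · rintro ⟨⟨h1, -⟩, h2⟩
        exact ⟨h1, h2⟩
  have h1 := Set.ncard_le_ncard hsub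
    ((ord_finite P.finite_toSet).union (Finset.finite_toSet _))
  have h2 := Set.ncard_union_le {L : Set RP2 | IsProjLine L ∧ ((P : Set RP2) ∩ L).ncard = 2}
    ((X.image fun z => PL (cr z.1.rep z.2.rep) : Finset (Set RP2)) : Set (Set RP2))
  rw [Set.ncard_coe_finset] at h2
  have h3 : (X.image fun z => PL (cr z.1.rep z.2.rep)).card ≤ X.card := Finset.card_image_le
  unfold numOrdinaryLines
  omega

end

end OL


namespace OL

open MvPolynomial

open Classical in
lemma pair_count {α : Type} (P : Finset α) (R : α → α → Prop) :
    ((P ×ˢ P).filter fun z : α × α => R z.1 z.2).card = ∑ q ∈ P, (P.filter fun p => R q p).card ∧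
    ((P ×ˢ P).filter fun z : α × α => R z.1 z.2).card = ∑ p ∈ P, (P.filter fun q => R q p).card := by
  constructor
  · rw [Finset.card_filter, Finset.sum_product]
    simp only [Finset.card_filter]
  · rw [Finset.card_filter, Finset.sum_product_right]
    simp only [Finset.card_filter]

set_option maxHeartbeats 1000000 in
open Classical in
theorem case_conic {P : Finset RP2} {β : RP2 → ℕ} {B : RP2 → Finset V3} {Fs : RP2 → Finset MP}
    (h : ∀ p ∈ P, LocAt P p (β p) (B p) (Fs p)) {C : ℝ} (hC : 1 ≤ C)
    (hS : ((∑ p ∈ P, β p : ℕ) : ℝ) ≤ C * P.card) {Q : MP} (hirr : Irreducible Q)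
    (hQ : Q.IsHomogeneous 2) (σ : Set RP2) (hσ : ∀ x, x ∈ σ ↔ eval x.rep Q = 0)
    (hT : 18 * C ≤ (P.filter (fun x => eval x.rep Q = 0)).card) :
    (∃ Ls : Finset (Set RP2), (∀ L ∈ Ls, IsProjLine L) ∧ (Ls.card : ℝ) ≤ 288 * C ∧
      ∀ q ∈ P, eval q.rep Q ≠ 0 → ∃ L ∈ Ls, q ∈ L) ∧
    |((P.filter (fun x => eval x.rep Q = 0)).card : ℝ) - P.card / 2| ≤ 37 * C ∧
    (numOrdinaryLines ((P : Set RP2) \ σ) : ℝ) ≤ numOrdinaryLines (P : Set RP2) + 8 * C * P.card := by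
  set X := (P ×ˢ P).filter fun z : RP2 × RP2 => ¬ eval z.1.rep Q = 0 ∧ eval z.2.rep Q = 0 ∧
        ¬ Nice P Q z.1 z.2 with hX
  have hc1 : X.card = ∑ q ∈ P, (P.filter fun p => ¬ eval q.rep Q = 0 ∧ eval p.rep Q = 0 ∧
      ¬ Nice P Q q p).card := by
    rw [hX]
    convert (pair_count P (fun q p => ¬ eval q.rep Q = 0 ∧ eval p.rep Q = 0 ∧ ¬ Nice P Q q p)).1
  have hc2 : X.card = ∑ p ∈ P, (P.filter fun q => ¬ eval q.rep Q = 0 ∧ eval p.rep Q = 0 ∧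
      ¬ Nice P Q q p).card := by
    rw [hX]
    convert (pair_count P (fun q p => ¬ eval q.rep Q = 0 ∧ eval p.rep Q = 0 ∧ ¬ Nice P Q q p)).2
  have hX1 : X.card ≤ 8 * ∑ p ∈ P, β p := by
    rw [hc1, Finset.mul_sum]
    apply Finset.sum_le_sum
    intro q hq
    by_cases hqQ : eval q.rep Q = 0
    · rw [Finset.filter_false_of_mem (fun p _ h => h.1 hqQ)]
      simp
    · refine le_trans (Finset.card_le_card ?_) (conic_count hirr hQ (h q hq) hq hqQ)
      intro p hp
      obtain ⟨h1, h2, h3, h4⟩ := Finset.mem_filter.1 hp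
      exact Finset.mem_filter.2 ⟨h1, h3, h4⟩
  let x : RP2 → ℕ := fun p => (P.filter (fun q => ¬ eval q.rep Q = 0 ∧ ¬ Nice P Q q p)).card
  set P' := P.filter (fun x => eval x.rep Q = 0) with hP'
  have hPs : P' ⊆ P := Finset.filter_subset _ _
  have hX2 : ∑ p ∈ P', x p ≤ X.card := by
    rw [hc2]
    refine le_trans ?_ (Finset.sum_le_sum_of_subset hPs)
    apply Finset.sum_le_sum
    intro p hp
    obtain ⟨hp, hpQ⟩ := Finset.mem_filter.1 hp
    apply Finset.card_le_card
    intro q hq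
    obtain ⟨h1, h2, h3⟩ := Finset.mem_filter.1 hq
    exact Finset.mem_filter.2 ⟨h1, h2, hpQ, h3⟩
  have hX3 : ∑ p ∈ P', (x p + β p) ≤ 9 * ∑ p ∈ P, β p := by
    rw [Finset.sum_add_distrib]
    have : ∑ p ∈ P', β p ≤ ∑ p ∈ P, β p :=
      Finset.sum_le_sum_of_subset hPs
    omega
  have hne : P'.Nonempty := by
    rw [← Finset.card_pos]
    have : (0 : ℝ) < P'.card := by linarith
    exact_mod_cast this
  obtain ⟨p, hpm, hmin⟩ := Finset.exists_min_image P' (fun p => x p + β p) hne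
  obtain ⟨hp, hpQ⟩ := Finset.mem_filter.1 hpm
  have hmul : P'.card * (x p + β p) ≤ 9 * ∑ p ∈ P, β p := by
    refine le_trans ?_ hX3
    rw [← smul_eq_mul]
    exact Finset.card_nsmul_le_sum _ _ _ hmin
  have hup := conic_upper hp hpQ
  have hlo := conic_lower hirr hQ (h p hp) hp hpQ
  obtain ⟨Ls, hL1, hL2, hL3⟩ := conic_lines hirr hQ (h p hp) hp hpQ
  have hord := conic_ord (P := P) σ hσ
  have hn : P'.card + (P.filter (fun q => ¬ eval q.rep Q = 0)).card = P.card :=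
    Finset.card_filter_add_card_filter_not (s := P) (fun x => eval x.rep Q = 0)
  change _ ≤ P'.card + x p at hup
  change P'.card ≤ _ at hlo
  change _ ≤ 8 * β p + x p at hL2
  change _ ≤ _ + X.card at hord
  set a := P'.card
  set b := (P.filter (fun q => ¬ eval q.rep Q = 0)).card
  set y := x p + β p with hy
  have hup' : (b : ℝ) ≤ a + y := by exact_mod_cast (by omega : b ≤ a + y)
  have hlo' : (a : ℝ) ≤ b + 2 * y + 1 := by exact_mod_cast (by omega : a ≤ b + 2 * y + 1)
  have hLc : (Ls.card : ℝ) ≤ 8 * y := by exact_mod_cast (by omega : Ls.card ≤ 8 * y)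
  have hn' : (P.card : ℝ) = a + b := by exact_mod_cast hn.symm
  have hmul' : (a : ℝ) * y ≤ 9 * (C * P.card) := by
    have : (a : ℝ) * y ≤ 9 * ((∑ p ∈ P, β p : ℕ) : ℝ) := by exact_mod_cast hmul
    linarith
  clear hc1 hc2
  have hXr : (X.card : ℝ) ≤ 8 * (C * P.card) := by
    have : (X.card : ℝ) ≤ 8 * ((∑ p ∈ P, β p : ℕ) : ℝ) := by exact_mod_cast hX1
    linarith
  have hord' : (numOrdinaryLines ((P : Set RP2) \ σ) : ℝ)
      ≤ numOrdinaryLines (P : Set RP2) + X.card := by exact_mod_cast hord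
  have ha0 : (0 : ℝ) < a := by linarith
  have hb0 : (0 : ℝ) ≤ b := Nat.cast_nonneg _
  have hy0 : (0 : ℝ) ≤ y := Nat.cast_nonneg _
  have hy1 : (y : ℝ) ≤ (a + b) / 2 := by
    rw [hn'] at hmul'
    by_contra hc
    push Not at hc
    nlinarith [mul_lt_mul_of_pos_left hc ha0, mul_le_mul_of_nonneg_right hT (by linarith : (0:ℝ) ≤ a + b)]
  have hab : (a + b : ℝ) ≤ 4 * a := by linarith
  have hy2 : (y : ℝ) ≤ 36 * C := by
    rw [hn'] at hmul'
    have : (a : ℝ) * y ≤ a * (36 * C) := by nlinarith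
    exact le_of_mul_le_mul_left this ha0
  refine ⟨⟨Ls, hL1, by linarith, hL3⟩, ?_, by linarith⟩
  rw [hn', abs_le]
  constructor <;> linarith

open Classical in
/-- a cubic splits into few lines and few points -/
lemma cover_cubic {P : Finset RP2} {T : ℕ}
    (h3 : ∀ F : MP, Irreducible F → F.IsHomogeneous 3 → (P.filter (fun x => eval x.rep F = 0)).card ≤ T)
    (h2 : ∀ F : MP, Irreducible F → F.IsHomogeneous 2 → (P.filter (fun x => eval x.rep F = 0)).card ≤ T)
    {F : MP} (hF0 : F ≠ 0) (hF : F.IsHomogeneous 3) :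
    ∃ (Ls : Finset (Set RP2)) (S : Finset RP2), (∀ L ∈ Ls, IsProjLine L) ∧ Ls.card ≤ 3 ∧
      S.card ≤ T ∧ ∀ x ∈ P, eval x.rep F = 0 → (∃ L ∈ Ls, x ∈ L) ∨ x ∈ S := by
  rcases cubic_split hF0 hF with hi | ⟨a, Q, ha, hQ0, hQ, rfl⟩
  · exact ⟨∅, _, by simp, by simp, h3 F hi hF, fun x hx h => Or.inr (Finset.mem_filter.2 ⟨hx, h⟩)⟩
  rcases conic_split hQ0 hQ with hi | ⟨b, c, hb, hc, rfl⟩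
  · refine ⟨{PL a}, _, by simpa using isProjLine_PL ha, by simp, h2 Q hi hQ, fun x hx h => ?_⟩
    rw [map_mul, mul_eq_zero, eval_lin] at h
    rcases h with h | h
    · exact Or.inl ⟨PL a, by simp, h⟩
    · exact Or.inr (Finset.mem_filter.2 ⟨hx, h⟩)
  · refine ⟨{PL a, PL b, PL c}, ∅, ?_, Finset.card_le_three, by simp, fun x hx h => ?_⟩
    · intro L hL
      simp only [Finset.mem_insert, Finset.mem_singleton] at hL
      rcases hL with rfl | rfl | rfl <;> apply isProjLine_PL <;> assumption
    · rw [map_mul, map_mul, mul_eq_zero, mul_eq_zero, eval_lin, eval_lin, eval_lin] at h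
      left
      rcases h with h | h | h
      · exact ⟨PL a, by simp, h⟩
      · exact ⟨PL b, by simp, h⟩
      · exact ⟨PL c, by simp, h⟩

open Classical in
theorem case_lines {P : Finset RP2} {T : ℕ}
    (h3 : ∀ F : MP, Irreducible F → F.IsHomogeneous 3 → (P.filter (fun x => eval x.rep F = 0)).card ≤ T)
    (h2 : ∀ F : MP, Irreducible F → F.IsHomogeneous 2 → (P.filter (fun x => eval x.rep F = 0)).card ≤ T)
    {p : RP2} {β : ℕ} {B : Finset V3} {Fs : Finset MP} (h : LocAt P p β B Fs) :
    ∃ (Ls : Finset (Set RP2)) (S : Finset RP2), (∀ L ∈ Ls, IsProjLine L) ∧ Ls.card ≤ 4 * β ∧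
      S.card ≤ β * T + 1 ∧ ∀ x ∈ P, (∃ L ∈ Ls, x ∈ L) ∨ x ∈ S := by
  obtain ⟨hB, hFs, hF3, h4, h5⟩ := h
  have hcov : ∀ F ∈ Fs, ∃ (Ls : Finset (Set RP2)) (S : Finset RP2), (∀ L ∈ Ls, IsProjLine L) ∧
      Ls.card ≤ 3 ∧ S.card ≤ T ∧ ∀ x ∈ P, eval x.rep F = 0 → (∃ L ∈ Ls, x ∈ L) ∨ x ∈ S :=
    fun F hF => cover_cubic h3 h2 (hF3 F hF).1 (hF3 F hF).2
  choose! Lf Sf k1 k2 k3 k4 using hcov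
  refine ⟨B.image PL ∪ Fs.biUnion Lf, Fs.biUnion Sf ∪ {p}, ?_, ?_, ?_, ?_⟩
  · intro L hL
    simp only [Finset.mem_union, Finset.mem_image, Finset.mem_biUnion] at hL
    rcases hL with ⟨b, hb, rfl⟩ | ⟨F, hF, hL⟩
    · exact isProjLine_PL (h4 b hb).1
    · exact k1 F hF L hL
  · have c1 := Finset.card_union_le (B.image PL) (Fs.biUnion Lf)
    have c2 : (B.image PL).card ≤ B.card := Finset.card_image_le
    have c3 := Finset.card_biUnion_le_card_mul Fs Lf 3 k2
    omega
  · have c1 := Finset.card_union_le (Fs.biUnion Sf) {p}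
    have c3 := Finset.card_biUnion_le_card_mul Fs Sf T k3
    have c4 : Fs.card * T ≤ β * T := Nat.mul_le_mul_right _ hFs
    rw [Finset.card_singleton] at c1
    omega
  · intro x hx
    simp only [Finset.mem_union, Finset.mem_image, Finset.mem_biUnion, Finset.mem_singleton]
    by_cases hxp : x = p
    · exact Or.inr (Or.inr hxp)
    rcases h5 x hx hxp with ⟨b, hb, hbx⟩ | ⟨r, -, -, -, b, -, -, F, hF, -, g2, -⟩
    · exact Or.inl ⟨PL b, Or.inl ⟨b, hb, rfl⟩, hbx⟩
    · rcases k4 F hF x hx g2 with ⟨L, hL, hxL⟩ | h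
      · exact Or.inl ⟨L, Or.inr ⟨F, hF, hL⟩, hxL⟩
      · exact Or.inr (Or.inl ⟨F, hF, h⟩)

end OL


/-- The intermediate structure theorem for sets with few ordinary lines. -/
theorem intermediate_structure (K : ℝ) (hK : 1 ≤ K) (n : ℕ) (P : Set RP2)
    (hfin : P.Finite) (hcard : P.ncard = n)
    (hord : (numOrdinaryLines P : ℝ) ≤ K * n) :
    (∃ (γ S : Set RP2), IsIrreducibleCubic γ ∧ S.Finite ∧
      (S.ncard : ℝ) ≤ (2 : ℝ) ^ 75 * K ^ 5 ∧ P ⊆ γ ∪ S) ∨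
    (∃ (σ : Set RP2) (Ls : Finset (Set RP2)), IsIrreducibleConic σ ∧
      (∀ L ∈ Ls, IsProjLine L) ∧ (Ls.card : ℝ) ≤ (2 : ℝ) ^ 64 * K ^ 4 ∧
      P ⊆ σ ∪ (⋃ L ∈ Ls, L) ∧
      (n : ℝ) / 2 - (2 : ℝ) ^ 76 * K ^ 5 ≤ ((P ∩ σ).ncard : ℝ) ∧
      ((P ∩ σ).ncard : ℝ) ≤ (n : ℝ) / 2 + (2 : ℝ) ^ 76 * K ^ 5 ∧
      (numOrdinaryLines (P \ σ) : ℝ) ≤ (2 : ℝ) ^ 62 * K ^ 4 * n) ∨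
    (∃ (Ls : Finset (Set RP2)) (S : Set RP2), (∀ L ∈ Ls, IsProjLine L) ∧
      (Ls.card : ℝ) ≤ (2 : ℝ) ^ 16 * K ∧ S.Finite ∧
      (S.ncard : ℝ) ≤ (2 : ℝ) ^ 87 * K ^ 6 ∧
      P ⊆ (⋃ L ∈ Ls, L) ∪ S) := by
  classical
  obtain ⟨P, rfl⟩ : ∃ P' : Finset RP2, P = (P' : Set RP2) := ⟨hfin.toFinset, by simp⟩
  rw [Set.ncard_coe_finset] at hcard
  have hK0 : (0 : ℝ) < K := by linarith
  have hpow : ∀ i, (1 : ℝ) ≤ K ^ i := fun i => one_le_pow₀ hK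
  have hmono : ∀ {i j : ℕ}, i ≤ j → K ^ i ≤ K ^ j := fun hij => pow_le_pow_right₀ hK hij
  by_cases h7 : P.card < 7
  · right; right
    refine ⟨∅, P, by simp, by simp; positivity, hfin, ?_, by simp⟩
    rw [Set.ncard_coe_finset]
    have : (P.card : ℝ) ≤ 7 := by exact_mod_cast h7.le
    nlinarith [hpow 6]
  by_cases hcol : ∃ L, IsProjLine L ∧ (P : Set RP2) ⊆ L
  · right; right
    obtain ⟨L, hL, hPL⟩ := hcol
    refine ⟨{L}, ∅, by simpa using hL, ?_, Set.finite_empty, ?_, by simpa using hPL⟩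
    · simp; linarith
    · simp; positivity
  obtain ⟨β, B, Fs, hsum, hloc⟩ := OL.propB hcol (by omega)
  replace hloc : ∀ p ∈ P, OL.LocAt P p (β p) (B p) (Fs p) := hloc
  have hS : ((∑ p ∈ P, β p : ℕ) : ℝ) ≤ (1205 * K) * P.card := by
    have h1 : ((∑ p ∈ P, β p : ℕ) : ℝ) ≤ 1204 * (numOrdinaryLines (P : Set RP2) : ℝ) + P.card := by
      exact_mod_cast hsum
    rw [← hcard] at hord
    have h2 : (0 : ℝ) ≤ P.card := Nat.cast_nonneg _
    nlinarith
  set C := 1205 * K with hCdef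
  have hC0 : 0 < C := by positivity
  have hC1 : 1 ≤ C := by linarith
  by_cases h3 : ∃ F : OL.MP, Irreducible F ∧ F.IsHomogeneous 3 ∧
      24 * C ≤ (P.filter (fun x => MvPolynomial.eval x.rep F = 0)).card
  · left
    obtain ⟨F, hirr, hF, hT⟩ := h3
    have := OL.case_cubic hloc hC0 hS hirr hF hT
    refine ⟨{x : RP2 | MvPolynomial.eval x.rep F = 0},
      (P.filter (fun x => ¬ MvPolynomial.eval x.rep F = 0) : Finset RP2), ⟨F, hirr, hF, rfl⟩,
      Finset.finite_toSet _, ?_, ?_⟩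
    · rw [Set.ncard_coe_finset]
      have h5 := hmono (show 1 ≤ 5 by norm_num)
      rw [pow_one] at h5
      linarith
    · intro x hx
      by_cases h : MvPolynomial.eval x.rep F = 0
      · exact Or.inl h
      · exact Or.inr (by simpa using ⟨hx, h⟩)
  by_cases h2 : ∃ F : OL.MP, Irreducible F ∧ F.IsHomogeneous 2 ∧
      24 * C ≤ (P.filter (fun x => MvPolynomial.eval x.rep F = 0)).card
  · right; left
    obtain ⟨Q, hirr, hQ, hT⟩ := h2
    obtain ⟨⟨Ls, hL1, hL2, hL3⟩, hd, ho⟩ := OL.case_conic hloc hC1 hS hirr hQ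
      {x : RP2 | MvPolynomial.eval x.rep Q = 0} (fun x => Iff.rfl) (by linarith)
    have hi : ((P : Set RP2) ∩ {x : RP2 | MvPolynomial.eval x.rep Q = 0}).ncard
        = (P.filter (fun x => MvPolynomial.eval x.rep Q = 0)).card := by
      rw [← Set.ncard_coe_finset]
      congr 1
      ext x
      simp
    have h4 := hmono (show 1 ≤ 4 by norm_num)
    have h5 := hmono (show 1 ≤ 5 by norm_num)
    rw [pow_one] at h4 h5
    rw [hcard, abs_le] at hd
    refine ⟨{x : RP2 | MvPolynomial.eval x.rep Q = 0}, Ls, ⟨Q, hirr, hQ, rfl⟩, hL1,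
      by linarith, ?_, ?_, ?_, ?_⟩
    · intro x hx
      by_cases h : MvPolynomial.eval x.rep Q = 0
      · exact Or.inl h
      · right
        obtain ⟨L, hL, hxL⟩ := hL3 x hx h
        exact Set.mem_biUnion hL hxL
    · rw [hi]; linarith [hd.1]
    · rw [hi]; linarith [hd.2]
    · rw [hcard] at ho
      have hn0 : (0 : ℝ) ≤ n := Nat.cast_nonneg _
      have : K * (n : ℝ) ≤ K ^ 4 * n := mul_le_mul_of_nonneg_right h4 hn0
      have h8 : 8 * C * (n : ℝ) = 9640 * (K * n) := by rw [hCdef]; ring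
      have h9 : (0 : ℝ) ≤ K ^ 4 * n := by positivity
      rw [h8] at ho
      rw [mul_assoc]
      linarith
  right; right
  push Not at h3 h2
  have hne : P.Nonempty := by rw [← Finset.card_pos]; omega
  obtain ⟨p, hp, hmin⟩ := Finset.exists_min_image P β hne
  have hb : (β p : ℝ) ≤ C := by
    have h1 : P.card * β p ≤ ∑ p ∈ P, β p := by
      rw [← smul_eq_mul]
      exact Finset.card_nsmul_le_sum _ _ _ hmin
    have h1' : (P.card : ℝ) * β p ≤ ((∑ p ∈ P, β p : ℕ) : ℝ) := by exact_mod_cast h1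
    have h4 : (0 : ℝ) < P.card := by exact_mod_cast Finset.card_pos.2 hne
    have h5 : (P.card : ℝ) * β p ≤ P.card * C := by linarith
    exact le_of_mul_le_mul_left h5 h4
  obtain ⟨Ls, S, l1, l2, l3, l4⟩ := OL.case_lines (P := P) (T := ⌊24 * C⌋₊)
    (fun F hi hF => Nat.le_floor (h3 F hi hF).le) (fun F hi hF => Nat.le_floor (h2 F hi hF).le)
    (hloc p hp)
  refine ⟨Ls, S, l1, ?_, S.finite_toSet, ?_, ?_⟩
  · have : (Ls.card : ℝ) ≤ 4 * β p := by exact_mod_cast l2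
    linarith
  · rw [Set.ncard_coe_finset]
    have e1 : (S.card : ℝ) ≤ β p * (⌊24 * C⌋₊ : ℝ) + 1 := by exact_mod_cast l3
    have e2 : (⌊24 * C⌋₊ : ℝ) ≤ 24 * C := Nat.floor_le (by positivity)
    have e3 : (β p : ℝ) * (⌊24 * C⌋₊ : ℝ) ≤ C * (24 * C) :=
      mul_le_mul hb e2 (Nat.cast_nonneg _) hC0.le
    have e4 : C * (24 * C) = 34848600 * K ^ 2 := by rw [hCdef]; ring
    have e5 := hmono (show 2 ≤ 6 by norm_num)
    have e6 := hpow 6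
    linarith
  · intro x hx
    rcases l4 x hx with ⟨L, hL, hxL⟩ | h
    · exact Or.inl (Set.mem_biUnion hL hxL)
    · exact Or.inr h
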